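/- arXiv:1511.04235 — 2 statements merged into one kernel-verified Lean document; each statement's English description precedes it below -/
import Mathlib

section
/- Let U be a bounded convex plane domain with smooth boundary. Then U is uniquely determined in the class of all bounded plane domains with smooth boundaries by the condition of local isometry of boundaries in the relative metrics; that is, for every bounded plane domain V with smooth boundary, if there exists a bijective local isometry f: ∂U → ∂V in the relative metrics, then there exists a Euclidean isometry J: ℝ² → ℝ² with J(U) = V. -/
open Set Filter Metric Topology ENNReal

noncomputable section

/-- A domain in `ℝⁿ`: a nonempty open connected set. -/
def IsDomainSet {n : ℕ} (U : Set (EuclideanSpace ℝ (Fin n))) : Prop :=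
  IsOpen U ∧ IsConnected U

/-- The infimum of lengths of smooth paths joining `a` and `b` inside `U`. -/
def smoothPathInf {n : ℕ} (U : Set (EuclideanSpace ℝ (Fin n)))
    (a b : EuclideanSpace ℝ (Fin n)) : ℝ≥0∞ :=
  ⨅ (γ : ℝ → EuclideanSpace ℝ (Fin n)) (_ : ContDiff ℝ 1 γ) (_ : γ 0 = a)
    (_ : γ 1 = b) (_ : ∀ t ∈ Icc (0:ℝ) 1, γ t ∈ U), eVariationOn γ (Icc 0 1)

/-- The relative metric `ρ_{∂U,U}`:
`ρ(x,y) = liminf_{x'→x, y'→y; x',y'∈U} inf{length γ : γ smooth path joining x',y' in U}`. -/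
def relDist {n : ℕ} (U : Set (EuclideanSpace ℝ (Fin n)))
    (x y : EuclideanSpace ℝ (Fin n)) : ℝ≥0∞ :=
  Filter.liminf (fun p : EuclideanSpace ℝ (Fin n) × EuclideanSpace ℝ (Fin n) =>
    smoothPathInf U p.1 p.2) ((𝓝[U] x) ×ˢ (𝓝[U] y))

/-- `f` is a bijection of `∂U` onto `∂V` which is a local isometry
in the relative metrics of the boundaries. -/
def IsBoundaryLocalIsometry {n : ℕ} (U V : Set (EuclideanSpace ℝ (Fin n)))
    (f : EuclideanSpace ℝ (Fin n) → EuclideanSpace ℝ (Fin n)) : Prop :=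
  Set.BijOn f (frontier U) (frontier V) ∧
  ∀ y ∈ frontier U, ∃ ε : ℝ≥0∞, 0 < ε ∧ ∀ a ∈ frontier U, ∀ b ∈ frontier U,
    relDist U a y < ε → relDist U b y < ε →
      relDist U a b = relDist V (f a) (f b)

/-- `U` has smooth boundary: `∂U` is an `(n-1)`-dimensional submanifold of
class `C¹` without boundary, i.e. near each of its points the frontier can be
mapped by a `C¹` diffeomorphism onto an open piece of a hyperplane. -/
def HasC1Boundary {n : ℕ} (U : Set (EuclideanSpace ℝ (Fin n))) : Prop :=
  ∀ x ∈ frontier U, ∃ (W W' : Set (EuclideanSpace ℝ (Fin n)))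
    (φ ψ : EuclideanSpace ℝ (Fin n) → EuclideanSpace ℝ (Fin n))
    (ℓ : EuclideanSpace ℝ (Fin n) →L[ℝ] ℝ),
    IsOpen W ∧ x ∈ W ∧ IsOpen W' ∧ ℓ ≠ 0 ∧
    ContDiffOn ℝ 1 φ W ∧ ContDiffOn ℝ 1 ψ W' ∧
    Set.MapsTo φ W W' ∧ Set.MapsTo ψ W' W ∧
    (∀ z ∈ W, ψ (φ z) = z) ∧ (∀ z ∈ W', φ (ψ z) = z) ∧
    φ '' (W ∩ frontier U) = W' ∩ {y | ℓ y = 0}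

/-- The intrinsic distance inside a set `S`: the infimum of lengths of
(continuous) paths joining `a` and `b` inside `S`. -/
def intrinsicDist {n : ℕ} (S : Set (EuclideanSpace ℝ (Fin n)))
    (a b : EuclideanSpace ℝ (Fin n)) : ℝ≥0∞ :=
  ⨅ (γ : ℝ → EuclideanSpace ℝ (Fin n)) (_ : ContinuousOn γ (Icc (0:ℝ) 1))
    (_ : γ 0 = a) (_ : γ 1 = b) (_ : ∀ t ∈ Icc (0:ℝ) 1, γ t ∈ S),
    eVariationOn γ (Icc 0 1)

section PathLength

variable {n : ℕ}

theorem smoothPathInf_le {U : Set (EuclideanSpace ℝ (Fin n))}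
    {γ : ℝ → EuclideanSpace ℝ (Fin n)} (hγ : ContDiff ℝ 1 γ)
    (hU : ∀ t ∈ Icc (0 : ℝ) 1, γ t ∈ U) :
    smoothPathInf U (γ 0) (γ 1) ≤ eVariationOn γ (Icc 0 1) :=
  iInf_le_of_le γ <| iInf_le_of_le hγ <| iInf_le_of_le rfl <| iInf_le_of_le rfl <|
    iInf_le_of_le hU le_rfl

theorem exists_path_of_smoothPathInf_lt {U : Set (EuclideanSpace ℝ (Fin n))}
    {a b : EuclideanSpace ℝ (Fin n)} {M : ℝ≥0∞} (h : smoothPathInf U a b < M) :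
    ∃ γ : ℝ → EuclideanSpace ℝ (Fin n), ContDiff ℝ 1 γ ∧ γ 0 = a ∧ γ 1 = b ∧
      (∀ t ∈ Icc (0 : ℝ) 1, γ t ∈ U) ∧ eVariationOn γ (Icc 0 1) < M := by
  simpa only [smoothPathInf, iInf_lt_iff, exists_prop] using h

theorem edist_le_smoothPathInf (U : Set (EuclideanSpace ℝ (Fin n)))
    (a b : EuclideanSpace ℝ (Fin n)) : edist a b ≤ smoothPathInf U a b := by
  refine le_iInf fun γ => le_iInf fun _ => le_iInf fun h0 => le_iInf fun h1 => le_iInf fun _ => ?_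
  rw [← h0, ← h1]
  exact eVariationOn.edist_le _ (by simp) (by simp)

theorem eVariationOn_lineMap (a b : EuclideanSpace ℝ (Fin n)) :
    eVariationOn (fun t : ℝ => AffineMap.lineMap a b t) (Icc 0 1) ≤ edist a b := by
  have h : LipschitzWith (nndist a b) (fun t : ℝ => AffineMap.lineMap (k := ℝ) a b t) :=
    lipschitzWith_lineMap a b
  calc eVariationOn (fun t : ℝ => AffineMap.lineMap a b t) (Icc 0 1)
      ≤ nndist a b * eVariationOn (id : ℝ → ℝ) (Icc 0 1) :=
        (h.lipschitzOnWith (s := univ)).comp_eVariationOn_le fun _ _ => mem_univ _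
    _ = edist a b := by rw [eVariationOn_id_Icc, edist_nndist]; simp

theorem smoothPathInf_of_segment_subset {U : Set (EuclideanSpace ℝ (Fin n))}
    {a b : EuclideanSpace ℝ (Fin n)} (h : segment ℝ a b ⊆ U) :
    smoothPathInf U a b = edist a b := by
  refine le_antisymm ?_ (edist_le_smoothPathInf U a b)
  have hc : ContDiff ℝ 1 (fun t : ℝ => AffineMap.lineMap (k := ℝ) a b t) := by
    simp only [AffineMap.lineMap_apply_module]
    fun_prop
  have := smoothPathInf_le (U := U) hc fun t ht => h <| by
    rw [segment_eq_image_lineMap]; exact mem_image_of_mem _ ht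
  simpa using this.trans (eVariationOn_lineMap a b)

theorem smoothPathInf_subpath_le {U : Set (EuclideanSpace ℝ (Fin n))}
    {γ : ℝ → EuclideanSpace ℝ (Fin n)} (hγ : ContDiff ℝ 1 γ) {s t : ℝ} (hst : s ≤ t)
    (hU : ∀ r ∈ Icc s t, γ r ∈ U) :
    smoothPathInf U (γ s) (γ t) ≤ eVariationOn γ (Icc s t) := by
  have hm : ∀ u ∈ Icc (0:ℝ) 1, s + u * (t - s) ∈ Icc s t := by
    rintro u ⟨h0, h1⟩
    constructor <;> nlinarith
  have hc : ContDiff ℝ 1 (γ ∘ fun u : ℝ => s + u * (t - s)) := hγ.comp (by fun_prop)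
  have h := smoothPathInf_le (U := U) hc fun u hu => hU _ (hm u hu)
  have h2 : eVariationOn (γ ∘ fun u : ℝ => s + u * (t - s)) (Icc 0 1) ≤
      eVariationOn γ (Icc s t) := by
    refine eVariationOn.comp_le_of_monotoneOn _ _ ?_ hm
    intro u _ v _ huv
    have := mul_le_mul_of_nonneg_right huv (sub_nonneg.2 hst)
    simpa using this
  simpa using h.trans h2

theorem smoothPathInf_triangle (U : Set (EuclideanSpace ℝ (Fin n)))
    (a b c : EuclideanSpace ℝ (Fin n)) :
    smoothPathInf U a c ≤ smoothPathInf U a b + smoothPathInf U b c := by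
  refine ENNReal.le_of_forall_pos_le_add fun ε hε hfin => ?_
  have hε' : (0 : ℝ≥0∞) < (ε / 2 : NNReal) := ENNReal.coe_pos.2 (half_pos hε)
  obtain ⟨h1, h2⟩ := ENNReal.add_lt_top.1 hfin
  obtain ⟨γ, hγ, hγ0, hγ1, hγU, hγl⟩ :=
    exists_path_of_smoothPathInf_lt (ENNReal.lt_add_right h1.ne hε'.ne')
  obtain ⟨δ, hδ, hδ0, hδ1, hδU, hδl⟩ :=
    exists_path_of_smoothPathInf_lt (ENNReal.lt_add_right h2.ne hε'.ne')
  have hS : ContDiff ℝ 1 Real.smoothTransition := Real.smoothTransition.contDiff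
  have hφ : ContDiff ℝ 1 fun t : ℝ => Real.smoothTransition (2 * t) := hS.comp (by fun_prop)
  have hψ : ContDiff ℝ 1 fun t : ℝ => Real.smoothTransition (2 * t - 1) := hS.comp (by fun_prop)
  let ω : ℝ → EuclideanSpace ℝ (Fin n) := fun t =>
    γ (Real.smoothTransition (2 * t)) + δ (Real.smoothTransition (2 * t - 1)) - b
  have hω : ContDiff ℝ 1 ω := ((hγ.comp hφ).add (hδ.comp hψ)).sub contDiff_const
  have hl : ∀ t ≤ (1 / 2 : ℝ), ω t = γ (Real.smoothTransition (2 * t)) := fun t ht => by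
    simp [ω, Real.smoothTransition.zero_of_nonpos (show 2 * t - 1 ≤ 0 by linarith), hδ0]
  have hr : ∀ t, (1 / 2 : ℝ) ≤ t → ω t = δ (Real.smoothTransition (2 * t - 1)) := fun t ht => by
    simp [ω, Real.smoothTransition.one_of_one_le (show 1 ≤ 2 * t by linarith), hγ1]
  have hmem : ∀ x, Real.smoothTransition x ∈ Icc (0:ℝ) 1 := fun x =>
    ⟨Real.smoothTransition.nonneg x, Real.smoothTransition.le_one x⟩
  have hmono : Monotone Real.smoothTransition := Real.smoothTransition.monotone
  have hωU : ∀ t ∈ Icc (0:ℝ) 1, ω t ∈ U := fun t _ => by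
    rcases le_total t (1 / 2) with h | h
    · rw [hl t h]; exact hγU _ (hmem _)
    · rw [hr t h]; exact hδU _ (hmem _)
  have key := smoothPathInf_le hω hωU
  have e0 : ω 0 = a := by
    rw [hl 0 (by norm_num)]; simpa using hγ0
  have e1 : ω 1 = c := by
    rw [hr 1 (by norm_num), show (2 * 1 - 1 : ℝ) = 1 by norm_num]
    simpa using hδ1
  rw [e0, e1] at key
  have hsplit := eVariationOn.Icc_add_Icc ω (s := univ) (a := 0) (b := 1 / 2) (c := 1)
    (by norm_num) (by norm_num) (mem_univ _)
  simp only [univ_inter] at hsplit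
  have hA : eVariationOn ω (Icc 0 (1 / 2)) ≤ eVariationOn γ (Icc 0 1) := by
    rw [eVariationOn.congr (fun t ht => hl t ht.2 :
      EqOn ω (γ ∘ fun t => Real.smoothTransition (2 * t)) (Icc 0 (1 / 2)))]
    exact eVariationOn.comp_le_of_monotoneOn _ _
      (fun x _ y _ hxy => hmono (by linarith)) fun t _ => hmem _
  have hB : eVariationOn ω (Icc (1 / 2) 1) ≤ eVariationOn δ (Icc 0 1) := by
    rw [eVariationOn.congr (fun t ht => hr t ht.1 :
      EqOn ω (δ ∘ fun t => Real.smoothTransition (2 * t - 1)) (Icc (1 / 2) 1))]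
    exact eVariationOn.comp_le_of_monotoneOn _ _
      (fun x _ y _ hxy => hmono (by linarith)) fun t _ => hmem _
  calc smoothPathInf U a c ≤ eVariationOn γ (Icc 0 1) + eVariationOn δ (Icc 0 1) :=
        key.trans (hsplit ▸ add_le_add hA hB)
    _ ≤ (smoothPathInf U a b + (ε / 2 : NNReal)) + (smoothPathInf U b c + (ε / 2 : NNReal)) :=
        add_le_add hγl.le hδl.le
    _ = smoothPathInf U a b + smoothPathInf U b c + ε := by
        rw [add_add_add_comm, ← ENNReal.coe_add, add_halves]

theorem exists_param_of_smoothPathInf_lt {U : Set (EuclideanSpace ℝ (Fin n))}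
    {a b : EuclideanSpace ℝ (Fin n)} {M : ℝ}
    (h : smoothPathInf U a b < ENNReal.ofReal M) :
    ∃ c : ℝ → EuclideanSpace ℝ (Fin n), c 0 = a ∧ c 1 = b ∧ (∀ t ∈ Icc (0 : ℝ) 1, c t ∈ U) ∧
      ∀ s ∈ Icc (0 : ℝ) 1, ∀ t ∈ Icc (0 : ℝ) 1, s ≤ t →
        smoothPathInf U (c s) (c t) ≤ ENNReal.ofReal (M * (t - s)) := by
  obtain ⟨γ, hγ, hγ0, hγ1, hγU, hγl⟩ := exists_path_of_smoothPathInf_lt h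
  obtain ⟨C, hC⟩ := (hγ.contDiffOn (s := Icc 0 1)).exists_lipschitzOnWith one_ne_zero
    (convex_Icc 0 1) isCompact_Icc
  have hLip : ∀ s t, 0 ≤ s → s ≤ t → t ≤ 1 →
      eVariationOn γ (Icc s t) ≤ ENNReal.ofReal (C * (t - s)) := by
    intro s t hs hst ht
    have := hC.comp_eVariationOn_le (g := id) (s := Icc s t)
      (fun x hx => ⟨hs.trans hx.1, hx.2.trans ht⟩)
    rw [eVariationOn_id_Icc] at this
    refine this.trans_eq ?_
    rw [ENNReal.ofReal_mul C.coe_nonneg, ENNReal.ofReal_coe_nnreal]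
  have hfin : ∀ s t, 0 ≤ s → s ≤ t → t ≤ 1 → eVariationOn γ (Icc s t) ≠ ⊤ :=
    fun s t hs hst ht => ((hLip s t hs hst ht).trans_lt ENNReal.ofReal_lt_top).ne
  let L : ℝ → ℝ := fun t => (eVariationOn γ (Icc 0 t)).toReal
  have hadd : ∀ s t, 0 ≤ s → s ≤ t → t ≤ 1 →
      eVariationOn γ (Icc s t) = ENNReal.ofReal (L t - L s) := by
    intro s t hs hst ht
    have hsplit := eVariationOn.Icc_add_Icc γ (s := univ) hs hst (mem_univ _)
    simp only [univ_inter] at hsplit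
    simp only [L]
    rw [← hsplit, ENNReal.toReal_add (hfin 0 s le_rfl hs (hst.trans ht)) (hfin s t hs hst ht),
      add_sub_cancel_left, ENNReal.ofReal_toReal (hfin s t hs hst ht)]
  have hmono : ∀ s t, 0 ≤ s → s ≤ t → t ≤ 1 → L s ≤ L t := by
    intro s t hs hst ht
    exact ENNReal.toReal_mono (hfin 0 t le_rfl (hs.trans hst) ht)
      (eVariationOn.mono _ (Icc_subset_Icc_right hst))
  have hcont : ContinuousOn L (Icc 0 1) := by
    refine (LipschitzOnWith.of_dist_le_mul (K := C) ?_).continuousOn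
    have aux : ∀ s t, 0 ≤ s → s ≤ t → t ≤ 1 → dist (L s) (L t) ≤ C * dist s t := by
      intro s t hs hst ht
      rw [dist_comm, dist_comm s, Real.dist_eq, Real.dist_eq, abs_of_nonneg (sub_nonneg.2 hst),
        abs_of_nonneg (sub_nonneg.2 (hmono s t hs hst ht))]
      have := hLip s t hs hst ht
      rw [hadd s t hs hst ht] at this
      exact (ENNReal.ofReal_le_ofReal_iff (mul_nonneg C.2 (sub_nonneg.2 hst))).1 this
    intro s hs t ht
    rcases le_total s t with hst | hst
    · exact aux s t hs.1 hst ht.2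
    · rw [dist_comm, dist_comm s]; exact aux t s ht.1 hst hs.2
  have hL0 : L 0 = 0 := by simp [L, eVariationOn.subsingleton]
  have hL1 : 0 ≤ L 1 := ENNReal.toReal_nonneg
  have hL1M : L 1 ≤ M := by
    have hM : 0 < M := ENNReal.ofReal_pos.1 (bot_lt_of_lt h)
    exact ENNReal.toReal_le_of_le_ofReal hM.le hγl.le
  have hIVT : ∀ r ∈ Icc (0:ℝ) 1, ∃ t ∈ Icc (0:ℝ) 1, L t = r * L 1 ∧ (r = 0 → t = 0) ∧
      (r = 1 → t = 1) := by
    intro r hr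
    rcases eq_or_ne r 0 with rfl | h0
    · exact ⟨0, by simp, by simp [hL0], by simp, by simp⟩
    rcases eq_or_ne r 1 with rfl | h1
    · exact ⟨1, by simp, by simp, by simp, by simp⟩
    have : r * L 1 ∈ Icc (L 0) (L 1) := by
      rw [hL0]
      exact ⟨mul_nonneg hr.1 hL1, mul_le_of_le_one_left hL1 hr.2⟩
    obtain ⟨t, ht, hLt⟩ := intermediate_value_Icc zero_le_one hcont this
    exact ⟨t, ht, hLt, fun h => absurd h h0, fun h => absurd h h1⟩
  choose! τ hτ hLτ hτ0 hτ1 using hIVT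
  refine ⟨γ ∘ τ, ?_, ?_, fun t ht => hγU _ (hτ t ht), ?_⟩
  · simp [hτ0 0 (by simp) rfl, hγ0]
  · simp [hτ1 1 (by simp) rfl, hγ1]
  intro s hs t ht hst
  rcases le_total (τ s) (τ t) with hle | hle
  · refine (smoothPathInf_subpath_le hγ hle fun r hr =>
      hγU r ⟨(hτ s hs).1.trans hr.1, hr.2.trans (hτ t ht).2⟩).trans ?_
    rw [hadd _ _ (hτ s hs).1 hle (hτ t ht).2, hLτ s hs, hLτ t ht, ← sub_mul, mul_comm]
    exact ENNReal.ofReal_le_ofReal (mul_le_mul_of_nonneg_right hL1M (sub_nonneg.2 hst))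
  · have h1 := hmono _ _ (hτ t ht).1 hle (hτ s hs).2
    have h2 : L (τ s) ≤ L (τ t) := by
      rw [hLτ s hs, hLτ t ht]; exact mul_le_mul_of_nonneg_right hst hL1
    have h3 := hadd _ _ (hτ t ht).1 hle (hτ s hs).2
    rw [le_antisymm h1 h2, sub_self, ENNReal.ofReal_zero] at h3
    have h4 : γ (τ s) = γ (τ t) := by
      have := eVariationOn.edist_le γ (s := Icc (τ t) (τ s)) (right_mem_Icc.2 hle)
        (left_mem_Icc.2 hle)
      rw [h3] at this
      exact edist_le_zero.1 this
    have h5 : smoothPathInf U (γ (τ t)) (γ (τ t)) = 0 := by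
      rw [smoothPathInf_of_segment_subset]
      · simp
      · simpa using hγU _ (hτ t ht)
    simp [Function.comp, h4, h5]

end PathLength

section RelativeDistance

variable {n : ℕ} {U : Set (EuclideanSpace ℝ (Fin n))}

theorem nhdsWithin_prod_neBot {a b : EuclideanSpace ℝ (Fin n)} (ha : a ∈ closure U)
    (hb : b ∈ closure U) : ((𝓝[U] a) ×ˢ (𝓝[U] b)).NeBot := by
  have := mem_closure_iff_nhdsWithin_neBot.1 ha
  have := mem_closure_iff_nhdsWithin_neBot.1 hb
  infer_instance

theorem tendsto_edist_nhdsWithin_prod (a b : EuclideanSpace ℝ (Fin n)) :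
    Tendsto (fun p : EuclideanSpace ℝ (Fin n) × EuclideanSpace ℝ (Fin n) => edist p.1 p.2)
      ((𝓝[U] a) ×ˢ (𝓝[U] b)) (𝓝 (edist a b)) := by
  have h : Tendsto (fun p : EuclideanSpace ℝ (Fin n) × EuclideanSpace ℝ (Fin n) =>
      edist p.1 p.2) (𝓝 (a, b)) (𝓝 (edist a b)) :=
    (continuous_edist.tendsto (a, b))
  refine h.mono_left ?_
  rw [nhds_prod_eq]
  exact Filter.prod_mono nhdsWithin_le_nhds nhdsWithin_le_nhds

theorem edist_le_relDist {a b : EuclideanSpace ℝ (Fin n)} (ha : a ∈ closure U)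
    (hb : b ∈ closure U) : edist a b ≤ relDist U a b := by
  have := nhdsWithin_prod_neBot ha hb
  rw [← (tendsto_edist_nhdsWithin_prod (U := U) a b).liminf_eq]
  exact liminf_le_liminf (Eventually.of_forall fun p => edist_le_smoothPathInf U p.1 p.2)

theorem relDist_of_convex (hU : Convex ℝ U) {a b : EuclideanSpace ℝ (Fin n)}
    (ha : a ∈ closure U) (hb : b ∈ closure U) : relDist U a b = edist a b := by
  have := nhdsWithin_prod_neBot ha hb
  rw [← (tendsto_edist_nhdsWithin_prod (U := U) a b).liminf_eq]
  refine liminf_congr ?_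
  filter_upwards [prod_mem_prod self_mem_nhdsWithin self_mem_nhdsWithin] with p hp
  exact smoothPathInf_of_segment_subset (hU.segment_subset hp.1 hp.2)

theorem relDist_le_of_tendsto {ι : Type*} {l : Filter ι} [l.NeBot]
    {a b : EuclideanSpace ℝ (Fin n)} {x y : ι → EuclideanSpace ℝ (Fin n)} {m : ι → ℝ≥0∞}
    {c : ℝ≥0∞} (hx : Tendsto x l (𝓝[U] a)) (hy : Tendsto y l (𝓝[U] b))
    (hm : ∀ᶠ i in l, smoothPathInf U (x i) (y i) ≤ m i) (hc : Tendsto m l (𝓝 c)) :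
    relDist U a b ≤ c := by
  have h : Tendsto (fun i => (x i, y i)) l ((𝓝[U] a) ×ˢ (𝓝[U] b)) := hx.prodMk hy
  calc relDist U a b ≤ liminf (fun p : EuclideanSpace ℝ (Fin n) × EuclideanSpace ℝ (Fin n) =>
        smoothPathInf U p.1 p.2) (map (fun i => (x i, y i)) l) :=
        liminf_le_liminf_of_le h
    _ = liminf (fun i => smoothPathInf U (x i) (y i)) l := rfl
    _ ≤ liminf m l := liminf_le_liminf hm
    _ = c := hc.liminf_eq

end RelativeDistance

section Geodesics

theorem eq_lineMap_of_locally_affine {E : Type*} [NormedAddCommGroup E] [NormedSpace ℝ E]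
    {σ : ℝ → E} (hσ : ContinuousOn σ (Icc 0 1))
    (h : ∀ t ∈ Ioo (0 : ℝ) 1, ∃ w : E, ∀ᶠ s in 𝓝 t, σ s = σ t + (s - t) • w) :
    ∀ s ∈ Icc (0 : ℝ) 1, σ s = AffineMap.lineMap (σ 0) (σ 1) s := by
  have hderiv : ∀ t ∈ Ioo (0 : ℝ) 1, ∃ w : E, ∀ᶠ s in 𝓝 t, HasDerivAt σ w s := by
    intro t ht
    obtain ⟨w, hw⟩ := h t ht
    refine ⟨w, ?_⟩
    filter_upwards [hw.eventually_nhds] with s hs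
    have h1 : HasDerivAt (fun s => σ t + (s - t) • w) ((1 : ℝ) • w) s :=
      (((hasDerivAt_id s).sub_const t).smul_const w).const_add _
    rw [one_smul] at h1
    exact h1.congr_of_eventuallyEq hs
  have hd1 : DifferentiableOn ℝ (deriv σ) (Ioo 0 1) := by
    intro t ht
    obtain ⟨w, hw⟩ := hderiv t ht
    have : deriv σ =ᶠ[𝓝 t] fun _ => w := hw.mono fun s hs => hs.deriv
    exact (this.differentiableAt_iff.2 (differentiableAt_const _)).differentiableWithinAt
  have hd2 : EqOn (deriv (deriv σ)) 0 (Ioo 0 1) := by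
    intro t ht
    obtain ⟨w, hw⟩ := hderiv t ht
    have : deriv σ =ᶠ[𝓝 t] fun _ => w := hw.mono fun s hs => hs.deriv
    simp [this.deriv_eq]
  obtain ⟨v, hv⟩ := isOpen_Ioo.exists_is_const_of_deriv_eq_zero isPreconnected_Ioo hd1 hd2
  have hd3 : ∀ t ∈ Ioo (0 : ℝ) 1, HasDerivAt (fun s => σ s - s • v) 0 t := by
    intro t ht
    obtain ⟨w, hw⟩ := hderiv t ht
    have h1 := hw.self_of_nhds
    have h2 : v = w := by rw [← hv t ht, h1.deriv]
    subst h2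
    have h3 := h1.sub ((hasDerivAt_id t).smul_const v)
    rw [one_smul, sub_self] at h3
    exact h3
  obtain ⟨k, hk⟩ := isOpen_Ioo.exists_is_const_of_deriv_eq_zero isPreconnected_Ioo
    (fun t ht => (hd3 t ht).differentiableAt.differentiableWithinAt) fun t ht => (hd3 t ht).deriv
  have hk' : EqOn σ (fun s => k + s • v) (Icc 0 1) := by
    refine EqOn.of_subset_closure (s := Ioo 0 1) (fun t ht => ?_) hσ (by fun_prop)
      Ioo_subset_Icc_self (by rw [closure_Ioo zero_ne_one])
    rw [← hk t ht]; simp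
  intro s hs
  rw [hk' hs, hk' (left_mem_Icc.2 zero_le_one), hk' (right_mem_Icc.2 zero_le_one)]
  simp [AffineMap.lineMap_apply_module, sub_smul]
  abel

theorem locally_affine_of_dist_eq {E : Type*} [NormedAddCommGroup E] [InnerProductSpace ℝ E]
    {σ : ℝ → E} {L t δ : ℝ} (hδ : 0 < δ)
    (h : ∀ a b, |a - t| < δ → |b - t| < δ → a < b → dist (σ a) (σ b) = L * (b - a)) :
    ∃ w : E, ∀ᶠ s in 𝓝 t, σ s = σ t + (s - t) • w := by
  set α := t - δ / 2 with hα
  set β := t + δ / 2 with hβ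
  have hαβ : dist (σ α) (σ β) = L * (β - α) :=
    h α β (by simp [hα, abs_of_pos, hδ]) (by simp [hβ, abs_of_pos, hδ]) (by linarith)
  have key : ∀ s, α < s → s < β →
      σ s = AffineMap.lineMap (σ α) (σ β) ((s - α) / (β - α)) := by
    intro s h1 h2
    have hne : β - α ≠ 0 := by linarith
    have e1 : dist (σ α) (σ s) = L * (s - α) :=
      h α s (by simp [hα, abs_of_pos, hδ]) (by rw [abs_lt]; constructor <;> linarith) h1
    have e2 : dist (σ s) (σ β) = L * (β - s) :=
      h s β (by rw [abs_lt]; constructor <;> linarith) (by simp [hβ, abs_of_pos, hδ]) h2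
    refine eq_lineMap_of_dist_eq_mul_of_dist_eq_mul ?_ ?_
    · rw [e1, hαβ]; field_simp
    · rw [e2, hαβ]; field_simp; ring
  refine ⟨(β - α)⁻¹ • (σ β - σ α), ?_⟩
  filter_upwards [Ioo_mem_nhds (show α < t by linarith) (show t < β by linarith)] with s hs
  rw [key s hs.1 hs.2, key t (by linarith) (by linarith)]
  simp only [AffineMap.lineMap_apply_module']
  rw [smul_smul, add_right_comm, ← add_smul]
  congr 2
  have hne : β - α ≠ 0 := by linarith
  field_simp
  ring

variable {n : ℕ} {V : Set (EuclideanSpace ℝ (Fin n))}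

theorem dist_eq_of_geodesics_interior (hV : IsOpen V) (hVb : Bornology.IsBounded V)
    {p q : EuclideanSpace ℝ (Fin n)} {L : ℝ} (hL : 0 ≤ L)
    (hp : p ∈ closure V) (hq : q ∈ closure V) (hpq : relDist V p q = ENNReal.ofReal L)
    (hmid : ∀ r ∈ Ioo (0 : ℝ) 1, ∀ z ∈ closure V, relDist V p z ≤ ENNReal.ofReal (r * L) →
      relDist V z q ≤ ENNReal.ofReal ((1 - r) * L) → z ∈ V) :
    dist p q = L := by
  have := nhdsWithin_prod_neBot hp hq
  have hseq : ∀ k : ℕ, ∃ x y : EuclideanSpace ℝ (Fin n), x ∈ V ∧ y ∈ V ∧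
      dist x p < 1 / ((k : ℝ) + 1) ∧ dist y q < 1 / ((k : ℝ) + 1) ∧
      smoothPathInf V x y < ENNReal.ofReal (L + 1 / ((k : ℝ) + 1)) := by
    intro k
    have hk : (0 : ℝ) < 1 / ((k : ℝ) + 1) := by positivity
    have hlt : relDist V p q < ENNReal.ofReal (L + 1 / ((k : ℝ) + 1)) := by
      rw [hpq]; exact (ENNReal.ofReal_lt_ofReal_iff (by positivity)).2 (by linarith)
    have hf := frequently_lt_of_liminf_lt (h := hlt)
    have hev : ∀ᶠ z in (𝓝[V] p) ×ˢ (𝓝[V] q), z ∈ (V ∩ ball p (1 / ((k : ℝ) + 1))) ×ˢ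
        (V ∩ ball q (1 / ((k : ℝ) + 1))) :=
      prod_mem_prod (inter_mem self_mem_nhdsWithin (mem_nhdsWithin_of_mem_nhds (ball_mem_nhds _ hk)))
        (inter_mem self_mem_nhdsWithin (mem_nhdsWithin_of_mem_nhds (ball_mem_nhds _ hk)))
    obtain ⟨z, hz1, hz2⟩ := (hf.and_eventually hev).exists
    exact ⟨z.1, z.2, hz2.1.1, hz2.2.1, hz2.1.2, hz2.2.2, hz1⟩
  choose x y hxV hyV hxp hyq hxy using hseq
  choose c hc0 hc1 hcV hc using fun k => exists_param_of_smoothPathInf_lt (hxy k)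
  let 𝒰 : Ultrafilter ℕ := hyperfilter ℕ
  have h𝒰 : (𝒰 : Filter ℕ) ≤ atTop := Nat.hyperfilter_le_atTop
  have hinv : Tendsto (fun k : ℕ => 1 / ((k : ℝ) + 1)) 𝒰 (𝓝 0) :=
    tendsto_one_div_add_atTop_nhds_zero_nat.mono_left h𝒰
  have hM : Tendsto (fun k : ℕ => L + 1 / ((k : ℝ) + 1)) 𝒰 (𝓝 L) := by
    simpa using hinv.const_add L
  have hx : Tendsto x 𝒰 (𝓝 p) := tendsto_iff_dist_tendsto_zero.2 <|
    squeeze_zero (fun _ => dist_nonneg) (fun k => (hxp k).le) hinv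
  have hy : Tendsto y 𝒰 (𝓝 q) := tendsto_iff_dist_tendsto_zero.2 <|
    squeeze_zero (fun _ => dist_nonneg) (fun k => (hyq k).le) hinv
  have hlim : ∀ t ∈ Icc (0 : ℝ) 1, ∃ z ∈ closure V, Tendsto (fun k => c k t) 𝒰 (𝓝 z) := by
    intro t ht
    have hK : IsCompact (closure V) := hVb.isCompact_closure
    obtain ⟨z, hz, hz'⟩ := hK.ultrafilter_le_nhds (𝒰.map fun k => c k t) (by
      rw [le_principal_iff]
      exact mem_map.2 (univ_mem' fun k => subset_closure (hcV k t ht)))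
    exact ⟨z, hz, hz'⟩
  choose! γ hγV hγ using hlim
  have h0 : (0 : ℝ) ∈ Icc (0 : ℝ) 1 := left_mem_Icc.2 zero_le_one
  have h1 : (1 : ℝ) ∈ Icc (0 : ℝ) 1 := right_mem_Icc.2 zero_le_one
  have hγ0 : γ 0 = p := tendsto_nhds_unique (hγ 0 h0) (by simpa only [hc0] using hx)
  have hγ1 : γ 1 = q := tendsto_nhds_unique (hγ 1 h1) (by simpa only [hc1] using hy)
  have hin : ∀ t ∈ Icc (0 : ℝ) 1, Tendsto (fun k => c k t) 𝒰 (𝓝[V] (γ t)) := fun t ht =>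
    tendsto_nhdsWithin_iff.2 ⟨hγ t ht, Eventually.of_forall fun k => hcV k t ht⟩
  have hMr : ∀ r : ℝ, Tendsto (fun k : ℕ => ENNReal.ofReal ((L + 1 / ((k : ℝ) + 1)) * r)) 𝒰
      (𝓝 (ENNReal.ofReal (L * r))) := fun r =>
    (ENNReal.continuous_ofReal.tendsto _).comp (hM.mul_const r)
  have hrel : ∀ s ∈ Icc (0 : ℝ) 1, ∀ t ∈ Icc (0 : ℝ) 1, s ≤ t →
      relDist V (γ s) (γ t) ≤ ENNReal.ofReal (L * (t - s)) := fun s hs t ht hst =>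
    relDist_le_of_tendsto (hin s hs) (hin t ht)
      (Eventually.of_forall fun k => hc k s hs t ht hst) (hMr _)
  have hdist : ∀ s ∈ Icc (0 : ℝ) 1, ∀ t ∈ Icc (0 : ℝ) 1, s ≤ t →
      dist (γ s) (γ t) ≤ L * (t - s) := by
    intro s hs t ht hst
    have := (edist_le_relDist (hγV s hs) (hγV t ht)).trans (hrel s hs t ht hst)
    rw [edist_dist] at this
    exact (ENNReal.ofReal_le_ofReal_iff (mul_nonneg hL (sub_nonneg.2 hst))).1 this
  have hdist' : ∀ s ∈ Icc (0 : ℝ) 1, ∀ t ∈ Icc (0 : ℝ) 1, dist (γ s) (γ t) ≤ L * dist s t := by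
    intro s hs t ht
    rcases le_total s t with hst | hst
    · rw [dist_comm s, Real.dist_eq, abs_of_nonneg (sub_nonneg.2 hst)]; exact hdist s hs t ht hst
    · rw [dist_comm, Real.dist_eq, abs_of_nonneg (sub_nonneg.2 hst)]; exact hdist t ht s hs hst
  have hcont : ContinuousOn γ (Icc 0 1) :=
    (LipschitzOnWith.of_dist_le_mul (K := ⟨L, hL⟩) hdist').continuousOn
  have hγmem : ∀ t ∈ Ioo (0 : ℝ) 1, γ t ∈ V := by
    intro t ht
    have ht' := Ioo_subset_Icc_self ht
    refine hmid t ht _ (hγV t ht') ?_ ?_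
    · have := hrel 0 h0 t ht' ht.1.le
      rwa [hγ0, sub_zero, mul_comm] at this
    · have := hrel t ht' 1 h1 ht.2.le
      rwa [hγ1, mul_comm] at this
  have hloc : ∀ t ∈ Ioo (0 : ℝ) 1, ∃ δ > 0, ∀ a b, |a - t| < δ → |b - t| < δ → a < b →
      a ∈ Icc (0 : ℝ) 1 ∧ b ∈ Icc (0 : ℝ) 1 ∧ dist (γ a) (γ b) = L * (b - a) := by
    intro t ht
    obtain ⟨ρ, hρ, hball⟩ := Metric.isOpen_iff.1 hV _ (hγmem t ht)
    have hnear : ∀ᶠ s in 𝓝 t, γ s ∈ ball (γ t) ρ ∧ s ∈ Icc (0 : ℝ) 1 :=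
      ((hcont.continuousAt (Icc_mem_nhds ht.1 ht.2)).eventually (ball_mem_nhds _ hρ)).and
        (Icc_mem_nhds ht.1 ht.2)
    obtain ⟨δ, hδ, hδ'⟩ := Metric.eventually_nhds_iff.1 hnear
    refine ⟨δ, hδ, fun a b ha hb hab => ?_⟩
    obtain ⟨ha1, ha2⟩ := hδ' (show dist a t < δ from ha)
    obtain ⟨hb1, hb2⟩ := hδ' (show dist b t < δ from hb)
    refine ⟨ha2, hb2, le_antisymm (hdist a ha2 b hb2 hab.le) ?_⟩
    have hseg : ∀ᶠ k in (𝒰 : Filter ℕ),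
        smoothPathInf V (c k a) (c k b) = edist (c k a) (c k b) := by
      filter_upwards [(hγ a ha2).eventually (isOpen_ball.mem_nhds ha1),
        (hγ b hb2).eventually (isOpen_ball.mem_nhds hb1)] with k hk1 hk2
      exact smoothPathInf_of_segment_subset
        (((convex_ball (γ t) ρ).segment_subset hk1 hk2).trans hball)
    have hbound : ∀ᶠ k in (𝒰 : Filter ℕ), smoothPathInf V (x k) (y k) ≤
        ENNReal.ofReal ((L + 1 / ((k : ℝ) + 1)) * a) + edist (c k a) (c k b) +
        ENNReal.ofReal ((L + 1 / ((k : ℝ) + 1)) * (1 - b)) := by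
      filter_upwards [hseg] with k hk
      have i1 := hc k 0 h0 a ha2 ha2.1
      have i2 := hc k b hb2 1 h1 hb2.2
      rw [hc0, sub_zero] at i1
      rw [hc1] at i2
      rw [← hk]
      exact (smoothPathInf_triangle V _ (c k b) _).trans
        (add_le_add ((smoothPathInf_triangle V _ (c k a) _).trans (add_le_add i1 le_rfl)) i2)
    have hxin : Tendsto x 𝒰 (𝓝[V] p) :=
      tendsto_nhdsWithin_iff.2 ⟨hx, Eventually.of_forall hxV⟩
    have hyin : Tendsto y 𝒰 (𝓝[V] q) :=
      tendsto_nhdsWithin_iff.2 ⟨hy, Eventually.of_forall hyV⟩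
    have hfin := relDist_le_of_tendsto hxin hyin hbound
      (((hMr a).add ((hγ a ha2).edist (hγ b hb2))).add (hMr (1 - b)))
    have ha0 : 0 ≤ L * a := mul_nonneg hL ha2.1
    have hb0 : 0 ≤ L * (1 - b) := mul_nonneg hL (by linarith [hb2.2])
    rw [hpq, edist_dist, ← ENNReal.ofReal_add ha0 dist_nonneg,
      ← ENNReal.ofReal_add (by positivity) hb0,
      ENNReal.ofReal_le_ofReal_iff (by positivity)] at hfin
    linarith
  have haff := eq_lineMap_of_locally_affine hcont fun t ht => by
    obtain ⟨δ, hδ, h⟩ := hloc t ht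
    exact locally_affine_of_dist_eq hδ fun a b ha hb hab => (h a b ha hb hab).2.2
  obtain ⟨δ, hδ, h⟩ := hloc (1 / 2) (by norm_num)
  obtain ⟨ha, hb, hab⟩ := h (1 / 2 - δ / 2) (1 / 2 + δ / 2) (by simp [abs_of_pos, hδ])
    (by simp [abs_of_pos, hδ]) (by linarith)
  rw [haff _ ha, haff _ hb, dist_lineMap_lineMap, hγ0, hγ1, Real.dist_eq, abs_sub_comm,
    abs_of_pos (by linarith), mul_comm] at hab
  exact mul_right_cancel₀ (by linarith) hab

end Geodesics

section Contact

variable {n : ℕ}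

theorem HasC1Boundary.exists_defining_function {V : Set (EuclideanSpace ℝ (Fin n))}
    (hV : HasC1Boundary V) {v : EuclideanSpace ℝ (Fin n)} (hv : v ∈ frontier V) :
    ∃ (W : Set (EuclideanSpace ℝ (Fin n))) (G : EuclideanSpace ℝ (Fin n) → ℝ),
      IsOpen W ∧ v ∈ W ∧ ContDiffOn ℝ 1 G W ∧ (∀ z ∈ W, z ∈ frontier V ↔ G z = 0) ∧
      ∀ m : EuclideanSpace ℝ (Fin n), (∀ z ∈ frontier V, inner ℝ m (z - v) ≤ 0) →
        ∃ k : ℝ, ∀ w, inner ℝ m w = k * fderiv ℝ G v w := by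
  obtain ⟨W, W', φ, ψ, ℓ, hW, hvW, hW', hℓ, hφ, hψ, hφW, hψW, hψφ, hφψ, himg⟩ := hV v hv
  have hφv : φ v ∈ W' := hφW hvW
  have hiff : ∀ z ∈ W, z ∈ frontier V ↔ ℓ (φ z) = 0 := by
    intro z hz
    constructor
    · intro h
      have : φ z ∈ W' ∩ {y | ℓ y = 0} := himg ▸ mem_image_of_mem φ ⟨hz, h⟩
      exact this.2
    · intro h
      have : φ z ∈ φ '' (W ∩ frontier V) := himg ▸ ⟨hφW hz, h⟩
      obtain ⟨z', hz', hzz⟩ := this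
      rw [← hψφ z hz, ← hzz, hψφ z' hz'.1]
      exact hz'.2
  have hdφ : HasFDerivAt φ (fderiv ℝ φ v) v :=
    ((hφ.differentiableOn one_ne_zero).differentiableAt (hW.mem_nhds hvW)).hasFDerivAt
  have hdψ : HasFDerivAt ψ (fderiv ℝ ψ (φ v)) (φ v) :=
    ((hψ.differentiableOn one_ne_zero).differentiableAt (hW'.mem_nhds hφv)).hasFDerivAt
  have hψφ' : ∀ w, fderiv ℝ ψ (φ v) (fderiv ℝ φ v w) = w := by
    intro w
    have h1 : HasFDerivAt (ψ ∘ φ) ((fderiv ℝ ψ (φ v)).comp (fderiv ℝ φ v)) v := hdψ.comp v hdφ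
    have h2 : HasFDerivAt (ψ ∘ φ) (ContinuousLinearMap.id ℝ (EuclideanSpace ℝ (Fin n))) v :=
      (hasFDerivAt_id v).congr_of_eventuallyEq <| by
        filter_upwards [hW.mem_nhds hvW] with z hz using hψφ z hz
    exact DFunLike.congr_fun (h1.unique h2) w
  have hdG : HasFDerivAt (fun z => ℓ (φ z)) (ℓ.comp (fderiv ℝ φ v)) v :=
    ℓ.hasFDerivAt.comp v hdφ
  refine ⟨W, fun z => ℓ (φ z), hW, hvW, ℓ.contDiff.comp_contDiffOn hφ, hiff, fun m hm => ?_⟩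
  rw [hdG.fderiv]
  have hker : ∀ w, ℓ (fderiv ℝ φ v w) = 0 → inner ℝ m w = 0 := by
    intro w hw
    set y : ℝ → EuclideanSpace ℝ (Fin n) := fun s => φ v + s • fderiv ℝ φ v w with hy
    have hy' : HasDerivAt y (fderiv ℝ φ v w) 0 := by
      have := ((hasDerivAt_id (0 : ℝ)).smul_const (fderiv ℝ φ v w)).const_add (φ v)
      rw [one_smul] at this
      exact this
    have hy0 : y 0 = φ v := by simp [hy]
    have hℓv : ℓ (φ v) = 0 := (hiff v hvW).1 hv
    have hc : HasDerivAt (fun s => inner ℝ m (ψ (y s) - v)) (inner ℝ m w) 0 := by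
      rw [← hy0] at hdψ
      have h1 : HasDerivAt (ψ ∘ y) (fderiv ℝ ψ (y 0) (fderiv ℝ φ v w)) 0 :=
        hdψ.comp_hasDerivAt 0 hy'
      rw [hy0, hψφ'] at h1
      exact ((innerSL ℝ m).hasFDerivAt.comp_hasDerivAt (0 : ℝ) (h1.sub_const v))
    have hmax : IsLocalMax (fun s => inner ℝ m (ψ (y s) - v)) 0 := by
      have : ∀ᶠ s in 𝓝 (0 : ℝ), y s ∈ W' :=
        hy'.continuousAt.eventually (hW'.mem_nhds (hy0 ▸ hφv))
      filter_upwards [this] with s hs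
      have h0 : inner ℝ m (ψ (y 0) - v) = 0 := by rw [hy0, hψφ v hvW]; simp
      rw [h0]
      refine hm _ ?_
      have : y s ∈ φ '' (W ∩ frontier V) := by
        rw [himg]; exact ⟨hs, by simp [hy, hw, hℓv]⟩
      obtain ⟨z', hz', hzz⟩ := this
      rw [← hzz, hψφ z' hz'.1]
      exact hz'.2
    exact hmax.hasDerivAt_eq_zero hc
  by_cases h0 : ∀ w, ℓ (fderiv ℝ φ v w) = 0
  · exact ⟨0, fun w => by simpa using hker w (h0 w)⟩
  push Not at h0
  obtain ⟨w₀, hw₀⟩ := h0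
  refine ⟨inner ℝ m w₀ / ℓ (fderiv ℝ φ v w₀), fun w => ?_⟩
  have := hker (w - (ℓ (fderiv ℝ φ v w) / ℓ (fderiv ℝ φ v w₀)) • w₀) (by simp [hw₀])
  rw [inner_sub_right, inner_smul_right] at this
  simp only [ContinuousLinearMap.comp_apply]
  rw [sub_eq_zero.1 this]
  ring

/-- At a boundary point with outer normal `m`, the boundary has a defining function with
gradient `m`. -/
theorem HasC1Boundary.exists_defining_function_of_normal {V : Set (EuclideanSpace ℝ (Fin n))}
    (hV : HasC1Boundary V) {v m : EuclideanSpace ℝ (Fin n)} (hv : v ∈ frontier V) (hm0 : m ≠ 0)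
    (hm : ∀ z ∈ frontier V, inner ℝ m (z - v) ≤ 0) :
    ∃ (W : Set (EuclideanSpace ℝ (Fin n))) (G : EuclideanSpace ℝ (Fin n) → ℝ),
      IsOpen W ∧ v ∈ W ∧ ContDiffOn ℝ 1 G W ∧ (∀ z ∈ W, z ∈ frontier V ↔ G z = 0) ∧
      ∀ w, fderiv ℝ G v w = inner ℝ m w := by
  obtain ⟨W, G, hW, hvW, hG, hiff, hk⟩ := hV.exists_defining_function hv
  obtain ⟨k, hk⟩ := hk m hm
  have hk0 : k ≠ 0 := by
    rintro rfl
    exact hm0 (by simpa using hk m)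
  refine ⟨W, fun z => k * G z, hW, hvW, contDiffOn_const.mul hG, fun z hz => ?_, fun w => ?_⟩
  · rw [hiff z hz]; simp [hk0]
  · have hd : DifferentiableAt ℝ G v :=
      (hG.differentiableOn one_ne_zero).differentiableAt (hW.mem_nhds hvW)
    rw [hk w, fderiv_const_mul hd]
    simp

theorem HasC1Boundary.normal_unique {V : Set (EuclideanSpace ℝ (Fin n))}
    (hV : HasC1Boundary V) (hVo : IsOpen V) (hVne : V.Nonempty)
    {v m m' : EuclideanSpace ℝ (Fin n)} (hv : v ∈ frontier V) (hm1 : ‖m‖ = 1) (hm1' : ‖m'‖ = 1)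
    (hm : ∀ z ∈ closure V, inner ℝ m (z - v) ≤ 0)
    (hm' : ∀ z ∈ closure V, inner ℝ m' (z - v) ≤ 0) : m = m' := by
  obtain ⟨W, G, hW, hvW, hG, hiff, hk⟩ := hV.exists_defining_function hv
  obtain ⟨k, hk1⟩ := hk m fun z hz => hm z (frontier_subset_closure hz)
  obtain ⟨k', hk2⟩ := hk m' fun z hz => hm' z (frontier_subset_closure hz)
  have hk0 : k ≠ 0 := by
    rintro rfl
    have := hk1 m
    rw [zero_mul, real_inner_self_eq_norm_sq, hm1] at this
    norm_num at this
  have hmm : m' = (k' / k) • m := by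
    refine ext_inner_right ℝ fun w => ?_
    rw [hk2, inner_smul_left, hk1]
    simp only [conj_trivial]
    field_simp
  set r := k' / k with hr
  have hr1 : |r| = 1 := by
    rw [hmm, norm_smul, hm1, mul_one, Real.norm_eq_abs] at hm1'
    exact hm1'
  rcases eq_or_eq_neg_of_abs_eq hr1 with h | h
  · rw [hmm, h, one_smul]
  exfalso
  rw [hmm, h, neg_one_smul] at hm'
  have hzero : ∀ z ∈ closure V, inner ℝ m (z - v) = 0 := fun z hz => by
    have h1 := hm z hz
    have h2 := hm' z hz
    rw [inner_neg_left] at h2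
    linarith
  obtain ⟨u, hu⟩ := hVne
  obtain ⟨ε, hε, hball⟩ := Metric.isOpen_iff.1 hVo u hu
  have hu' : u + (ε / 2) • m ∈ V := hball <| by
    rw [mem_ball, dist_eq_norm, add_sub_cancel_left, norm_smul, hm1, Real.norm_eq_abs,
      abs_of_pos (by positivity)]
    linarith
  have h1 := hzero u (subset_closure hu)
  have h2 := hzero _ (subset_closure hu')
  rw [add_sub_right_comm, inner_add_right, h1, inner_smul_right, real_inner_self_eq_norm_sq,
    hm1] at h2
  norm_num at h2
  linarith

theorem mem_of_segment_disjoint_frontier {V : Set (EuclideanSpace ℝ (Fin n))}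
    {a b : EuclideanSpace ℝ (Fin n)} (ha : a ∈ V) (h : ∀ z ∈ segment ℝ a b, z ∉ frontier V) :
    b ∈ V := by
  by_contra hb
  have hsub : segment ℝ a b ⊆ interior V ∪ (closure V)ᶜ := by
    intro z hz
    by_contra hc
    rw [mem_union, not_or, mem_compl_iff, not_not] at hc
    exact h z hz ⟨hc.2, hc.1⟩
  have ha' : a ∈ interior V := by
    rcases hsub (left_mem_segment ℝ a b) with h1 | h1
    · exact h1
    · exact absurd (subset_closure ha) h1
  have hb' : b ∈ (closure V)ᶜ := by
    rcases hsub (right_mem_segment ℝ a b) with h1 | h1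
    · exact absurd (interior_subset h1) hb
    · exact h1
  obtain ⟨z, -, hz1, hz2⟩ := (convex_segment (𝕜 := ℝ) a b).isPreconnected _ _ isOpen_interior
    isClosed_closure.isOpen_compl hsub ⟨a, left_mem_segment ℝ a b, ha'⟩
    ⟨b, right_mem_segment ℝ a b, hb'⟩
  exact hz2 (subset_closure (interior_subset hz1))

end Contact

/-- An orthonormal frame of the plane. -/
structure IsFrame (e m : EuclideanSpace ℝ (Fin 2)) : Prop where
  norm_left : ‖e‖ = 1
  norm_right : ‖m‖ = 1
  inner_eq_zero : inner ℝ e m = 0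
  decomp : ∀ z, z = inner ℝ e z • e + inner ℝ m z • m

theorem IsFrame.neg_left {e m : EuclideanSpace ℝ (Fin 2)} (h : IsFrame e m) : IsFrame (-e) m :=
  ⟨by rw [norm_neg, h.norm_left], h.norm_right, by rw [inner_neg_left, h.inner_eq_zero, neg_zero],
    fun z => by simpa using h.decomp z⟩

theorem exists_isFrame {m : EuclideanSpace ℝ (Fin 2)} (hm : ‖m‖ = 1) : ∃ e, IsFrame e m := by
  have h : m 0 ^ 2 + m 1 ^ 2 = 1 := by
    have := EuclideanSpace.real_norm_sq_eq m
    rw [hm, Fin.sum_univ_two] at this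
    linarith
  refine ⟨!₂[-m 1, m 0], ?_, hm, ?_, fun z => ?_⟩
  · rw [EuclideanSpace.norm_eq, Real.sqrt_eq_one, Fin.sum_univ_two]
    simp
    linarith
  · simp [PiLp.inner_apply, Fin.sum_univ_two]
    ring
  · ext i
    fin_cases i
    · simp [PiLp.inner_apply, Fin.sum_univ_two]
      linear_combination (-z 0) * h
    · simp [PiLp.inner_apply, Fin.sum_univ_two]
      linear_combination (-z 1) * h

theorem IsFrame.norm_le {e m : EuclideanSpace ℝ (Fin 2)} (h : IsFrame e m)
    (z : EuclideanSpace ℝ (Fin 2)) : ‖z‖ ≤ |inner ℝ e z| + |inner ℝ m z| := by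
  conv_lhs => rw [h.decomp z]
  refine (norm_add_le _ _).trans ?_
  rw [norm_smul, norm_smul, h.norm_left, h.norm_right, mul_one, mul_one, Real.norm_eq_abs,
    Real.norm_eq_abs]

theorem IsFrame.abs_inner_left_le {e m : EuclideanSpace ℝ (Fin 2)} (h : IsFrame e m)
    (z : EuclideanSpace ℝ (Fin 2)) : |inner ℝ e z| ≤ ‖z‖ := by
  simpa [h.norm_left] using abs_real_inner_le_norm e z

theorem IsFrame.abs_inner_right_le {e m : EuclideanSpace ℝ (Fin 2)} (h : IsFrame e m)
    (z : EuclideanSpace ℝ (Fin 2)) : |inner ℝ m z| ≤ ‖z‖ := by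
  simpa [h.norm_right] using abs_real_inner_le_norm m z

theorem IsFrame.ext {e m : EuclideanSpace ℝ (Fin 2)} (h : IsFrame e m)
    {y z : EuclideanSpace ℝ (Fin 2)} (h1 : inner ℝ e y = inner ℝ e z)
    (h2 : inner ℝ m y = inner ℝ m z) : y = z := by
  rw [h.decomp y, h.decomp z, h1, h2]

/-- The boundary is tangent to the supporting line. -/
theorem HasC1Boundary.eventually_abs_inner_le {V : Set (EuclideanSpace ℝ (Fin 2))}
    (hV : HasC1Boundary V) {v e m : EuclideanSpace ℝ (Fin 2)} (hf : IsFrame e m)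
    (hv : v ∈ frontier V) (hm : ∀ z ∈ closure V, inner ℝ m (z - v) ≤ 0) {κ : ℝ} (hκ : 0 < κ) :
    ∀ᶠ z in 𝓝 v, z ∈ frontier V → |inner ℝ m (z - v)| ≤ κ * |inner ℝ e (z - v)| := by
  have hm0 : m ≠ 0 := by
    rintro rfl
    simpa using hf.norm_right
  obtain ⟨W, G, hW, hvW, hG, hiff, hd⟩ := hV.exists_defining_function_of_normal hv hm0
    fun z hz => hm z (frontier_subset_closure hz)
  have hd1 : HasFDerivAt G (fderiv ℝ G v) v :=
    ((hG.differentiableOn one_ne_zero).differentiableAt (hW.mem_nhds hvW)).hasFDerivAt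
  have h1 := (hasFDerivAt_iff_isLittleO.1 hd1).def (c := min (κ / 2) (1 / 2)) (by positivity)
  filter_upwards [h1, hW.mem_nhds hvW] with z hz hzW hzf
  have hz0 : G z = 0 := (hiff z hzW).1 hzf
  have hv0 : G v = 0 := (hiff v hvW).1 hv
  rw [hz0, hv0, hd, sub_zero, zero_sub, norm_neg, Real.norm_eq_abs] at hz
  have h2 := hf.norm_le (z - v)
  have h3 : min (κ / 2) (1 / 2) ≤ κ / 2 := min_le_left _ _
  have h4 : min (κ / 2) (1 / 2) ≤ 1 / 2 := min_le_right _ _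
  have h5 : 0 < min (κ / 2) (1 / 2) := by positivity
  nlinarith [abs_nonneg (inner ℝ e (z - v)), abs_nonneg (inner ℝ m (z - v)), norm_nonneg (z - v)]

/-- Near a boundary point with a supporting line, everything below the boundary is inside. -/
theorem HasC1Boundary.exists_forall_below_mem {V : Set (EuclideanSpace ℝ (Fin 2))}
    (hV : HasC1Boundary V) (hVo : IsOpen V) {v e m : EuclideanSpace ℝ (Fin 2)} (hf : IsFrame e m)
    (hv : v ∈ frontier V) (hm : ∀ z ∈ closure V, inner ℝ m (z - v) ≤ 0) :
    ∃ δ > 0, ∀ z ∈ ball v δ, z ∈ frontier V → ∀ z' ∈ ball v δ,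
      inner ℝ e (z' - v) = inner ℝ e (z - v) → inner ℝ m (z' - v) < inner ℝ m (z - v) →
      z' ∈ V := by
  have hm0 : m ≠ 0 := by
    rintro rfl
    simpa using hf.norm_right
  obtain ⟨W, G, hW, hvW, hG, hiff, hd⟩ := hV.exists_defining_function_of_normal hv hm0
    fun z hz => hm z (frontier_subset_closure hz)
  have hfd : ContinuousOn (fderiv ℝ G) W := hG.continuousOn_fderiv_of_isOpen hW le_rfl
  have hev : ∀ᶠ z in 𝓝 v, z ∈ W ∧ 0 < fderiv ℝ G z m := by
    have hc : ContinuousAt (fun z => fderiv ℝ G z m) v :=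
      ((ContinuousLinearMap.apply ℝ ℝ m).continuous.continuousAt).comp
        (hfd.continuousAt (hW.mem_nhds hvW))
    refine Filter.Eventually.and (hW.mem_nhds hvW) (hc.eventually_const_lt ?_)
    simp only [hd, real_inner_self_eq_norm_sq, hf.norm_right]
    norm_num
  obtain ⟨ρ, hρ, hball⟩ := Metric.eventually_nhds_iff_ball.1 hev
  -- points in coordinates
  set P : ℝ → ℝ → EuclideanSpace ℝ (Fin 2) := fun x y => v + x • e + y • m with hP
  have hPz : ∀ z, z = P (inner ℝ e (z - v)) (inner ℝ m (z - v)) := fun z => by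
    simp only [hP]
    rw [add_assoc, ← hf.decomp (z - v)]
    abel
  have hPball : ∀ {x y}, |x| + |y| < ρ → P x y ∈ ball v ρ := by
    intro x y hxy
    rw [mem_ball, dist_eq_norm]
    refine lt_of_le_of_lt ?_ hxy
    simp only [hP]
    rw [show v + x • e + y • m - v = x • e + y • m by abel]
    refine (norm_add_le _ _).trans ?_
    rw [norm_smul, norm_smul, hf.norm_left, hf.norm_right, mul_one, mul_one]
    rfl
  have hPc : Continuous fun p : ℝ × ℝ => P p.1 p.2 := by
    simp only [hP]; fun_prop
  have hPd : ∀ x y, HasDerivAt (P x) m y := by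
    intro x y
    have := ((hasDerivAt_id y).smul_const m).const_add (v + x • e)
    rw [one_smul] at this
    exact this
  have hmono : ∀ {x y y'}, |x| < ρ / 4 → -(ρ / 2) ≤ y → y < y' → y' ≤ ρ / 2 →
      G (P x y) < G (P x y') := by
    intro x y y' hx hy hyy hy'
    have hin : ∀ t ∈ Icc (-(ρ / 2)) (ρ / 2), P x t ∈ ball v ρ := fun t ht =>
      hPball (by have := abs_le.2 ht; linarith)
    have hder : ∀ t ∈ Icc (-(ρ / 2)) (ρ / 2),
        HasDerivAt (fun s => G (P x s)) (fderiv ℝ G (P x t) m) t := fun t ht =>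
      (((hG.differentiableOn one_ne_zero).differentiableAt
        (hW.mem_nhds (hball _ (hin t ht)).1)).hasFDerivAt).comp_hasDerivAt t (hPd x t)
    have hsm : StrictMonoOn (fun s => G (P x s)) (Icc (-(ρ / 2)) (ρ / 2)) := by
      refine strictMonoOn_of_deriv_pos (convex_Icc _ _)
        (fun t ht => (hder t ht).continuousAt.continuousWithinAt) fun t ht => ?_
      rw [(hder t (interior_subset ht)).deriv]
      exact (hball _ (hin t (interior_subset ht))).2
    exact hsm ⟨hy, by linarith⟩ ⟨by linarith, hy'⟩ hyy
  have hP00 : P 0 0 = v := by simp [hP]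
  have hG0 : G (P 0 0) = 0 := by rw [hP00]; exact (hiff v hvW).1 hv
  have hbot : G (P 0 (-(ρ / 2))) < 0 := by
    exact lt_of_lt_of_eq
      (hmono (y' := 0) (by rw [abs_zero]; linarith) le_rfl (by linarith) (by linarith)) hG0
  have hGc : ContinuousOn G W := hG.continuousOn
  obtain ⟨α, hα, hαb⟩ : ∃ α > 0, ∀ x, |x| < α → G (P x (-(ρ / 2))) < 0 := by
    have hmem : P 0 (-(ρ / 2)) ∈ W := (hball _ (hPball (by
      rw [abs_zero, abs_neg, abs_of_pos (half_pos hρ)]; linarith))).1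
    have hc : ContinuousAt (fun x => G (P x (-(ρ / 2)))) 0 :=
      ContinuousAt.comp (f := fun x => P x (-(ρ / 2))) (hGc.continuousAt (hW.mem_nhds hmem))
        (by fun_prop)
    obtain ⟨α, hα, h⟩ := Metric.eventually_nhds_iff_ball.1 (hc.eventually_lt_const hbot)
    exact ⟨α, hα, fun x hx => h x (by simpa using hx)⟩
  have hfr : ∀ {x y}, |x| < ρ / 4 → |y| ≤ ρ / 2 → (P x y ∈ frontier V ↔ G (P x y) = 0) :=
    fun hx hy => hiff _ (hball _ (hPball (by linarith))).1
  set a := min α (ρ / 4) with ha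
  have ha0 : 0 < a := by positivity
  have haα : a ≤ α := min_le_left _ _
  have haρ : a ≤ ρ / 4 := min_le_right _ _
  have hvert : ∀ x y y', ∀ z ∈ segment ℝ (P x y) (P x y'), ∃ t ∈ segment ℝ y y', z = P x t := by
    rintro x y y' z ⟨r, s, hr, hs, hrs, rfl⟩
    refine ⟨r • y + s • y', ⟨r, s, hr, hs, hrs, rfl⟩, ?_⟩
    obtain rfl : r = 1 - s := by linarith
    simp only [hP, smul_eq_mul]
    module
  have hhor : ∀ x x' y, ∀ z ∈ segment ℝ (P x y) (P x' y), ∃ t ∈ segment ℝ x x', z = P t y := by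
    rintro x x' y z ⟨r, s, hr, hs, hrs, rfl⟩
    refine ⟨r • x + s • x', ⟨r, s, hr, hs, hrs, rfl⟩, ?_⟩
    obtain rfl : r = 1 - s := by linarith
    simp only [hP, smul_eq_mul]
    module
  -- some point of `V` below the graph
  obtain ⟨x₀, y₀, hx₀, hy₀, hV₀⟩ : ∃ x y, |x| < a ∧ |y| < ρ / 2 ∧ P x y ∈ V := by
    have hvc : v ∈ closure V := frontier_subset_closure hv
    obtain ⟨z, hzV, hz⟩ := Metric.mem_closure_iff.1 hvc a ha0
    rw [dist_comm, dist_eq_norm] at hz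
    refine ⟨inner ℝ e (z - v), inner ℝ m (z - v), (hf.abs_inner_left_le _).trans_lt hz,
      ((hf.abs_inner_right_le _).trans_lt hz).trans_le (by linarith), ?_⟩
    rw [← hPz z]; exact hzV
  have hnf : ∀ z ∈ V, z ∉ frontier V := fun z hz hzf => by
    rw [hVo.frontier_eq] at hzf
    exact hzf.2 hz
  have hinY : ∀ x y, inner ℝ m (P x y - v) = y := by
    intro x y
    simp only [hP]
    rw [show v + x • e + y • m - v = x • e + y • m by abel, inner_add_right, inner_smul_right,
      inner_smul_right, real_inner_comm, hf.inner_eq_zero, real_inner_self_eq_norm_sq,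
      hf.norm_right]
    ring
  have hy₀' : y₀ ≤ 0 := by
    rw [← hinY x₀ y₀]; exact hm _ (subset_closure hV₀)
  have habs₀ := abs_lt.1 hy₀
  have hG₀ : G (P x₀ y₀) < 0 := by
    rcases lt_trichotomy (G (P x₀ y₀)) 0 with h | h | h
    · exact h
    · exact absurd ((hfr (by linarith) hy₀.le).2 h) (hnf _ hV₀)
    · exfalso
      have : P x₀ (ρ / 4) ∈ V := by
        refine mem_of_segment_disjoint_frontier hV₀ fun z hz => ?_
        obtain ⟨t, ht, rfl⟩ := hvert _ _ _ z hz
        rw [segment_eq_Icc (by linarith)] at ht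
        rw [hfr (by linarith) (abs_le.2 ⟨by linarith [ht.1], by linarith [ht.2]⟩)]
        rcases ht.1.eq_or_lt with h1 | h1
        · rw [← h1]; exact h.ne'
        · exact (h.trans (hmono (by linarith) (by linarith) h1 (by linarith [ht.2]))).ne'
      have h2 := hm _ (subset_closure this)
      rw [hinY] at h2
      linarith
  have hbelow : ∀ x y, |x| < a → |y| < ρ / 2 → G (P x y) < 0 → P x y ∈ V := by
    intro x y hx hy hxy
    have hy' := abs_lt.1 hy
    have hρ2 : |-(ρ / 2)| ≤ ρ / 2 := by rw [abs_neg, abs_of_pos (by positivity)]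
    have h1 : P x₀ (-(ρ / 2)) ∈ V := by
      refine mem_of_segment_disjoint_frontier hV₀ fun z hz => ?_
      obtain ⟨t, ht, rfl⟩ := hvert _ _ _ z hz
      rw [segment_symm, segment_eq_Icc (by linarith)] at ht
      rw [hfr (by linarith) (abs_le.2 ⟨by linarith [ht.1], by linarith [ht.2]⟩)]
      rcases ht.2.eq_or_lt with h1 | h1
      · rw [h1]; exact hG₀.ne
      · exact ((hmono (by linarith) (by linarith [ht.1]) h1 (by linarith)).trans hG₀).ne
    have h2 : P x (-(ρ / 2)) ∈ V := by
      refine mem_of_segment_disjoint_frontier h1 fun z hz => ?_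
      obtain ⟨t, ht, rfl⟩ := hhor _ _ _ z hz
      have hta : |t| < a := by
        have : segment ℝ x₀ x ⊆ Ioo (-a) a :=
          (convex_Ioo (-a) a).segment_subset (abs_lt.1 hx₀) (abs_lt.1 hx)
        exact abs_lt.2 (this ht)
      rw [hfr (by linarith) hρ2]
      exact (hαb t (by linarith)).ne
    refine mem_of_segment_disjoint_frontier h2 fun z hz => ?_
    obtain ⟨t, ht, rfl⟩ := hvert _ _ _ z hz
    rw [segment_eq_Icc (by linarith)] at ht
    rw [hfr (by linarith) (abs_le.2 ⟨by linarith [ht.1], by linarith [ht.2]⟩)]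
    rcases ht.2.eq_or_lt with h1 | h1
    · rw [h1]; exact hxy.ne
    · exact ((hmono (by linarith) (by linarith [ht.1]) h1 (by linarith)).trans hxy).ne
  refine ⟨a, ha0, fun z hz hzf z' hz' hX hY => ?_⟩
  rw [mem_ball, dist_eq_norm] at hz hz'
  have hx := (hf.abs_inner_left_le _).trans_lt hz
  have hy := (hf.abs_inner_right_le _).trans_lt hz
  have hy' := (hf.abs_inner_right_le _).trans_lt hz'
  have hGz : G z = 0 := (hiff z (by rw [hPz z]; exact (hball _ (hPball (by linarith))).1)).1 hzf
  rw [hPz z', hX]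
  refine hbelow _ _ hx (by linarith) ?_
  have h3 := hmono (x := inner ℝ e (z - v)) (by linarith) (by linarith [(abs_lt.1 hy').1]) hY
    (by linarith [(abs_lt.1 hy).2])
  rwa [← hPz z, hGz] at h3

/-- A boundary arc lying above its chord has a relative distance realised by the chord. -/
theorem relDist_le_of_above_chord {V : Set (EuclideanSpace ℝ (Fin 2))}
    {v e m : EuclideanSpace ℝ (Fin 2)} (hf : IsFrame e m) {δ : ℝ}
    (hδ : ∀ z ∈ ball v δ, z ∈ frontier V → ∀ z' ∈ ball v δ,
      inner ℝ e (z' - v) = inner ℝ e (z - v) → inner ℝ m (z' - v) < inner ℝ m (z - v) → z' ∈ V)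
    {σ : ℝ → EuclideanSpace ℝ (Fin 2)} {t : ℝ} (ht : 0 ≤ t) (hσ : ContinuousOn σ (Icc 0 t))
    (hσ0 : σ 0 = v) (hσV : ∀ s ∈ Icc 0 t, σ s ∈ frontier V) (hσδ : ∀ s ∈ Icc 0 t, σ s ∈ ball v δ)
    (hpos : 0 < inner ℝ e (σ t - v))
    (hslope : ∀ s ∈ Icc 0 t, inner ℝ m (σ t - v) * inner ℝ e (σ s - v) ≤
      inner ℝ m (σ s - v) * inner ℝ e (σ t - v)) :
    relDist V v (σ t) ≤ edist v (σ t) := by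
  have hin : ∀ τ : ℝ, 0 < τ → τ < δ - ‖σ t - v‖ →
      segment ℝ (v - τ • m) (σ t - τ • m) ⊆ V := by
    rintro τ hτ hτδ z hz
    rw [segment_eq_image'] at hz
    obtain ⟨r, hr, rfl⟩ := hz
    obtain ⟨s, hs, hXs⟩ : r * inner ℝ e (σ t - v) ∈ (fun s => inner ℝ e (σ s - v)) '' Icc 0 t := by
      refine intermediate_value_Icc ht (f := fun s => inner ℝ e (σ s - v))
        (continuousOn_const.inner (hσ.sub continuousOn_const)) ⟨?_, ?_⟩
      · simp only [hσ0, sub_self, inner_zero_right]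
        exact mul_nonneg hr.1 hpos.le
      · exact mul_le_of_le_one_left hpos.le hr.2
    have hz : v - τ • m + r • (σ t - τ • m - (v - τ • m)) - v = r • (σ t - v) - τ • m := by
      module
    refine hδ (σ s) (hσδ s hs) (hσV s hs) _ ?_ ?_ ?_
    · rw [mem_ball, dist_eq_norm, hz]
      calc ‖r • (σ t - v) - τ • m‖ ≤ ‖r • (σ t - v)‖ + ‖τ • m‖ := norm_sub_le _ _
        _ = r * ‖σ t - v‖ + τ := by
          rw [norm_smul, norm_smul, hf.norm_right, mul_one, Real.norm_of_nonneg hr.1,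
            Real.norm_of_nonneg hτ.le]
        _ < δ := by nlinarith [norm_nonneg (σ t - v), hr.2]
    · rw [hz, inner_sub_right, inner_smul_right, inner_smul_right, hf.inner_eq_zero]
      simp only at hXs
      linarith
    · rw [hz, inner_sub_right, inner_smul_right, inner_smul_right, real_inner_self_eq_norm_sq,
        hf.norm_right]
      have h1 := hslope s hs
      simp only at hXs
      rw [hXs] at h1
      have h2 : r * inner ℝ m (σ t - v) ≤ inner ℝ m (σ s - v) := by
        refine le_of_mul_le_mul_right ?_ hpos
        linarith
      linarith
  have hlt : ‖σ t - v‖ < δ := by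
    have := hσδ t ⟨ht, le_rfl⟩
    rwa [mem_ball, dist_eq_norm] at this
  have hev : ∀ᶠ τ in 𝓝[>] (0 : ℝ), segment ℝ (v - τ • m) (σ t - τ • m) ⊆ V := by
    have h1 : ∀ᶠ τ in 𝓝[>] (0 : ℝ), τ < δ - ‖σ t - v‖ :=
      nhdsWithin_le_nhds (eventually_lt_nhds (sub_pos.2 hlt))
    filter_upwards [h1, self_mem_nhdsWithin] with τ h2 h3 using hin τ h3 h2
  have htend : ∀ p : EuclideanSpace ℝ (Fin 2),
      Tendsto (fun τ : ℝ => p - τ • m) (𝓝[>] 0) (𝓝 p) := fun p => by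
    have : Continuous fun τ : ℝ => p - τ • m := by fun_prop
    simpa using (this.tendsto 0).mono_left nhdsWithin_le_nhds
  refine relDist_le_of_tendsto (l := 𝓝[>] (0 : ℝ)) (x := fun τ => v - τ • m)
    (y := fun τ => σ t - τ • m) (m := fun τ => edist (v - τ • m) (σ t - τ • m))
    (tendsto_nhdsWithin_iff.2 ⟨htend v, ?_⟩) (tendsto_nhdsWithin_iff.2 ⟨htend (σ t), ?_⟩) ?_
    ((htend v).edist (htend (σ t)))
  · filter_upwards [hev] with τ h using h (left_mem_segment ℝ _ _)
  · filter_upwards [hev] with τ h using h (right_mem_segment ℝ _ _)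
  · filter_upwards [hev] with τ h using (smoothPathInf_of_segment_subset h).le

/-- The shape of a constant speed boundary arc starting at a point with a supporting line. -/
theorem exists_affine_of_contact_of_pos {V : Set (EuclideanSpace ℝ (Fin 2))} (hVo : IsOpen V)
    (hV : HasC1Boundary V)
    {v e m : EuclideanSpace ℝ (Fin 2)} (hf : IsFrame e m) (hm : ∀ z ∈ closure V, inner ℝ m (z - v) ≤ 0)
    {σ : ℝ → EuclideanSpace ℝ (Fin 2)} {T L : ℝ} (hT : 0 < T) (hL : 0 ≤ L)
    (hσ : ContinuousOn σ (Icc 0 T)) (hσ0 : σ 0 = v) (hσV : ∀ s ∈ Icc 0 T, σ s ∈ frontier V)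
    (hdist : ∀ s ∈ Icc 0 T, ∀ t ∈ Icc 0 T, relDist V (σ s) (σ t) = ENNReal.ofReal (L * |s - t|))
    (hpos : ∀ t ∈ Ioc 0 T, 0 < inner ℝ e (σ t - v)) :
    ∃ t₁ ∈ Ioc 0 T, ∃ w, (∀ t ∈ Icc 0 t₁, σ t = v + t • w) ∧ inner ℝ m w = 0 ∧ ‖w‖ = L := by
  have h0T : (0 : ℝ) ∈ Icc 0 T := ⟨le_rfl, hT.le⟩
  have hv : v ∈ frontier V := hσ0 ▸ hσV 0 h0T
  obtain ⟨δ, hδ0, hδ⟩ := hV.exists_forall_below_mem hVo hf hv hm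
  have htend : Tendsto σ (𝓝[Icc 0 T] 0) (𝓝 v) := hσ0 ▸ hσ 0 h0T
  -- shrink to a ball
  obtain ⟨T', hT', hT'T, hball⟩ : ∃ T' > 0, T' ≤ T ∧ ∀ t ∈ Icc 0 T', σ t ∈ ball v δ := by
    have h1 := htend.eventually (ball_mem_nhds v hδ0)
    rw [nhdsWithin_Icc_eq_nhdsGE hT, (nhdsGE_basis (0 : ℝ)).eventually_iff] at h1
    obtain ⟨c, hc, h⟩ := h1
    exact ⟨min (c / 2) T, by positivity, min_le_right _ _, fun t ht =>
      h ⟨ht.1, ht.2.trans_lt ((min_le_left _ _).trans_lt (half_lt_self hc))⟩⟩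
  have hsub : Icc 0 T' ⊆ Icc 0 T := Icc_subset_Icc_right hT'T
  set X : ℝ → ℝ := fun t => inner ℝ e (σ t - v) with hX
  set Y : ℝ → ℝ := fun t => inner ℝ m (σ t - v) with hY
  have hX0 : X 0 = 0 := by simp [hX, hσ0]
  have hY0 : Y 0 = 0 := by simp [hY, hσ0]
  have hXc : ContinuousOn X (Icc 0 T') :=
    continuousOn_const.inner ((hσ.mono hsub).sub continuousOn_const)
  have hYc : ContinuousOn Y (Icc 0 T') :=
    continuousOn_const.inner ((hσ.mono hsub).sub continuousOn_const)
  have htan : ∀ κ > 0, ∀ᶠ t in 𝓝[Icc 0 T'] 0, |Y t| ≤ κ * |X t| := by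
    intro κ hκ
    have h1 := (htend.mono_left (nhdsWithin_mono _ hsub)).eventually
      (hV.eventually_abs_inner_le hf hv hm hκ)
    filter_upwards [h1, self_mem_nhdsWithin] with t ht ht' using ht (hσV t (hsub ht'))
  have hXpos : ∀ t ∈ Ioc 0 T', 0 < X t := fun t ht => hpos t ⟨ht.1, ht.2.trans hT'T⟩
  have hgc : ContinuousOn (fun t => Y t / X t) (Icc 0 T') := by
    intro t ht
    rcases ht.1.eq_or_lt with h | h
    · subst h
      rw [ContinuousWithinAt, hX0, hY0, _root_.div_zero, Metric.tendsto_nhds]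
      intro κ hκ
      filter_upwards [htan (κ / 2) (half_pos hκ)] with t ht
      rw [Real.dist_0_eq_abs, abs_div]
      refine lt_of_le_of_lt (div_le_of_le_mul₀ (abs_nonneg _) (half_pos hκ).le ht) (half_lt_self hκ)
    · exact (hYc t ht).div (hXc t ht) (hXpos t ⟨h, ht.2⟩).ne'
  obtain ⟨t₁, ht₁, hmin⟩ : ∃ t₁ ∈ Ioc 0 T', ∀ t ∈ Icc 0 T', Y t₁ / X t₁ ≤ Y t / X t := by
    obtain ⟨t₁, ht₁, hmin⟩ := isCompact_Icc.exists_isMinOn (nonempty_Icc.2 hT'.le) hgc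
    rcases ht₁.1.eq_or_lt with h | h
    · subst h
      refine ⟨T', ⟨hT', le_rfl⟩, fun t ht => ?_⟩
      have h1 : Y T' ≤ 0 := hm _ (frontier_subset_closure (hσV _ (hsub ⟨hT'.le, le_rfl⟩)))
      have h2 : Y 0 / X 0 ≤ Y t / X t := hmin ht
      rw [hX0, _root_.div_zero] at h2
      exact (div_nonpos_of_nonpos_of_nonneg h1 (hXpos T' ⟨hT', le_rfl⟩).le).trans h2
    · exact ⟨t₁, ⟨h, ht₁.2⟩, fun t ht => hmin ht⟩
  have ht₁T : t₁ ∈ Icc 0 T := hsub ⟨ht₁.1.le, ht₁.2⟩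
  have hsub1 : Icc 0 t₁ ⊆ Icc 0 T' := Icc_subset_Icc_right ht₁.2
  have hle : relDist V v (σ t₁) ≤ edist v (σ t₁) := by
    refine relDist_le_of_above_chord hf hδ ht₁.1.le (hσ.mono (hsub1.trans hsub)) hσ0
      (fun s hs => hσV s (hsub (hsub1 hs))) (fun s hs => hball s (hsub1 hs)) (hXpos t₁ ht₁)
      fun s hs => ?_
    rcases hs.1.eq_or_lt with h | h
    · subst h; simp [hσ0]
    · have h1 := hmin s (hsub1 hs)
      have h2 := hXpos s ⟨h, hs.2.trans ht₁.2⟩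
      rwa [div_le_div_iff₀ (hXpos t₁ ht₁) h2] at h1
  have hcl : ∀ s ∈ Icc 0 T, σ s ∈ closure V := fun s hs => frontier_subset_closure (hσV s hs)
  have hlip : ∀ s ∈ Icc 0 T, ∀ t ∈ Icc 0 T, dist (σ s) (σ t) ≤ L * |s - t| := by
    intro s hs t ht
    have h1 := edist_le_relDist (hcl s hs) (hcl t ht)
    rw [hdist s hs t ht, edist_dist] at h1
    exact (ENNReal.ofReal_le_ofReal_iff (by positivity)).1 h1
  have hge : L * t₁ ≤ dist v (σ t₁) := by
    have h1 := hdist 0 h0T t₁ ht₁T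
    rw [hσ0] at h1
    rw [h1, edist_dist, ENNReal.ofReal_le_ofReal_iff dist_nonneg, zero_sub, abs_neg,
      abs_of_pos ht₁.1] at hle
    exact hle
  have hd1 : dist v (σ t₁) = L * t₁ := by
    refine le_antisymm ?_ hge
    have := hlip 0 h0T t₁ ht₁T
    rwa [hσ0, zero_sub, abs_neg, abs_of_pos ht₁.1] at this
  have hlin : ∀ t ∈ Icc 0 t₁, σ t = v + t • ((1 / t₁) • (σ t₁ - v)) := by
    intro t ht
    have htT := hsub (hsub1 ht)
    have h1 := hlip 0 h0T t htT
    have h2 := hlip t htT t₁ ht₁T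
    rw [hσ0, zero_sub, abs_neg, abs_of_nonneg ht.1] at h1
    rw [abs_sub_comm, abs_of_nonneg (sub_nonneg.2 ht.2)] at h2
    have h3 := dist_triangle v (σ t) (σ t₁)
    have h4 : σ t = AffineMap.lineMap v (σ t₁) (t / t₁) := by
      have hrw : t / t₁ * (L * t₁) = L * t := by have := ht₁.1.ne'; field_simp
      refine eq_lineMap_of_dist_eq_mul_of_dist_eq_mul ?_ ?_
      · rw [hd1, hrw]; linarith
      · rw [hd1, sub_mul, hrw]; linarith
    rw [h4, AffineMap.lineMap_apply, vsub_eq_sub, vadd_eq_add, smul_smul]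
    ring_nf
    rw [add_comm]
  obtain ⟨w, hw⟩ : ∃ w, w = (1 / t₁) • (σ t₁ - v) := ⟨_, rfl⟩
  rw [← hw] at hlin
  refine ⟨t₁, ⟨ht₁.1, ht₁T.2⟩, w, hlin, ?_, ?_⟩
  · by_contra hne
    have hm0 : 0 < |inner ℝ m w| := abs_pos.2 hne
    have h1 : 0 < |inner ℝ m w| / (2 * (|inner ℝ e w| + 1)) := by positivity
    have h2 := htan _ h1
    rw [nhdsWithin_Icc_eq_nhdsGE hT'] at h2
    have h3 := h2.filter_mono (nhdsWithin_mono (0 : ℝ) Ioi_subset_Ici_self)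
    have h4 : ∀ᶠ t in 𝓝[>] (0 : ℝ), t < t₁ := nhdsWithin_le_nhds (eventually_lt_nhds ht₁.1)
    obtain ⟨t, ⟨h5, h6⟩, h7⟩ := ((h3.and h4).and self_mem_nhdsWithin).exists
    have h7' : 0 < t := h7
    simp only [hX, hY] at h5
    rw [hlin t ⟨h7'.le, h6.le⟩, add_sub_cancel_left, inner_smul_right, inner_smul_right, abs_mul,
      abs_mul, abs_of_pos h7'] at h5
    have h8 : |inner ℝ m w| ≤ |inner ℝ m w| / (2 * (|inner ℝ e w| + 1)) * |inner ℝ e w| := by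
      refine le_of_mul_le_mul_left ?_ h7'
      rwa [mul_left_comm] at h5
    rw [div_mul_eq_mul_div, le_div_iff₀ (by positivity)] at h8
    nlinarith [abs_nonneg (inner ℝ e w)]
  · rw [hw, norm_smul, ← dist_eq_norm, dist_comm, hd1, Real.norm_of_nonneg (by have := ht₁.1; positivity)]
    have := ht₁.1.ne'
    field_simp

/-- The shape of a constant speed boundary arc starting at a point with a supporting line. -/
theorem exists_affine_of_contact {V : Set (EuclideanSpace ℝ (Fin 2))} (hVo : IsOpen V)
    (hV : HasC1Boundary V)
    {v m : EuclideanSpace ℝ (Fin 2)} (hm1 : ‖m‖ = 1) (hm : ∀ z ∈ closure V, inner ℝ m (z - v) ≤ 0)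
    {σ : ℝ → EuclideanSpace ℝ (Fin 2)} {T L : ℝ} (hT : 0 < T) (hL : 0 ≤ L)
    (hσ : ContinuousOn σ (Icc 0 T)) (hinj : InjOn σ (Icc 0 T)) (hσ0 : σ 0 = v)
    (hσV : ∀ s ∈ Icc 0 T, σ s ∈ frontier V)
    (hdist : ∀ s ∈ Icc 0 T, ∀ t ∈ Icc 0 T, relDist V (σ s) (σ t) = ENNReal.ofReal (L * |s - t|)) :
    ∃ t₁ ∈ Ioc 0 T, ∃ w, (∀ t ∈ Icc 0 t₁, σ t = v + t • w) ∧ inner ℝ m w = 0 ∧ ‖w‖ = L := by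
  obtain ⟨e, hf⟩ := exists_isFrame hm1
  have h0T : (0 : ℝ) ∈ Icc 0 T := ⟨le_rfl, hT.le⟩
  have hv : v ∈ frontier V := hσ0 ▸ hσV 0 h0T
  have htend : Tendsto σ (𝓝[Icc 0 T] 0) (𝓝 v) := hσ0 ▸ hσ 0 h0T
  obtain ⟨T', hT', hT'T, hX⟩ : ∃ T' > 0, T' ≤ T ∧ ∀ t ∈ Ioc 0 T', inner ℝ e (σ t - v) ≠ 0 := by
    have h1 := htend.eventually (hV.eventually_abs_inner_le hf hv hm one_pos)
    rw [nhdsWithin_Icc_eq_nhdsGE hT, (nhdsGE_basis (0 : ℝ)).eventually_iff] at h1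
    obtain ⟨c, hc, h⟩ := h1
    refine ⟨min (c / 2) T, by positivity, min_le_right _ _, fun t ht h0 => ?_⟩
    have htT : t ∈ Icc 0 T := ⟨ht.1.le, ht.2.trans (min_le_right _ _)⟩
    have h2 := h (x := t) ⟨ht.1.le, ht.2.trans_lt ((min_le_left _ _).trans_lt (half_lt_self hc))⟩
      (hσV t htT)
    rw [h0, abs_zero, mul_zero] at h2
    have h3 : σ t - v = 0 := hf.ext (by simpa using h0) (by simpa using abs_nonpos_iff.1 h2)
    have h4 : t = 0 := hinj htT h0T (by rw [hσ0]; exact sub_eq_zero.1 h3)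
    exact ht.1.ne' h4
  have hsub : Icc 0 T' ⊆ Icc 0 T := Icc_subset_Icc_right hT'T
  have hXc : ContinuousOn (fun t => inner ℝ e (σ t - v)) (Ioc 0 T') :=
    continuousOn_const.inner ((hσ.mono (Ioc_subset_Icc_self.trans hsub)).sub continuousOn_const)
  have key : ∀ e, IsFrame e m → (∀ t ∈ Ioc 0 T', 0 < inner ℝ e (σ t - v)) →
      ∃ t₁ ∈ Ioc 0 T, ∃ w, (∀ t ∈ Icc 0 t₁, σ t = v + t • w) ∧ inner ℝ m w = 0 ∧ ‖w‖ = L := by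
    intro e hf hpos
    obtain ⟨t₁, ht₁, h⟩ := exists_affine_of_contact_of_pos hVo hV hf hm hT' hL (hσ.mono hsub) hσ0
      (fun s hs => hσV s (hsub hs)) (fun s hs t ht => hdist s (hsub hs) t (hsub ht)) hpos
    exact ⟨t₁, ⟨ht₁.1, ht₁.2.trans hT'T⟩, h⟩
  have hsign : (∀ t ∈ Ioc 0 T', 0 < inner ℝ e (σ t - v)) ∨
      ∀ t ∈ Ioc 0 T', inner ℝ e (σ t - v) < 0 := by
    by_contra! hc
    obtain ⟨⟨s, hs, hs'⟩, t, ht, ht'⟩ := hc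
    obtain ⟨r, hr, hr0⟩ := isPreconnected_Ioc.intermediate_value hs ht hXc ⟨hs', ht'⟩
    exact hX r hr hr0
  rcases hsign with h | h
  · exact key e hf h
  · exact key (-e) hf.neg_left fun t ht => by rw [inner_neg_left]; linarith [h t ht]

theorem frontier_isCompact {n : ℕ} {U : Set (EuclideanSpace ℝ (Fin n))}
    (hU : Bornology.IsBounded U) : IsCompact (frontier U) :=
  Metric.isCompact_of_isClosed_isBounded isClosed_frontier
    (hU.closure.subset frontier_subset_closure)

/-- A boundary correspondence which is isometric, for the Euclidean metric on `∂U` and the relative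
metric on `∂V`, at scales below `ε`. -/
structure BoundaryIso (U V : Set (EuclideanSpace ℝ (Fin 2)))
    (f : EuclideanSpace ℝ (Fin 2) → EuclideanSpace ℝ (Fin 2)) (ε : ℝ) : Prop where
  isOpen_left : IsOpen U
  nonempty_left : U.Nonempty
  bounded_left : Bornology.IsBounded U
  convex : Convex ℝ U
  smooth_left : HasC1Boundary U
  isOpen_right : IsOpen V
  nonempty_right : V.Nonempty
  bounded_right : Bornology.IsBounded V
  smooth_right : HasC1Boundary V
  bijOn : BijOn f (frontier U) (frontier V)
  pos : 0 < ε
  lip : ∀ a ∈ frontier U, ∀ b ∈ frontier U, dist a b < ε → dist (f a) (f b) ≤ dist a b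
  iso_of_image : ∀ a ∈ frontier U, ∀ b ∈ frontier U, dist (f a) (f b) < ε →
    relDist V (f a) (f b) = edist a b

theorem exists_boundaryIso {U V : Set (EuclideanSpace ℝ (Fin 2))}
    {f : EuclideanSpace ℝ (Fin 2) → EuclideanSpace ℝ (Fin 2)}
    (hUo : IsOpen U) (hUne : U.Nonempty) (hUb : Bornology.IsBounded U) (hUc : Convex ℝ U)
    (hU1 : HasC1Boundary U)
    (hVo : IsOpen V) (hVne : V.Nonempty) (hVb : Bornology.IsBounded V) (hV1 : HasC1Boundary V)
    (hf : IsBoundaryLocalIsometry U V f) : ∃ ε, BoundaryIso U V f ε := by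
  have hcl : ∀ a ∈ frontier U, a ∈ closure U := fun a ha => frontier_subset_closure ha
  obtain ⟨hbij, hloc⟩ := hf
  have hK : IsCompact (frontier U) := frontier_isCompact hUb
  have hrel : ∀ a ∈ frontier U, ∀ b ∈ frontier U, relDist U a b = edist a b :=
    fun a ha b hb => relDist_of_convex hUc (hcl a ha) (hcl b hb)
  choose! r hr0 hr using hloc
  obtain ⟨δ, hδ, hδ'⟩ := lebesgue_number_lemma_of_metric (c := fun y : frontier U => eball (y : EuclideanSpace ℝ (Fin 2)) (r y))
    hK (fun _ => isOpen_eball) fun y hy => mem_iUnion.2 ⟨⟨y, hy⟩, mem_eball_self (hr0 y hy)⟩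
  have hiso : ∀ a ∈ frontier U, ∀ b ∈ frontier U, dist a b < δ →
      relDist V (f a) (f b) = edist a b := by
    intro a ha b hb hab
    obtain ⟨⟨y, hy⟩, hsub⟩ := hδ' a ha
    have h1 : a ∈ eball y (r y) := hsub (mem_ball_self hδ)
    have h2 : b ∈ eball y (r y) := hsub (by rwa [mem_ball, dist_comm])
    rw [← hr y hy a ha b hb (by rwa [hrel a ha y hy]) (by rwa [hrel b hb y hy]), hrel a ha b hb]
  have hlip : ∀ a ∈ frontier U, ∀ b ∈ frontier U, dist a b < δ → dist (f a) (f b) ≤ dist a b := by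
    intro a ha b hb hab
    have h1 := edist_le_relDist (U := V) (frontier_subset_closure (hbij.mapsTo ha))
      (frontier_subset_closure (hbij.mapsTo hb))
    rw [hiso a ha b hb hab, edist_dist, edist_dist,
      ENNReal.ofReal_le_ofReal_iff dist_nonneg] at h1
    exact h1
  have hcont : ContinuousOn f (frontier U) := by
    intro a ha
    rw [Metric.continuousWithinAt_iff]
    intro η hη
    refine ⟨min δ η, by positivity, fun b hb hab => ?_⟩
    exact (hlip b hb a ha (hab.trans_le (min_le_left _ _))).trans_lt
      (hab.trans_le (min_le_right _ _))
  obtain ⟨η, hη, hη'⟩ : ∃ η > 0, ∀ a ∈ frontier U, ∀ b ∈ frontier U, dist (f a) (f b) < η →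
      dist a b < δ := by
    set K := (frontier U ×ˢ frontier U) ∩ {p | δ ≤ dist p.1 p.2} with hKdef
    have hKc : IsCompact K := (hK.prod hK).inter_right
      (isClosed_le continuous_const (continuous_fst.dist continuous_snd))
    have hc : ContinuousOn (fun p : EuclideanSpace ℝ (Fin 2) × EuclideanSpace ℝ (Fin 2) =>
        dist (f p.1) (f p.2)) K :=
      continuous_dist.comp_continuousOn
        ((hcont.comp continuousOn_fst fun p (hp : p ∈ K) => hp.1.1).prodMk
          (hcont.comp continuousOn_snd fun p (hp : p ∈ K) => hp.1.2))
    rcases K.eq_empty_or_nonempty with h | h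
    · refine ⟨1, one_pos, fun a ha b hb _ => ?_⟩
      by_contra! hc
      have : (a, b) ∈ K := ⟨⟨ha, hb⟩, hc⟩
      rw [h] at this
      exact this
    · obtain ⟨p, hp, hmin⟩ := hKc.exists_isMinOn h hc
      refine ⟨dist (f p.1) (f p.2), dist_pos.2 fun h0 => ?_, fun a ha b hb hab => ?_⟩
      · have h1 := hbij.injOn hp.1.1 hp.1.2 h0
        have h2 : δ ≤ dist p.1 p.2 := hp.2
        rw [h1, dist_self] at h2
        linarith
      · by_contra! hc
        have hab' : (a, b) ∈ K := ⟨⟨ha, hb⟩, hc⟩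
        exact absurd (isMinOn_iff.1 hmin (a, b) hab') (not_le.2 hab)
  exact ⟨min δ η, hUo, hUne, hUb, hUc, hU1, hVo, hVne, hVb, hV1, hbij, lt_min hδ hη,
    fun a ha b hb h => hlip a ha b hb (h.trans_le (min_le_left _ _)),
    fun a ha b hb h => hiso a ha b hb (hη' a ha b hb (h.trans_le (min_le_right _ _)))⟩

namespace BoundaryIso

variable {U V : Set (EuclideanSpace ℝ (Fin 2))}
  {f : EuclideanSpace ℝ (Fin 2) → EuclideanSpace ℝ (Fin 2)} {ε : ℝ}

theorem iso (S : BoundaryIso U V f ε) {a b : EuclideanSpace ℝ (Fin 2)} (ha : a ∈ frontier U)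
    (hb : b ∈ frontier U) (h : dist a b < ε) : relDist V (f a) (f b) = edist a b :=
  S.iso_of_image a ha b hb ((S.lip a ha b hb h).trans_lt h)

theorem continuousOn (S : BoundaryIso U V f ε) : ContinuousOn f (frontier U) := by
  intro a ha
  rw [Metric.continuousWithinAt_iff]
  intro η hη
  refine ⟨min ε η, lt_min S.pos hη, fun b hb hab => ?_⟩
  exact (S.lip b hb a ha (hab.trans_le (min_le_left _ _))).trans_lt
    (hab.trans_le (min_le_right _ _))

theorem mem_closure_right (S : BoundaryIso U V f ε) {a : EuclideanSpace ℝ (Fin 2)}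
    (ha : a ∈ frontier U) : f a ∈ closure V :=
  frontier_subset_closure (S.bijOn.mapsTo ha)

theorem notMem_left (S : BoundaryIso U V f ε) {a : EuclideanSpace ℝ (Fin 2)}
    (ha : a ∈ frontier U) : a ∉ U := by
  rw [S.isOpen_left.frontier_eq] at ha
  exact ha.2

/-- Short chords through the interior keep their length. -/
theorem dist_eq_of_openSegment_subset (S : BoundaryIso U V f ε) {a b : EuclideanSpace ℝ (Fin 2)}
    (ha : a ∈ frontier U) (hb : b ∈ frontier U) (hab : dist a b < ε)
    (h : openSegment ℝ a b ⊆ U) : dist (f a) (f b) = dist a b := by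
  refine dist_eq_of_geodesics_interior S.isOpen_right S.bounded_right dist_nonneg
    (S.mem_closure_right ha) (S.mem_closure_right hb) (by rw [S.iso ha hb hab, edist_dist])
    fun r hr z hz h1 h2 => ?_
  by_contra hzV
  have hzf : z ∈ frontier V := by
    rw [S.isOpen_right.frontier_eq]; exact ⟨hz, hzV⟩
  obtain ⟨c, hc, rfl⟩ := S.bijOn.surjOn hzf
  have key : ∀ p ∈ frontier U, ∀ q ∈ frontier U, ∀ ρ ∈ Ioo (0 : ℝ) 1,
      relDist V (f p) (f q) ≤ ENNReal.ofReal (ρ * dist a b) → dist p q ≤ ρ * dist a b := by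
    intro p hp q hq ρ hρ hle
    have hnn : 0 ≤ ρ * dist a b := mul_nonneg hρ.1.le dist_nonneg
    have h3 := (edist_le_relDist (S.mem_closure_right hp) (S.mem_closure_right hq)).trans hle
    rw [edist_dist, ENNReal.ofReal_le_ofReal_iff hnn] at h3
    have h4 : ρ * dist a b ≤ dist a b := mul_le_of_le_one_left dist_nonneg hρ.2.le
    rw [S.iso_of_image p hp q hq (by linarith), edist_dist, ENNReal.ofReal_le_ofReal_iff hnn] at hle
    exact hle
  have h3 := key a ha c hc r hr h1
  have h4 := key c hc b hb (1 - r) ⟨by linarith [hr.2], by linarith [hr.1]⟩ h2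
  have h5 := dist_triangle a c b
  have h6 : c = AffineMap.lineMap a b r :=
    eq_lineMap_of_dist_eq_mul_of_dist_eq_mul (by linarith) (by linarith)
  refine S.notMem_left hc (h ?_)
  rw [h6, openSegment_eq_image_lineMap]
  exact mem_image_of_mem _ hr

theorem exists_affine_of_normal (S : BoundaryIso U V f ε) {p u m : EuclideanSpace ℝ (Fin 2)}
    {c : ℝ} (hc : 0 < c) (hu : u ≠ 0) (hp : ∀ s ∈ Icc 0 c, p + s • u ∈ frontier U) (hm1 : ‖m‖ = 1)
    (hm : ∀ z ∈ closure V, inner ℝ m (z - f p) ≤ 0) :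
    ∃ t₁ ∈ Ioc 0 c, ∃ w, (∀ t ∈ Icc 0 t₁, f (p + t • u) = f p + t • w) ∧ inner ℝ m w = 0 ∧
      ‖w‖ = ‖u‖ := by
  have hu0 : 0 < ‖u‖ := norm_pos_iff.2 hu
  have hε := S.pos
  set T := min c (ε / (2 * ‖u‖)) with hT
  have hT0 : 0 < T := by positivity
  have hTc : T ≤ c := min_le_left _ _
  have hTε : T * ‖u‖ < ε := by
    have : T ≤ ε / (2 * ‖u‖) := min_le_right _ _
    rw [le_div_iff₀ (by positivity)] at this
    nlinarith
  have hmem : ∀ s ∈ Icc 0 T, p + s • u ∈ frontier U := fun s hs => hp s ⟨hs.1, hs.2.trans hTc⟩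
  have hdist : ∀ s t : ℝ, dist (p + s • u) (p + t • u) = ‖u‖ * |s - t| := by
    intro s t
    rw [dist_eq_norm, add_sub_add_left_eq_sub, ← sub_smul, norm_smul, Real.norm_eq_abs, mul_comm]
  obtain ⟨t₁, ht₁, w, h⟩ := exists_affine_of_contact (v := f p) (σ := fun s => f (p + s • u)) (T := T)
    (L := ‖u‖)
    S.isOpen_right S.smooth_right hm1 hm hT0 hu0.le
    (S.continuousOn.comp (by fun_prop) hmem) (fun s hs t ht hst => by
      have h1 := S.bijOn.injOn (hmem s hs) (hmem t ht) hst
      have h2 := hdist s t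
      rw [h1, dist_self, eq_comm, mul_eq_zero, abs_eq_zero, sub_eq_zero] at h2
      exact h2.resolve_left hu0.ne') (by simp) (fun s hs => S.bijOn.mapsTo (hmem s hs))
    (fun s hs t ht => by
      rw [S.iso (hmem s hs) (hmem t ht), edist_dist, hdist]
      rw [hdist]
      have : |s - t| ≤ T := abs_le.2 ⟨by linarith [hs.1, ht.2], by linarith [hs.2, ht.1]⟩
      nlinarith)
  exact ⟨t₁, ⟨ht₁.1, ht₁.2.trans hTc⟩, w, h⟩

/-- Boundary segments are mapped to segments once the image has a supporting line at one end. -/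
theorem flat_segment (S : BoundaryIso U V f ε) {x y m : EuclideanSpace ℝ (Fin 2)} (hxy : x ≠ y)
    (hseg : segment ℝ x y ⊆ frontier U) (hm1 : ‖m‖ = 1)
    (hm : ∀ z ∈ closure V, inner ℝ m (z - f x) ≤ 0) :
    (∀ t ∈ Icc (0 : ℝ) 1, f (AffineMap.lineMap x y t) = AffineMap.lineMap (f x) (f y) t) ∧
      inner ℝ m (f y - f x) = 0 ∧ dist (f x) (f y) = dist x y := by
  have hlm : ∀ t : ℝ, AffineMap.lineMap x y t = x + t • (y - x) := fun t => by
    rw [AffineMap.lineMap_apply, vsub_eq_sub, vadd_eq_add, add_comm]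
  have hmem : ∀ t ∈ Icc (0 : ℝ) 1, x + t • (y - x) ∈ frontier U := fun t ht => by
    rw [segment_eq_image'] at hseg
    exact hseg (mem_image_of_mem _ ht)
  set σ : ℝ → EuclideanSpace ℝ (Fin 2) := fun t => f (x + t • (y - x)) with hσ
  have hσc : ContinuousOn σ (Icc 0 1) := S.continuousOn.comp (by fun_prop) hmem
  have hσ0 : σ 0 = f x := by simp [hσ]
  have hσ1 : σ 1 = f y := by simp [hσ]
  have hu : y - x ≠ 0 := sub_ne_zero.2 hxy.symm
  have hu0 : 0 < ‖y - x‖ := norm_pos_iff.2 hu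
  have hnormal : ∀ t, inner ℝ m (σ t - f x) = 0 → ∀ z ∈ closure V, inner ℝ m (z - σ t) ≤ 0 := by
    intro t ht z hz
    have h1 := hm z hz
    have h2 : z - σ t = (z - f x) - (σ t - f x) := by abel
    rw [h2, inner_sub_right, ht, sub_zero]
    exact h1
  have hright : ∀ t ∈ Ico (0 : ℝ) 1, inner ℝ m (σ t - f x) = 0 → ∃ t₁ > 0, ∃ w,
      (∀ s ∈ Icc 0 t₁, σ (t + s) = σ t + s • w) ∧ inner ℝ m w = 0 ∧ ‖w‖ = ‖y - x‖ := by
    intro t ht h0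
    have hrw : ∀ s : ℝ, x + t • (y - x) + s • (y - x) = x + (t + s) • (y - x) := fun s => by module
    obtain ⟨t₁, ht₁, w, hw, h⟩ := S.exists_affine_of_normal (p := x + t • (y - x)) (u := y - x)
      (c := 1 - t) (by linarith [ht.2]) hu (fun s hs => by
        rw [hrw]; exact hmem _ ⟨by linarith [ht.1, hs.1], by linarith [hs.2]⟩) hm1
      (hnormal t h0)
    refine ⟨t₁, ht₁.1, w, fun s hs => ?_, h⟩
    rw [← hw s hs, hrw]
  have hleft : ∀ t ∈ Ioc (0 : ℝ) 1, inner ℝ m (σ t - f x) = 0 → ∃ t₁ > 0, ∃ w,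
      (∀ s ∈ Icc 0 t₁, σ (t - s) = σ t + s • w) ∧ inner ℝ m w = 0 ∧ ‖w‖ = ‖y - x‖ := by
    intro t ht h0
    have hrw : ∀ s : ℝ, x + t • (y - x) + s • (x - y) = x + (t - s) • (y - x) := fun s => by module
    obtain ⟨t₁, ht₁, w, hw, h⟩ := S.exists_affine_of_normal (p := x + t • (y - x)) (u := x - y)
      (c := t) ht.1 (sub_ne_zero.2 hxy) (fun s hs => by
        rw [hrw]; exact hmem _ ⟨by linarith [hs.2], by linarith [ht.2, hs.1]⟩) hm1
      (hnormal t h0)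
    refine ⟨t₁, ht₁.1, w, fun s hs => ?_, by rw [h.1], by rw [h.2, norm_sub_rev]⟩
    rw [← hw s hs, hrw]
  have hall : Icc (0 : ℝ) 1 ⊆ {t | inner ℝ m (σ t - f x) = 0} := by
    have hcl : IsClosed ({t | inner ℝ m (σ t - f x) = 0} ∩ Icc (0 : ℝ) 1) := by
      rw [inter_comm]
      exact (continuousOn_const.inner (hσc.sub continuousOn_const)).preimage_isClosed_of_isClosed
        isClosed_Icc isClosed_singleton
    refine hcl.Icc_subset_of_forall_mem_nhdsWithin (by simp [hσ0]) fun t ht => ?_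
    obtain ⟨t₁, ht₁, w, hw, hmw, -⟩ := hright t ht.2 ht.1
    have : Ioc t (t + t₁) ∈ 𝓝[>] t := Ioc_mem_nhdsGT (by linarith)
    refine mem_of_superset this fun s hs => ?_
    have h1 := hw (s - t) ⟨by linarith [hs.1], by linarith [hs.2]⟩
    rw [add_sub_cancel] at h1
    have h2 : inner ℝ m (σ t - f x) = 0 := ht.1
    rw [mem_ofPred_eq, h1, add_sub_right_comm, inner_add_right, h2, inner_smul_right, hmw]
    ring
  obtain ⟨e, hf⟩ := exists_isFrame hm1
  have hinj : ∀ s ∈ Icc (0 : ℝ) 1, ∀ t ∈ Icc (0 : ℝ) 1, σ s = σ t → s = t := by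
    intro s hs t ht hst
    have h1 := S.bijOn.injOn (hmem s hs) (hmem t ht) hst
    rw [_root_.add_right_inj] at h1
    exact smul_left_injective ℝ hu h1
  have haff : ∀ t ∈ Ioo (0 : ℝ) 1, ∃ w, ∀ᶠ s in 𝓝 t, σ s = σ t + (s - t) • w := by
    intro t ht
    have h0 := hall (Ioo_subset_Icc_self ht)
    obtain ⟨t₁, ht₁, w, hw, hmw, hwn⟩ := hright t ⟨ht.1.le, ht.2⟩ h0
    obtain ⟨t₂, ht₂, w', hw', hmw', hwn'⟩ := hleft t ⟨ht.1, ht.2.le⟩ h0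
    have habs : ∀ w, inner ℝ m w = 0 → ‖w‖ = |inner ℝ e w| := by
      intro w hmw
      conv_lhs => rw [hf.decomp w]
      rw [hmw, zero_smul, add_zero, norm_smul, hf.norm_left, mul_one, Real.norm_eq_abs]
    have hww : w' = -w := by
      have h1 : |inner ℝ e w'| = |inner ℝ e w| := by
        rw [← habs w hmw, ← habs w' hmw', hwn, hwn']
      rcases abs_eq_abs.1 h1 with h2 | h2
      · exfalso
        have h3 : w' = w := hf.ext h2 (by rw [hmw, hmw'])
        obtain ⟨s, hs⟩ : ∃ s, s = min (min t₁ t₂) (min t (1 - t)) := ⟨_, rfl⟩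
        have hs0 : 0 < s := by
          rw [hs]; exact lt_min (lt_min ht₁ ht₂) (lt_min ht.1 (by linarith [ht.2]))
        have hs1 : s ≤ min t₁ t₂ := hs ▸ min_le_left _ _
        have hs2 : s ≤ min t (1 - t) := hs ▸ min_le_right _ _
        rw [le_min_iff] at hs1 hs2
        have h4 := hw s ⟨hs0.le, hs1.1⟩
        have h5 := hw' s ⟨hs0.le, hs1.2⟩
        rw [h3, ← h4] at h5
        have := hinj _ ⟨by linarith, by linarith⟩ _ ⟨by linarith, by linarith⟩ h5
        linarith
      · exact hf.ext (by rw [h2, inner_neg_right]) (by rw [hmw', inner_neg_right, hmw, neg_zero])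
    refine ⟨w, ?_⟩
    have : Ioo (t - t₂) (t + t₁) ∈ 𝓝 t := Ioo_mem_nhds (by linarith) (by linarith)
    filter_upwards [this] with s hs
    rcases le_total t s with h | h
    · have h1 := hw (s - t) ⟨by linarith, by linarith [hs.2]⟩
      rwa [add_sub_cancel] at h1
    · have h1 := hw' (t - s) ⟨by linarith, by linarith [hs.1]⟩
      rw [_root_.sub_sub_cancel, hww] at h1
      rw [h1]
      module
  have hline := eq_lineMap_of_locally_affine hσc haff
  rw [hσ0, hσ1] at hline
  refine ⟨fun t ht => by rw [hlm]; exact hline t ht, ?_, ?_⟩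
  · rw [← hσ1]; exact hall ⟨zero_le_one, le_rfl⟩
  · obtain ⟨t₁, ht₁, w, hw, -, hwn⟩ := hright 0 ⟨le_rfl, one_pos⟩ (by simp [hσ0])
    obtain ⟨s, hs⟩ : ∃ s, s = min t₁ 1 := ⟨_, rfl⟩
    have hs0 : 0 < s := hs ▸ lt_min ht₁ one_pos
    have h1 := hw s ⟨hs0.le, hs ▸ min_le_left _ _⟩
    rw [zero_add, hline s ⟨hs0.le, hs ▸ min_le_right _ _⟩, hσ0, AffineMap.lineMap_apply,
      vsub_eq_sub, vadd_eq_add, add_comm, _root_.add_right_inj] at h1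
    have h2 : f y - f x = w := smul_right_injective _ hs0.ne' h1
    rw [dist_comm, dist_eq_norm, h2, hwn, dist_comm x y, dist_eq_norm]

end BoundaryIso

/-- The cone of outer normals of `U` at `x`. -/
def normalCone (U : Set (EuclideanSpace ℝ (Fin 2))) (x : EuclideanSpace ℝ (Fin 2)) :
    Set (EuclideanSpace ℝ (Fin 2)) :=
  {m | ∀ z ∈ closure U, inner ℝ m (z - x) ≤ 0}

theorem mem_normalCone_of_forall {U : Set (EuclideanSpace ℝ (Fin 2))}
    {x m : EuclideanSpace ℝ (Fin 2)}
    (h : ∀ z ∈ U, inner ℝ m (z - x) ≤ 0) : m ∈ normalCone U x := by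
  have hc : IsClosed {z | inner ℝ m (z - x) ≤ 0} :=
    isClosed_le (continuous_const.inner (continuous_id.sub continuous_const)) continuous_const
  exact fun z hz => closure_minimal (t := {z | inner ℝ m (z - x) ≤ 0}) h hc hz

theorem mem_normalCone_of_inner_eq_zero {U : Set (EuclideanSpace ℝ (Fin 2))}
    {x y m : EuclideanSpace ℝ (Fin 2)} (h : m ∈ normalCone U x) (hxy : inner ℝ m (y - x) = 0) :
    m ∈ normalCone U y := by
  intro z hz
  have h1 := h z hz
  have h2 : z - y = (z - x) - (y - x) := by abel
  rw [h2, inner_sub_right, hxy, sub_zero]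
  exact h1

theorem smul_mem_normalCone {U : Set (EuclideanSpace ℝ (Fin 2))}
    {x m : EuclideanSpace ℝ (Fin 2)} {c : ℝ} (hc : 0 ≤ c) (h : m ∈ normalCone U x) :
    c • m ∈ normalCone U x := fun z hz => by
  rw [inner_smul_left]
  exact mul_nonpos_of_nonneg_of_nonpos (by simpa using hc) (h z hz)

theorem inner_neg_of_mem_normalCone {U : Set (EuclideanSpace ℝ (Fin 2))} (hU : IsOpen U)
    {x m z : EuclideanSpace ℝ (Fin 2)} (h : m ∈ normalCone U x) (hm : m ≠ 0) (hz : z ∈ U) :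
    inner ℝ m (z - x) < 0 := by
  refine lt_of_le_of_ne (h z (subset_closure hz)) fun h0 => ?_
  obtain ⟨ε, hε, hball⟩ := Metric.isOpen_iff.1 hU z hz
  have hm0 : 0 < ‖m‖ := norm_pos_iff.2 hm
  have h1 : z + (ε / (2 * ‖m‖)) • m ∈ U := hball <| by
    rw [mem_ball, dist_eq_norm, add_sub_cancel_left, norm_smul, Real.norm_of_nonneg (by positivity)]
    field_simp
    linarith
  have h2 := h _ (subset_closure h1)
  rw [add_sub_right_comm, inner_add_right, h0, zero_add, inner_smul_right,
    real_inner_self_eq_norm_sq] at h2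
  have : 0 < ε / (2 * ‖m‖) * ‖m‖ ^ 2 := by positivity
  linarith

theorem isClosed_setOf_mem_normalCone (U : Set (EuclideanSpace ℝ (Fin 2))) :
    IsClosed {q : EuclideanSpace ℝ (Fin 2) × EuclideanSpace ℝ (Fin 2) |
      q.1 ∈ normalCone U q.2} := by
  have : {q : EuclideanSpace ℝ (Fin 2) × EuclideanSpace ℝ (Fin 2) | q.1 ∈ normalCone U q.2} =
      ⋂ z ∈ closure U, {q | inner ℝ q.1 (z - q.2) ≤ 0} := by
    ext q; simp [normalCone]
  rw [this]
  exact isClosed_biInter fun z _ =>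
    isClosed_le (continuous_fst.inner (continuous_const.sub continuous_snd)) continuous_const

theorem exists_mem_normalCone {U : Set (EuclideanSpace ℝ (Fin 2))} (hUo : IsOpen U)
    (hUne : U.Nonempty) (hUb : Bornology.IsBounded U) {m : EuclideanSpace ℝ (Fin 2)}
    (hm : m ≠ 0) : ∃ x ∈ frontier U, m ∈ normalCone U x := by
  have hK : IsCompact (closure U) :=
    Metric.isCompact_of_isClosed_isBounded isClosed_closure hUb.closure
  obtain ⟨x, hx, hmax⟩ := hK.exists_isMaxOn hUne.closure
    (f := fun z => inner ℝ m z) (continuous_const.inner continuous_id).continuousOn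
  have hn : m ∈ normalCone U x := fun z hz => by
    rw [inner_sub_right, sub_nonpos]; exact hmax hz
  refine ⟨x, ?_, hn⟩
  rw [hUo.frontier_eq]
  refine ⟨hx, fun hxU => ?_⟩
  have := inner_neg_of_mem_normalCone hUo hn hm hxU
  simp at this

/-- The unit outer normal. -/
def outerNormal (U : Set (EuclideanSpace ℝ (Fin 2))) (x : EuclideanSpace ℝ (Fin 2)) :
    EuclideanSpace ℝ (Fin 2) :=
  Classical.epsilon fun n => ‖n‖ = 1 ∧ n ∈ normalCone U x

/-- Boundary points which are limits of boundary points with a different normal. -/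
def extremeSet (U : Set (EuclideanSpace ℝ (Fin 2))) : Set (EuclideanSpace ℝ (Fin 2)) :=
  {p | p ∈ frontier U ∧ p ∈ closure {x | x ∈ frontier U ∧ outerNormal U x ≠ outerNormal U p}}

theorem isClosed_extremeSet (U : Set (EuclideanSpace ℝ (Fin 2))) : IsClosed (extremeSet U) := by
  refine isClosed_of_closure_subset fun p hp => ?_
  have hpf : p ∈ frontier U := closure_minimal (fun _ h => h.1) isClosed_frontier hp
  refine ⟨hpf, ?_⟩
  by_contra hc
  obtain ⟨q, hq1, hq2, hq3⟩ := mem_closure_iff.1 hp _ isClosed_closure.isOpen_compl hc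
  have hqp : outerNormal U q = outerNormal U p := by
    by_contra hne
    exact hq1 (subset_closure ⟨hq2, hne⟩)
  rw [hqp] at hq3
  exact hq1 hq3

namespace BoundaryIso

variable {U V : Set (EuclideanSpace ℝ (Fin 2))}
  {f : EuclideanSpace ℝ (Fin 2) → EuclideanSpace ℝ (Fin 2)} {ε : ℝ}

theorem outerNormal_spec (S : BoundaryIso U V f ε) {x : EuclideanSpace ℝ (Fin 2)}
    (hx : x ∈ frontier U) : ‖outerNormal U x‖ = 1 ∧ outerNormal U x ∈ normalCone U x := by
  refine Classical.epsilon_spec (p := fun n => ‖n‖ = 1 ∧ n ∈ normalCone U x) ?_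
  obtain ⟨φ, hφ⟩ := geometric_hahn_banach_open_point S.convex S.isOpen_left (S.notMem_left hx)
  set m := (InnerProductSpace.toDual ℝ (EuclideanSpace ℝ (Fin 2))).symm φ with hm
  have hmφ : ∀ z, inner ℝ m z = φ z := fun z => InnerProductSpace.toDual_symm_apply
  have hm0 : m ≠ 0 := by
    intro h0
    obtain ⟨u, hu⟩ := S.nonempty_left
    have h1 := hφ u hu
    rw [← hmφ, ← hmφ, h0, inner_zero_left, inner_zero_left] at h1
    exact lt_irrefl _ h1
  refine ⟨(‖m‖⁻¹) • m, norm_smul_inv_norm hm0, smul_mem_normalCone (by positivity) ?_⟩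
  refine mem_normalCone_of_forall fun z hz => ?_
  rw [inner_sub_right, hmφ, hmφ]
  linarith [hφ z hz]

theorem eq_outerNormal (S : BoundaryIso U V f ε) {x n : EuclideanSpace ℝ (Fin 2)}
    (hx : x ∈ frontier U) (hn : ‖n‖ = 1) (h : n ∈ normalCone U x) : n = outerNormal U x :=
  S.smooth_left.normal_unique S.isOpen_left S.nonempty_left hx hn (S.outerNormal_spec hx).1 h
    (S.outerNormal_spec hx).2

theorem outerNormal_ne_zero (S : BoundaryIso U V f ε) {x : EuclideanSpace ℝ (Fin 2)}
    (hx : x ∈ frontier U) : outerNormal U x ≠ 0 := by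
  intro h
  have := (S.outerNormal_spec hx).1
  rw [h, norm_zero] at this
  exact zero_ne_one this

theorem outerNormal_eq_iff (S : BoundaryIso U V f ε) {x y : EuclideanSpace ℝ (Fin 2)}
    (hx : x ∈ frontier U) (hy : y ∈ frontier U) :
    outerNormal U x = outerNormal U y ↔ inner ℝ (outerNormal U x) (y - x) = 0 := by
  obtain ⟨hx1, hx2⟩ := S.outerNormal_spec hx
  obtain ⟨hy1, hy2⟩ := S.outerNormal_spec hy
  constructor
  · intro h
    refine le_antisymm (hx2 y (frontier_subset_closure hy)) ?_
    have h1 := hy2 x (frontier_subset_closure hx)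
    rw [← h, ← neg_sub, inner_neg_right] at h1
    linarith
  · exact fun h => S.eq_outerNormal hy hx1 (mem_normalCone_of_inner_eq_zero hx2 h)

theorem inner_neg (S : BoundaryIso U V f ε) {x y : EuclideanSpace ℝ (Fin 2)}
    (hx : x ∈ frontier U) (hy : y ∈ frontier U) (h : outerNormal U x ≠ outerNormal U y) :
    inner ℝ (outerNormal U x) (y - x) < 0 :=
  lt_of_le_of_ne ((S.outerNormal_spec hx).2 y (frontier_subset_closure hy))
    fun h0 => h ((S.outerNormal_eq_iff hx hy).2 h0)

theorem segment_subset_frontier (S : BoundaryIso U V f ε) {x y m : EuclideanSpace ℝ (Fin 2)}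
    (hx : x ∈ frontier U) (hy : y ∈ frontier U) (hm0 : m ≠ 0) (hmx : m ∈ normalCone U x)
    (hmy : m ∈ normalCone U y) : segment ℝ x y ⊆ frontier U := by
  intro z hz
  rw [S.isOpen_left.frontier_eq]
  refine ⟨S.convex.closure.segment_subset (frontier_subset_closure hx)
    (frontier_subset_closure hy) hz, fun hzU => ?_⟩
  have h1 := inner_neg_of_mem_normalCone S.isOpen_left hmx hm0 hzU
  have h2 := inner_neg_of_mem_normalCone S.isOpen_left hmy hm0 hzU
  obtain ⟨a, b, ha, hb, hab, rfl⟩ := hz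
  obtain rfl : a = 1 - b := by linarith
  rw [show (1 - b) • x + b • y - x = b • (y - x) by module, inner_smul_right] at h1
  rw [show (1 - b) • x + b • y - y = (1 - b) • (x - y) by module, inner_smul_right, ← neg_sub y x,
    inner_neg_right] at h2
  have h3 := hmx y (frontier_subset_closure hy)
  have h4 := hmy x (frontier_subset_closure hx)
  rw [← neg_sub y x, inner_neg_right] at h4
  nlinarith

theorem openSegment_subset (S : BoundaryIso U V f ε) {x y : EuclideanSpace ℝ (Fin 2)}
    (hx : x ∈ frontier U) (hy : y ∈ frontier U) (h : outerNormal U x ≠ outerNormal U y) :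
    openSegment ℝ x y ⊆ U := by
  intro z hz
  by_contra hzU
  have hxc := frontier_subset_closure hx
  have hyc := frontier_subset_closure hy
  have hzf : z ∈ frontier U := by
    rw [S.isOpen_left.frontier_eq]
    exact ⟨S.convex.closure.segment_subset hxc hyc (openSegment_subset_segment ℝ x y hz), hzU⟩
  obtain ⟨hz1, hz2⟩ := S.outerNormal_spec hzf
  have h1 := hz2 x hxc
  have h2 := hz2 y hyc
  obtain ⟨a, b, ha, hb, hab, hab'⟩ := hz
  have h3 : a * inner ℝ (outerNormal U z) (x - z) + b * inner ℝ (outerNormal U z) (y - z) = 0 := by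
    rw [← inner_smul_right, ← inner_smul_right, ← inner_add_right]
    have : a • (x - z) + b • (y - z) = 0 := by
      rw [smul_sub, smul_sub, sub_add_sub_comm, hab', ← add_smul, hab, one_smul, sub_self]
    rw [this, inner_zero_right]
  have h4 : inner ℝ (outerNormal U z) (x - z) = 0 := by nlinarith
  have h5 : inner ℝ (outerNormal U z) (y - z) = 0 := by nlinarith
  exact h (((S.outerNormal_eq_iff hzf hx).2 h4).symm.trans ((S.outerNormal_eq_iff hzf hy).2 h5))

theorem dist_eq (S : BoundaryIso U V f ε) {a b : EuclideanSpace ℝ (Fin 2)}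
    (ha : a ∈ frontier U) (hb : b ∈ frontier U) (hab : dist a b < ε)
    (h : outerNormal U a ≠ outerNormal U b) : dist (f a) (f b) = dist a b :=
  S.dist_eq_of_openSegment_subset ha hb hab (S.openSegment_subset ha hb h)

theorem isPreconnected_frontier (S : BoundaryIso U V f ε) : IsPreconnected (frontier U) := by
  obtain ⟨h, -, -, hf⟩ := exists_homeomorph_image_interior_closure_frontier_eq_unitBall S.convex
    (by rw [S.isOpen_left.interior_eq]; exact S.nonempty_left) S.bounded_left
  rw [← h.isPreconnected_image, hf]
  refine (isConnected_sphere ?_ _ zero_le_one).isPreconnected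
  rw [← Module.finrank_eq_rank, finrank_euclideanSpace, Fintype.card_fin]
  norm_num

/-- Each face meets the extreme set. -/
theorem exists_extreme (S : BoundaryIso U V f ε) {n : EuclideanSpace ℝ (Fin 2)} (hn : ‖n‖ = 1) :
    ∃ p ∈ extremeSet U, n ∈ normalCone U p := by
  by_contra! hc
  have hn0 : n ≠ 0 := by rintro rfl; simp at hn
  obtain ⟨x, hx, hxn⟩ := exists_mem_normalCone S.isOpen_left S.nonempty_left S.bounded_left hn0
  obtain ⟨y, hy, hyn⟩ := exists_mem_normalCone S.isOpen_left S.nonempty_left S.bounded_left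
    (neg_ne_zero.2 hn0)
  have hA : IsClosed {p | p ∈ frontier U ∧ n ∈ normalCone U p} :=
    isClosed_frontier.inter ((isClosed_setOf_mem_normalCone U).preimage
      (Continuous.prodMk_right n))
  have hdis : frontier U ∩ ({p | p ∈ frontier U ∧ n ∈ normalCone U p} ∩
      closure {x | x ∈ frontier U ∧ n ∉ normalCone U x}) = ∅ := by
    refine eq_empty_of_forall_notMem fun p hp => ?_
    have hpE : p ∈ extremeSet U := by
      have hsub : {x | x ∈ frontier U ∧ n ∉ normalCone U x} ⊆
          {x | x ∈ frontier U ∧ outerNormal U x ≠ outerNormal U p} := by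
        refine fun q hq => ⟨hq.1, fun h => hq.2 ?_⟩
        rw [S.eq_outerNormal hp.1 hn hp.2.1.2, ← h]
        exact (S.outerNormal_spec hq.1).2
      exact ⟨hp.1, closure_mono hsub hp.2.2⟩
    exact hc p hpE hp.2.1.2
  rcases isPreconnected_iff_subset_of_disjoint_closed.1 S.isPreconnected_frontier _ _ hA
    isClosed_closure (fun p hp => by
      by_cases h : n ∈ normalCone U p
      · exact Or.inl ⟨hp, h⟩
      · exact Or.inr (subset_closure ⟨hp, h⟩)) hdis with h | h
  · have h1 := S.eq_outerNormal hy hn (h hy).2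
    have h2 := S.eq_outerNormal hy (by rw [norm_neg, hn]) hyn
    have h3 : (2 : ℝ) • n = 0 := by
      rw [two_smul]; exact add_eq_zero_iff_eq_neg.2 (h1.trans h2.symm)
    exact hn0 ((smul_eq_zero.1 h3).resolve_left two_ne_zero)
  · have : x ∈ (∅ : Set (EuclideanSpace ℝ (Fin 2))) := hdis ▸ ⟨hx, ⟨hx, hxn⟩, h hx⟩
    exact this

end BoundaryIso

/-- Points of the plane are located by their distances to three points in general position, up to
an isometry carrying those three points along. -/
theorem exists_linearIsometryEquiv_of_dist_eq {p x₁ x₂ p' x₁' x₂' : EuclideanSpace ℝ (Fin 2)}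
    (hli : LinearIndependent ℝ ![x₁ - p, x₂ - p]) (h₁ : dist x₁' p' = dist x₁ p)
    (h₂ : dist x₂' p' = dist x₂ p) (h₁₂ : dist x₁' x₂' = dist x₁ x₂) :
    ∃ T : EuclideanSpace ℝ (Fin 2) ≃ₗᵢ[ℝ] EuclideanSpace ℝ (Fin 2), ∀ y y', dist y' p' = dist y p →
      dist y' x₁' = dist y x₁ → dist y' x₂' = dist y x₂ → y' = p' + T (y - p) := by
  have key : ∀ {a b a' b' : EuclideanSpace ℝ (Fin 2)}, dist a' p' = dist a p →
      dist b' p' = dist b p → dist a' b' = dist a b →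
      inner ℝ (a' - p') (b' - p') = inner ℝ (a - p) (b - p) := by
    intro a b a' b' ha hb hab
    rw [real_inner_eq_norm_mul_self_add_norm_mul_self_sub_norm_sub_mul_self_div_two,
      real_inner_eq_norm_mul_self_add_norm_mul_self_sub_norm_sub_mul_self_div_two,
      sub_sub_sub_cancel_right, sub_sub_sub_cancel_right, ← dist_eq_norm, ← dist_eq_norm,
      ← dist_eq_norm, ← dist_eq_norm, ← dist_eq_norm, ← dist_eq_norm, ha, hb, hab]
  set b := basisOfLinearIndependentOfCardEqFinrank hli (by simp) with hb
  have hb0 : b 0 = x₁ - p := by simp [hb]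
  have hb1 : b 1 = x₂ - p := by simp [hb]
  set L : EuclideanSpace ℝ (Fin 2) →ₗ[ℝ] EuclideanSpace ℝ (Fin 2) :=
    b.constr ℝ ![x₁' - p', x₂' - p'] with hL
  have hL0 : L (x₁ - p) = x₁' - p' := by rw [← hb0, hL, Module.Basis.constr_basis]; rfl
  have hL1 : L (x₂ - p) = x₂' - p' := by rw [← hb1, hL, Module.Basis.constr_basis]; rfl
  have hnorm : ∀ z, ‖L z‖ = ‖z‖ := by
    intro z
    have hz : z = b.repr z 0 • (x₁ - p) + b.repr z 1 • (x₂ - p) := by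
      conv_lhs => rw [← b.sum_repr z, Fin.sum_univ_two, hb0, hb1]
    rw [← sq_eq_sq₀ (norm_nonneg _) (norm_nonneg _), ← real_inner_self_eq_norm_sq,
      ← real_inner_self_eq_norm_sq, hz, map_add, map_smul, map_smul, hL0, hL1]
    simp only [inner_add_left, inner_add_right, inner_smul_left, inner_smul_right]
    rw [key h₁ h₁ (by simp), key h₂ h₂ (by simp), key h₁ h₂ h₁₂,
      key h₂ h₁ (by rw [dist_comm, h₁₂, dist_comm])]
  let T := (LinearIsometry.mk L hnorm).toLinearIsometryEquiv rfl
  have hT : ∀ z, T z = L z := fun z => rfl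
  refine ⟨T, fun y y' hy hy1 hy2 => ?_⟩
  have h0 : ∀ z, inner ℝ (y' - p') (T z) = inner ℝ (T (y - p)) (T z) := by
    intro z
    have hz : z = b.repr z 0 • (x₁ - p) + b.repr z 1 • (x₂ - p) := by
      conv_lhs => rw [← b.sum_repr z, Fin.sum_univ_two, hb0, hb1]
    rw [T.inner_map_map, hz, hT, map_add, map_smul, map_smul, hL0, hL1]
    simp only [inner_add_right, inner_smul_right]
    rw [key hy h₁ hy1, key hy h₂ hy2]
  have h3 : y' - p' - T (y - p) = 0 := by
    rw [← inner_self_eq_zero (𝕜 := ℝ)]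
    have h4 := h0 (T.symm (y' - p' - T (y - p)))
    rw [T.apply_symm_apply] at h4
    rw [inner_sub_left, h4, sub_self]
  rw [← sub_eq_zero.1 h3]
  abel

theorem linearIsometryEquiv_ext_of_linearIndependent {u v : EuclideanSpace ℝ (Fin 2)}
    (h : LinearIndependent ℝ ![u, v])
    {T T' : EuclideanSpace ℝ (Fin 2) ≃ₗᵢ[ℝ] EuclideanSpace ℝ (Fin 2)} (hu : T u = T' u)
    (hv : T v = T' v) : T = T' := by
  have : T.toLinearEquiv.toLinearMap = T'.toLinearEquiv.toLinearMap := by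
    refine (basisOfLinearIndependentOfCardEqFinrank h (by simp)).ext fun i => ?_
    rw [coe_basisOfLinearIndependentOfCardEqFinrank]
    fin_cases i
    · exact hu
    · exact hv
  ext1 z
  exact LinearMap.congr_fun this z

namespace BoundaryIso

variable {U V : Set (EuclideanSpace ℝ (Fin 2))}
  {f : EuclideanSpace ℝ (Fin 2) → EuclideanSpace ℝ (Fin 2)} {ε : ℝ}

theorem exists_triangle (S : BoundaryIso U V f ε) {p : EuclideanSpace ℝ (Fin 2)}
    (hp : p ∈ extremeSet U) {r : ℝ} (hr : 0 < r) :
    ∃ x₁ ∈ frontier U, ∃ x₂ ∈ frontier U, dist x₁ p < r ∧ dist x₂ p < r ∧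
      outerNormal U x₁ ≠ outerNormal U p ∧ outerNormal U x₂ ≠ outerNormal U p ∧
      outerNormal U x₁ ≠ outerNormal U x₂ ∧ LinearIndependent ℝ ![x₁ - p, x₂ - p] := by
  obtain ⟨hpf, hpc⟩ := hp
  obtain ⟨x₁, ⟨hx₁, hν₁⟩, hd₁⟩ := Metric.mem_closure_iff.1 hpc r hr
  have h1 := S.inner_neg hx₁ hpf hν₁
  have hop : IsOpen {y | inner ℝ (outerNormal U x₁) (y - x₁) < 0} :=
    isOpen_lt (continuous_const.inner (continuous_id.sub continuous_const)) continuous_const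
  obtain ⟨x₂, ⟨hx₂1, hx₂2⟩, hx₂, hν₂⟩ := mem_closure_iff.1 hpc _ (hop.inter isOpen_ball)
    ⟨h1, mem_ball_self hr⟩
  have hx₂1' : inner ℝ (outerNormal U x₁) (x₂ - x₁) < 0 := hx₂1
  have hν₁₂ : outerNormal U x₁ ≠ outerNormal U x₂ := fun h =>
    hx₂1'.ne ((S.outerNormal_eq_iff hx₁ hx₂).1 h)
  refine ⟨x₁, hx₁, x₂, hx₂, by rwa [dist_comm], hx₂2, hν₁, hν₂, hν₁₂, ?_⟩
  have hne : x₁ - p ≠ 0 := by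
    intro h; rw [sub_eq_zero.1 h] at hν₁; exact hν₁ rfl
  rw [LinearIndependent.pair_iff' hne]
  intro a ha
  have e1 := S.inner_neg hpf hx₁ hν₁.symm
  have e2 := S.inner_neg hpf hx₂ hν₂.symm
  have e3 := S.inner_neg hx₂ hpf hν₂
  have e4 := S.inner_neg hx₂ hx₁ hν₁₂.symm
  rw [← ha, inner_smul_right] at e2
  rw [show x₂ - x₁ = (a - 1) • (x₁ - p) by
    rw [sub_smul, ha, one_smul]; abel, inner_smul_right] at hx₂1'
  rw [show p - x₁ = -(x₁ - p) by abel, inner_neg_right] at h1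
  rw [show p - x₂ = -(a • (x₁ - p)) by rw [ha]; abel, inner_neg_right, inner_smul_right] at e3
  rw [show x₁ - x₂ = (1 - a) • (x₁ - p) by
    rw [sub_smul, ha, one_smul]; abel, inner_smul_right] at e4
  have ha0 : 0 < a := by by_contra! h; nlinarith
  have ha1 : a < 1 := by by_contra! h; nlinarith
  have e5 : 0 < inner ℝ (outerNormal U x₂) (x₁ - p) := by by_contra! h; nlinarith
  nlinarith

theorem dist_eq_of_mem_extremeSet (S : BoundaryIso U V f ε) {p y : EuclideanSpace ℝ (Fin 2)}
    (hp : p ∈ extremeSet U) (hy : y ∈ frontier U) (h : dist y p < ε) :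
    dist (f y) (f p) = dist y p := by
  by_cases hν : outerNormal U y = outerNormal U p
  · obtain ⟨x, hx, hxp⟩ := mem_closure_iff_seq_limit.1 hp.2
    have h1 : Tendsto (fun n => f (x n)) atTop (𝓝 (f p)) :=
      (S.continuousOn p hp.1).tendsto.comp
        (tendsto_nhdsWithin_iff.2 ⟨hxp, Eventually.of_forall fun n => (hx n).1⟩)
    have h2 : Tendsto (fun n => dist (f y) (f (x n))) atTop (𝓝 (dist (f y) (f p))) :=
      tendsto_const_nhds.dist h1
    have h3 : Tendsto (fun n => dist y (x n)) atTop (𝓝 (dist y p)) := tendsto_const_nhds.dist hxp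
    refine tendsto_nhds_unique h2 (h3.congr' ?_)
    filter_upwards [h3.eventually_lt_const h] with n hn
    exact (S.dist_eq hy (hx n).1 hn (by rw [hν]; exact (hx n).2.symm)).symm
  · exact S.dist_eq hy hp.1 h hν

/-- Near an extreme point the boundary map is an isometry of the plane. -/
theorem exists_local_isometry (S : BoundaryIso U V f ε) {p : EuclideanSpace ℝ (Fin 2)}
    (hp : p ∈ extremeSet U) :
    ∃ T : EuclideanSpace ℝ (Fin 2) ≃ₗᵢ[ℝ] EuclideanSpace ℝ (Fin 2), ∃ r > 0,
      ∀ y ∈ frontier U, dist y p < r → f y = f p + T (y - p) := by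
  have hε := S.pos
  obtain ⟨x₁, hx₁, x₂, hx₂, hd₁, hd₂, hν₁, hν₂, hν₁₂, hli⟩ := S.exists_triangle hp (half_pos hε)
  obtain ⟨T, hT⟩ := exists_linearIsometryEquiv_of_dist_eq hli
    (S.dist_eq hx₁ hp.1 (by linarith) hν₁) (S.dist_eq hx₂ hp.1 (by linarith) hν₂)
    (S.dist_eq hx₁ hx₂ (by linarith [dist_triangle_right x₁ x₂ p]) hν₁₂)
  have hop : ∀ x, IsOpen {y | inner ℝ (outerNormal U x) (y - x) < 0} := fun x =>
    isOpen_lt (continuous_const.inner (continuous_id.sub continuous_const)) continuous_const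
  obtain ⟨r, hr, hball⟩ := Metric.isOpen_iff.1 ((hop x₁).inter (hop x₂)) p
    ⟨S.inner_neg hx₁ hp.1 hν₁, S.inner_neg hx₂ hp.1 hν₂⟩
  refine ⟨T, min r (ε / 2), lt_min hr (half_pos hε), fun y hy hyp => ?_⟩
  have hyr := hyp.trans_le (min_le_left _ _)
  have hyε := hyp.trans_le (min_le_right _ _)
  obtain ⟨g1, g2⟩ := hball (mem_ball.2 hyr)
  have g1' : inner ℝ (outerNormal U x₁) (y - x₁) < 0 := g1
  have g2' : inner ℝ (outerNormal U x₂) (y - x₂) < 0 := g2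
  refine hT y (f y) (S.dist_eq_of_mem_extremeSet hp hy (by linarith)) ?_ ?_
  · exact S.dist_eq hy hx₁ (by linarith [dist_triangle_right y x₁ p])
      fun h => g1'.ne ((S.outerNormal_eq_iff hx₁ hy).1 h.symm)
  · exact S.dist_eq hy hx₂ (by linarith [dist_triangle_right y x₂ p])
      fun h => g2'.ne ((S.outerNormal_eq_iff hx₂ hy).1 h.symm)

/-- The plane isometry followed by the boundary map near the extreme points is locally constant. -/
theorem exists_locally_constant_isometry (S : BoundaryIso U V f ε) :
    ∃ (T : EuclideanSpace ℝ (Fin 2) → EuclideanSpace ℝ (Fin 2) ≃ₗᵢ[ℝ] EuclideanSpace ℝ (Fin 2))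
      (c : EuclideanSpace ℝ (Fin 2) → EuclideanSpace ℝ (Fin 2)), ∀ p ∈ extremeSet U, ∃ r > 0,
      (∀ y ∈ frontier U, dist y p < r → f y = c p + T p y) ∧
      ∀ q ∈ extremeSet U, dist q p < r → T q = T p ∧ c q = c p := by
  have : ∀ p, ∃ T : EuclideanSpace ℝ (Fin 2) ≃ₗᵢ[ℝ] EuclideanSpace ℝ (Fin 2), ∃ r : ℝ,
      p ∈ extremeSet U → 0 < r ∧ ∀ y ∈ frontier U, dist y p < r → f y = f p + T (y - p) := by
    intro p
    by_cases hp : p ∈ extremeSet U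
    · obtain ⟨T, r, hr, h⟩ := S.exists_local_isometry hp
      exact ⟨T, r, fun _ => ⟨hr, h⟩⟩
    · exact ⟨LinearIsometryEquiv.refl ℝ _, 1, fun h => absurd h hp⟩
  choose T r h using this
  have hf : ∀ p ∈ extremeSet U, ∀ y ∈ frontier U, dist y p < r p → f y = f p - T p p + T p y := by
    intro p hp y hy hyp
    rw [(h p hp).2 y hy hyp, map_sub]
    abel
  refine ⟨T, fun p => f p - T p p, fun p hp => ⟨r p, (h p hp).1, hf p hp, fun q hq hqp => ?_⟩⟩
  obtain ⟨x₁, hx₁, x₂, hx₂, hd₁, hd₂, -, -, -, hli⟩ := S.exists_triangle hq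
    (r := min (r q) (r p - dist q p)) (lt_min (h q hq).1 (sub_pos.2 hqp))
  have e : ∀ x ∈ frontier U, dist x q < min (r q) (r p - dist q p) →
      f q - T q q + T q x = f p - T p p + T p x := fun x hx hxq => by
    rw [← hf q hq x hx (hxq.trans_le (min_le_left _ _)), ← hf p hp x hx]
    have := hxq.trans_le (min_le_right _ _)
    linarith [dist_triangle x q p]
  have e0 := e q hq.1 (by rw [dist_self]; exact lt_min (h q hq).1 (sub_pos.2 hqp))
  have e' : ∀ x ∈ frontier U, dist x q < min (r q) (r p - dist q p) →
      T q (x - q) = T p (x - q) := fun x hx hxq => by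
    have := congrArg₂ (· - ·) (e x hx hxq) e0
    simpa only [map_sub, add_sub_add_left_eq_sub] using this
  have hT := linearIsometryEquiv_ext_of_linearIndependent hli (e' x₁ hx₁ hd₁) (e' x₂ hx₂ hd₂)
  refine ⟨hT, ?_⟩
  rw [hT] at e0
  simp only [hT]
  exact add_right_cancel e0

end BoundaryIso

namespace BoundaryIso

variable {U V : Set (EuclideanSpace ℝ (Fin 2))}
  {f : EuclideanSpace ℝ (Fin 2) → EuclideanSpace ℝ (Fin 2)} {ε : ℝ}

theorem inner_tangent_nonpos (S : BoundaryIso U V f ε) {p m e : EuclideanSpace ℝ (Fin 2)} {r : ℝ}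
    (hp : p ∈ frontier U) (hr : 0 < r)
    (hm : ∀ y ∈ frontier U, dist y p < r → inner ℝ m (y - p) ≤ 0)
    (he : IsFrame e (outerNormal U p)) : inner ℝ m e ≤ 0 := by
  obtain ⟨hν1, hν⟩ := S.outerNormal_spec hp
  set n := outerNormal U p with hn
  have hne : n ≠ 0 := S.outerNormal_ne_zero hp
  obtain ⟨z, hz, hze⟩ : ∃ z ∈ U, 0 < inner ℝ e (z - p) := by
    by_contra! hc
    have h1 := S.eq_outerNormal hp he.norm_left (mem_normalCone_of_forall hc)
    have h2 := he.inner_eq_zero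
    rw [h1, ← hn, real_inner_self_eq_norm_sq, hν1] at h2
    norm_num at h2
  set a := inner ℝ e (z - p) with ha
  refine le_of_forall_pos_le_add fun η hη => ?_
  have hκ : 0 < η / (‖m‖ + 1) := by positivity
  obtain ⟨ρ, hρ, hball⟩ := Metric.eventually_nhds_iff.1
    (S.smooth_left.eventually_abs_inner_le he hp hν hκ)
  have hzp : 0 < ‖z - p‖ := by
    rw [norm_pos_iff]; intro h; rw [ha, h, inner_zero_right] at hze; exact lt_irrefl _ hze
  set t := min 1 (min ρ r / (2 * ‖z - p‖)) with ht
  have ht0 : 0 < t := by positivity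
  have ht1 : t ≤ 1 := min_le_left _ _
  have htρ : t * ‖z - p‖ < min ρ r := by
    have : t ≤ min ρ r / (2 * ‖z - p‖) := min_le_right _ _
    rw [le_div_iff₀ (by positivity)] at this
    have : 0 < min ρ r := lt_min hρ hr
    linarith
  have hzt : p + t • (z - p) ∈ U := by
    have := S.convex.add_smul_sub_mem_interior' (x := p) (y := z) (frontier_subset_closure hp)
      (by rwa [S.isOpen_left.interior_eq]) ⟨ht0, ht1⟩
    rwa [S.isOpen_left.interior_eq] at this
  have hb : p + (t * a) • e ∉ U := by
    intro h
    have := inner_neg_of_mem_normalCone S.isOpen_left hν hne h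
    rw [add_sub_cancel_left, inner_smul_right, real_inner_comm, he.inner_eq_zero, mul_zero] at this
    exact lt_irrefl _ this
  obtain ⟨y, hy, hyf⟩ : ∃ y ∈ segment ℝ (p + t • (z - p)) (p + (t * a) • e), y ∈ frontier U := by
    by_contra! hc
    exact hb (mem_of_segment_disjoint_frontier hzt hc)
  have hyd : dist y p < min ρ r := by
    refine (convex_ball p (min ρ r)).segment_subset ?_ ?_ hy
    · rw [mem_ball, dist_eq_norm, add_sub_cancel_left, norm_smul, Real.norm_of_nonneg ht0.le]
      exact htρ
    · rw [mem_ball, dist_eq_norm, add_sub_cancel_left, norm_smul, he.norm_left,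
        Real.norm_of_nonneg (by positivity), mul_one]
      refine lt_of_le_of_lt ?_ htρ
      gcongr
      exact (le_abs_self _).trans (he.abs_inner_left_le _)
  have hye : inner ℝ e (y - p) = t * a := by
    obtain ⟨α, β, -, -, hαβ, rfl⟩ := hy
    have : α • (p + t • (z - p)) + β • (p + (t * a) • e) - p =
        α • t • (z - p) + β • (t * a) • e := by
      obtain rfl : β = 1 - α := by linarith
      module
    rw [this, inner_add_right, inner_smul_right, inner_smul_right, inner_smul_right,
      inner_smul_right, ← ha, real_inner_self_eq_norm_sq, he.norm_left]
    linear_combination (t * a) * hαβ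
  have h1 := hball (hyd.trans_le (min_le_left _ _)) hyf
  have h2 := hm y hyf (hyd.trans_le (min_le_right _ _))
  have hta : 0 < t * a := by positivity
  rw [hye, abs_of_pos hta] at h1
  rw [he.decomp (y - p), hye, inner_add_right, inner_smul_right, inner_smul_right] at h2
  have h3 : |inner ℝ m n| ≤ ‖m‖ := by
    have := abs_real_inner_le_norm m n
    rwa [hν1, mul_one] at this
  have h4 : |inner ℝ n (y - p) * inner ℝ m n| ≤ η / (‖m‖ + 1) * (t * a) * ‖m‖ := by
    rw [abs_mul]
    gcongr
  have h5 : η / (‖m‖ + 1) * ‖m‖ ≤ η := by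
    rw [div_mul_eq_mul_div, div_le_iff₀ (by positivity)]
    nlinarith [norm_nonneg m]
  have h6 := neg_abs_le (inner ℝ n (y - p) * inner ℝ m n)
  have h7 : t * a * inner ℝ m e ≤ t * a * η := by nlinarith
  have := le_of_mul_le_mul_left h7 hta
  linarith

/-- A direction which is locally outer normal at an extreme point is globally so. -/
theorem mem_normalCone_of_local (S : BoundaryIso U V f ε) {p m : EuclideanSpace ℝ (Fin 2)} {r : ℝ}
    (hp : p ∈ extremeSet U) (hr : 0 < r)
    (hm : ∀ y ∈ frontier U, dist y p < r → inner ℝ m (y - p) ≤ 0) : m ∈ normalCone U p := by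
  obtain ⟨hν1, hν⟩ := S.outerNormal_spec hp.1
  obtain ⟨e, he⟩ := exists_isFrame hν1
  have h1 := S.inner_tangent_nonpos hp.1 hr hm he
  have h2 := S.inner_tangent_nonpos hp.1 hr hm he.neg_left
  rw [inner_neg_right] at h2
  have h3 : m = inner ℝ (outerNormal U p) m • outerNormal U p := by
    conv_lhs => rw [he.decomp m]
    rw [real_inner_comm, le_antisymm h1 (by linarith), zero_smul, zero_add]
  rcases le_or_gt 0 (inner ℝ (outerNormal U p) m) with h4 | h4
  · rw [h3]
    exact smul_mem_normalCone h4 hν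
  · obtain ⟨y, ⟨hy, hyν⟩, hyp⟩ := Metric.mem_closure_iff.1 hp.2 r hr
    have h5 := S.inner_neg hp.1 hy hyν.symm
    have h6 := hm y hy (by rwa [dist_comm])
    rw [h3, inner_smul_left] at h6
    simp only [conj_trivial] at h6
    nlinarith

theorem mem_normalCone_image (S : BoundaryIso U V f ε) {x y m n : EuclideanSpace ℝ (Fin 2)}
    (hx : x ∈ frontier U) (hy : y ∈ frontier U) (hm0 : m ≠ 0) (hmx : m ∈ normalCone U x)
    (hmy : m ∈ normalCone U y) (hn : n ∈ normalCone V (f x)) :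
    inner ℝ n (f y - f x) = 0 ∧ n ∈ normalCone V (f y) := by
  suffices h : inner ℝ n (f y - f x) = 0 from ⟨h, mem_normalCone_of_inner_eq_zero hn h⟩
  rcases eq_or_ne x y with rfl | hxy
  · rw [sub_self, inner_zero_right]
  rcases eq_or_ne n 0 with rfl | hn0
  · exact inner_zero_left _
  have h1 := (S.flat_segment hxy (S.segment_subset_frontier hx hy hm0 hmx hmy)
    (m := ‖n‖⁻¹ • n) (norm_smul_inv_norm hn0)
    (smul_mem_normalCone (c := ‖n‖⁻¹) (by positivity) hn)).2.1
  rw [inner_smul_left] at h1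
  simpa [hn0] using h1

theorem exists_extreme_image (S : BoundaryIso U V f ε) (n : EuclideanSpace ℝ (Fin 2)) :
    ∃ p ∈ extremeSet U, n ∈ normalCone V (f p) := by
  wlog hn0 : n ≠ 0 generalizing n
  · obtain ⟨p, hp, -⟩ := this (!₂[1, 0]) (fun h => by simpa using congrArg (· 0) h)
    rw [not_not] at hn0
    exact ⟨p, hp, fun z _ => by rw [hn0, inner_zero_left]⟩
  obtain ⟨v, hv, hnv⟩ := exists_mem_normalCone S.isOpen_right S.nonempty_right S.bounded_right hn0
  obtain ⟨x, hx, rfl⟩ := S.bijOn.surjOn hv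
  obtain ⟨hν1, hν⟩ := S.outerNormal_spec hx
  obtain ⟨p, hp, hpn⟩ := S.exists_extreme hν1
  exact ⟨p, hp, (S.mem_normalCone_image hx hp.1 (S.outerNormal_ne_zero hx) hν hpn hnv).2⟩

/-- Finitely many isometries describe the boundary map near the extreme points. -/
theorem exists_pieces (S : BoundaryIso U V f ε) :
    ∃ (ι : Type) (_ : Finite ι) (K : ι → Set (EuclideanSpace ℝ (Fin 2)))
      (T : ι → EuclideanSpace ℝ (Fin 2) ≃ₗᵢ[ℝ] EuclideanSpace ℝ (Fin 2))
      (c : ι → EuclideanSpace ℝ (Fin 2)), (∀ i, IsCompact (K i)) ∧ (⋃ i, K i) = extremeSet U ∧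
      (∀ i j p, p ∈ K i → p ∈ K j → i = j) ∧ (∀ i j, T i = T j → c i = c j → i = j) ∧
      ∀ i, ∀ p ∈ K i, ∃ r > 0, ∀ y ∈ frontier U, dist y p < r → f y = c i + T i y := by
  obtain ⟨T, c, h⟩ := S.exists_locally_constant_isometry
  set Φ : extremeSet U → (EuclideanSpace ℝ (Fin 2) ≃ₗᵢ[ℝ] EuclideanSpace ℝ (Fin 2)) ×
    EuclideanSpace ℝ (Fin 2) := fun p => (T p, c p) with hΦ
  have hE : IsCompact (extremeSet U) :=
    (frontier_isCompact S.bounded_left).of_isClosed_subset (isClosed_extremeSet U) fun _ hp => hp.1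
  have : CompactSpace (extremeSet U) := isCompact_iff_compactSpace.1 hE
  have hloc : IsLocallyConstant Φ := by
    rw [IsLocallyConstant.iff_eventually_eq]
    intro p
    obtain ⟨r, hr, -, h2⟩ := h p p.2
    filter_upwards [ball_mem_nhds p hr] with q hq
    obtain ⟨h3, h4⟩ := h2 q q.2 hq
    exact Prod.ext h3 h4
  refine ⟨range Φ, hloc.range_finite, fun i => (↑) '' (Φ ⁻¹' {i.1}), fun i => i.1.1,
    fun i => i.1.2, fun i => ?_, ?_, ?_, ?_, ?_⟩
  · exact ((hloc.isClosed_fiber i.1).isCompact).image continuous_subtype_val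
  · ext p
    rw [mem_iUnion]
    constructor
    · rintro ⟨i, q, -, rfl⟩
      exact q.2
    · exact fun hp => ⟨⟨Φ ⟨p, hp⟩, mem_range_self _⟩, ⟨p, hp⟩, rfl, rfl⟩
  · rintro i j - ⟨p, hp, rfl⟩ ⟨q, hq, hqp⟩
    obtain rfl := Subtype.ext hqp
    exact Subtype.ext (hp.symm.trans hq)
  · exact fun i j h1 h2 => Subtype.ext (Prod.ext h1 h2)
  · rintro i - ⟨p, hp, rfl⟩
    obtain ⟨r, hr, h1, -⟩ := h p p.2
    refine ⟨r, hr, ?_⟩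
    beta_reduce
    rw [← (hp : Φ p = i.1)]
    exact h1

end BoundaryIso

theorem isClosed_setOf_exists_mem_normalCone (W : Set (EuclideanSpace ℝ (Fin 2)))
    {K : Set (EuclideanSpace ℝ (Fin 2))} (hK : IsCompact K)
    {g : EuclideanSpace ℝ (Fin 2) → EuclideanSpace ℝ (Fin 2)} (hg : ContinuousOn g K) :
    IsClosed {n | ∃ p ∈ K, n ∈ normalCone W (g p)} := by
  have : CompactSpace K := isCompact_iff_compactSpace.1 hK
  have hF : IsClosed {q : EuclideanSpace ℝ (Fin 2) × K | q.1 ∈ normalCone W (g q.2)} :=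
    (isClosed_setOf_mem_normalCone W).preimage
      (continuous_fst.prodMk (hg.domRestrict.comp continuous_snd))
  convert isClosedMap_fst_of_compactSpace _ hF
  ext n
  constructor
  · rintro ⟨p, hp, h⟩
    exact ⟨(n, ⟨p, hp⟩), h, rfl⟩
  · rintro ⟨⟨n, p⟩, h, rfl⟩
    exact ⟨p, p.2, h⟩

/-- Almost every direction is normal at a single point. -/
theorem ae_eq_of_mem_normalCone {U : Set (EuclideanSpace ℝ (Fin 2))} (hne : U.Nonempty)
    (hb : Bornology.IsBounded U) : ∀ᵐ m : EuclideanSpace ℝ (Fin 2),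
      ∀ p ∈ closure U, ∀ q ∈ closure U, m ∈ normalCone U p → m ∈ normalCone U q → p = q := by
  have hK : IsCompact (closure U) :=
    Metric.isCompact_of_isClosed_isBounded isClosed_closure hb.closure
  have hex : ∀ m : EuclideanSpace ℝ (Fin 2), ∃ x ∈ closure U, ∀ z ∈ closure U,
      inner ℝ m z ≤ inner ℝ m x := fun m => hK.exists_isMaxOn hne.closure
        (f := fun z => inner ℝ m z) (continuous_const.inner continuous_id).continuousOn
  choose g hg hmax using hex
  obtain ⟨R, hR⟩ := hb.closure.exists_norm_le
  have hR' : ∀ x ∈ closure U, ‖x‖ ≤ R.toNNReal := fun x hx => (hR x hx).trans (Real.le_coe_toNNReal R)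
  have hlip : LipschitzWith R.toNNReal fun m => inner ℝ m (g m) := by
    refine LipschitzWith.of_le_add_mul _ fun m m' => ?_
    have h1 := hmax m' (g m) (hg m)
    have h2 : inner ℝ m (g m) = inner ℝ m' (g m) + inner ℝ (m - m') (g m) := by
      rw [inner_sub_left]; ring
    have h3 := real_inner_le_norm (m - m') (g m)
    have h4 : ‖m - m'‖ * ‖g m‖ ≤ ‖m - m'‖ * R.toNNReal := by gcongr; exact hR' _ (hg m)
    rw [dist_eq_norm]
    linarith
  filter_upwards [hlip.ae_differentiableAt (μ := MeasureTheory.volume)] with m hd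
  have key : ∀ p ∈ closure U, m ∈ normalCone U p →
      fderiv ℝ (fun m => inner ℝ m (g m)) m = innerSL ℝ p := by
    intro p hp hmp
    have hmin : IsLocalMin (fun m' => inner ℝ m' (g m') - innerSL ℝ p m') m := by
      refine Eventually.of_forall fun m' => ?_
      have h1 := hmp (g m) (hg m)
      rw [inner_sub_right] at h1
      have h2 := hmax m' p hp
      simp only [innerSL_apply_apply, real_inner_comm _ p]
      linarith
    have h3 := hmin.hasFDerivAt_eq_zero (hd.hasFDerivAt.sub (innerSL ℝ p).hasFDerivAt)
    exact sub_eq_zero.1 h3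
  intro p hp q hq hmp hmq
  have h1 := (key p hp hmp).symm.trans (key q hq hmq)
  exact (innerSL_inj).1 h1

open MeasureTheory in
theorem iUnion_preimage_eq_univ {ι : Type} [Finite ι] {C D : ι → Set (EuclideanSpace ℝ (Fin 2))}
    (T : ι → EuclideanSpace ℝ (Fin 2) ≃ₗᵢ[ℝ] EuclideanSpace ℝ (Fin 2)) (hC : ∀ i, IsClosed (C i))
    (hCD : ∀ i, T i ⁻¹' C i ⊆ D i) (hcover : ⋃ i, C i = univ)
    (hD : ∀ᵐ m : EuclideanSpace ℝ (Fin 2), ∀ i j, m ∈ D i → m ∈ D j → i = j) :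
    ⋃ i, T i ⁻¹' C i = univ := by
  have := Fintype.ofFinite ι
  have hcl : ∀ i, IsClosed (T i ⁻¹' C i) := fun i => (hC i).preimage (T i).continuous
  have hcl' : IsClosed (⋃ i, T i ⁻¹' C i) := isClosed_iUnion_of_finite hcl
  by_contra hne
  obtain ⟨x, hx⟩ := (ne_univ_iff_exists_notMem _).1 hne
  set B : Set (EuclideanSpace ℝ (Fin 2)) := ball 0 (‖x‖ + 1) with hB
  have hxB : x ∈ B := by rw [hB, mem_ball_zero_iff]; exact lt_add_one _
  have hpre : ∀ i, T i ⁻¹' (C i ∩ B) = T i ⁻¹' C i ∩ B := fun i => by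
    ext z; simp [hB]
  have hBC : B = ⋃ i, C i ∩ B := by rw [← iUnion_inter, hcover, univ_inter]
  have hdis : Pairwise (Function.onFun (AEDisjoint volume) fun i => T i ⁻¹' C i ∩ B) := by
    intro i j hij
    refine measure_mono_null (fun m hm => ?_) (ae_iff.1 hD)
    exact fun h => hij (h i j (hCD i hm.1.1) (hCD j hm.2.1))
  have hμ : volume B ≤ volume ((⋃ i, T i ⁻¹' C i) ∩ B) := by
    calc volume B ≤ ∑ i, volume (C i ∩ B) := by
          conv_lhs => rw [hBC]
          exact measure_iUnion_fintype_le _ _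
      _ = ∑ i, volume (T i ⁻¹' C i ∩ B) := by
          refine Finset.sum_congr rfl fun i _ => ?_
          rw [← hpre, (T i).measurePreserving.measure_preimage
            ((hC i).measurableSet.inter measurableSet_ball).nullMeasurableSet]
      _ = volume ((⋃ i, T i ⁻¹' C i) ∩ B) := by
          rw [iUnion_inter, measure_iUnion₀ hdis fun i =>
            ((hcl i).measurableSet.inter measurableSet_ball).nullMeasurableSet, tsum_fintype]
  have hfin : volume ((⋃ i, T i ⁻¹' C i) ∩ B) ≠ ∞ :=
    measure_ne_top_of_subset inter_subset_right measure_ball_lt_top.ne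
  have h0 : volume (B \ ((⋃ i, T i ⁻¹' C i) ∩ B)) = 0 := by
    rw [measure_sdiff inter_subset_right
      (hcl'.measurableSet.inter measurableSet_ball).nullMeasurableSet hfin]
    exact tsub_eq_zero_of_le hμ
  have hop : IsOpen (B \ ((⋃ i, T i ⁻¹' C i) ∩ B)) := by
    rw [sdiff_inter_self_eq_sdiff]
    exact isOpen_ball.sdiff hcl'
  exact (hop.measure_pos volume ⟨x, hxB, fun h => hx h.1⟩).ne' h0

namespace BoundaryIso

variable {U V : Set (EuclideanSpace ℝ (Fin 2))}
  {f : EuclideanSpace ℝ (Fin 2) → EuclideanSpace ℝ (Fin 2)} {ε : ℝ}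

theorem mem_normalCone_symm (S : BoundaryIso U V f ε) {p c n : EuclideanSpace ℝ (Fin 2)}
    {T : EuclideanSpace ℝ (Fin 2) ≃ₗᵢ[ℝ] EuclideanSpace ℝ (Fin 2)} (hp : p ∈ extremeSet U)
    (hT : ∃ r > 0, ∀ y ∈ frontier U, dist y p < r → f y = c + T y)
    (hn : T n ∈ normalCone V (f p)) : n ∈ normalCone U p := by
  obtain ⟨r, hr, hT⟩ := hT
  refine S.mem_normalCone_of_local hp hr fun y hy hyp => ?_
  rw [← T.inner_map_map, map_sub, ← add_sub_add_left_eq_sub _ _ c, ← hT y hy hyp,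
    ← hT p hp.1 (by rwa [dist_self])]
  exact hn _ (S.mem_closure_right hy)

/-- Both ends of a face are moved by the same isometry. -/
theorem eq_of_face (S : BoundaryIso U V f ε) {p b c c' n : EuclideanSpace ℝ (Fin 2)}
    {T T' : EuclideanSpace ℝ (Fin 2) ≃ₗᵢ[ℝ] EuclideanSpace ℝ (Fin 2)} (hp : p ∈ extremeSet U)
    (hb : b ∈ extremeSet U) (hpb : p ≠ b) (hn1 : ‖n‖ = 1) (hnp : n ∈ normalCone U p)
    (hnb : n ∈ normalCone U b)
    (hT : ∃ r > 0, ∀ y ∈ frontier U, dist y p < r → f y = c + T y)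
    (hT' : ∃ r > 0, ∀ y ∈ frontier U, dist y b < r → f y = c' + T' y)
    (hn : T n ∈ normalCone V (f p)) : T = T' ∧ c = c' := by
  have hn0 : n ≠ 0 := by rintro rfl; simp at hn1
  obtain ⟨h1, h2⟩ := S.mem_normalCone_image hp.1 hb.1 hn0 hnp hnb hn
  have hseg := S.segment_subset_frontier hp.1 hb.1 hn0 hnp hnb
  have hflat := (S.flat_segment hpb hseg (by rw [T.norm_map, hn1]) hn).1
  have hnn : T' n = T n := by
    have h3 : T'.symm (T n) ∈ normalCone U b :=
      S.mem_normalCone_symm hb hT' (by rwa [T'.apply_symm_apply])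
    have h4 := S.eq_outerNormal hb.1 (by rw [T'.symm.norm_map, T.norm_map, hn1]) h3
    rw [S.eq_outerNormal hb.1 hn1 hnb, ← h4, T'.apply_symm_apply, h4,
      ← S.eq_outerNormal hb.1 hn1 hnb]
  obtain ⟨r, hr, hT⟩ := hT
  obtain ⟨r', hr', hT'⟩ := hT'
  have hfp := hT p hp.1 (by rwa [dist_self])
  have hfb := hT' b hb.1 (by rwa [dist_self])
  have hd : 0 < dist p b := dist_pos.2 hpb
  have hlm : ∀ t ∈ Icc (0 : ℝ) 1, AffineMap.lineMap p b t ∈ frontier U := fun t ht =>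
    hseg (by rw [segment_eq_image_lineMap]; exact mem_image_of_mem _ ht)
  have e1 : T (b - p) = f b - f p := by
    set t := min 1 (r / (2 * dist p b)) with ht
    have ht0 : 0 < t := by positivity
    have ht1 : t ≤ 1 := min_le_left _ _
    have htr : t * dist p b < r := by
      have : t ≤ r / (2 * dist p b) := min_le_right _ _
      rw [le_div_iff₀ (by positivity)] at this
      linarith
    have h5 := hT _ (hlm t ⟨ht0.le, ht1⟩)
      (by rwa [dist_lineMap_left, Real.norm_of_nonneg ht0.le])
    rw [hflat t ⟨ht0.le, ht1⟩, AffineMap.lineMap_apply, AffineMap.lineMap_apply] at h5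
    simp only [vsub_eq_sub, vadd_eq_add, map_add, map_smul] at h5
    have h6 : t • (T (b - p)) = t • (f b - f p) := by
      rw [hfp] at h5 ⊢
      have := congrArg (· - (c + T p)) h5
      simp only [add_sub_cancel_right] at this
      rw [this]
      abel
    exact smul_right_injective _ ht0.ne' h6
  have e2 : T' (b - p) = f b - f p := by
    set t := min 1 (r' / (2 * dist p b)) with ht
    have ht0 : 0 < t := by positivity
    have ht1 : t ≤ 1 := min_le_left _ _
    have htr : t * dist p b < r' := by
      have : t ≤ r' / (2 * dist p b) := min_le_right _ _
      rw [le_div_iff₀ (by positivity)] at this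
      linarith
    have hmem : (1 - t) ∈ Icc (0 : ℝ) 1 := ⟨by linarith, by linarith⟩
    have h5 := hT' _ (hlm (1 - t) hmem)
      (by rwa [dist_lineMap_right, _root_.sub_sub_cancel, Real.norm_of_nonneg ht0.le])
    rw [hflat _ hmem, AffineMap.lineMap_apply, AffineMap.lineMap_apply] at h5
    simp only [vsub_eq_sub, vadd_eq_add, map_add, map_smul] at h5
    have h6 : t • (T' (b - p)) = t • (f b - f p) := by
      have h7 : (1 - t) • (f b - f p) + f p = f b - t • (f b - f p) := by module
      have h8 : c' + ((1 - t) • T' (b - p) + T' p) = c' + T' b - t • T' (b - p) := by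
        rw [map_sub]; module
      rw [h7, h8, ← hfb] at h5
      exact (sub_right_injective h5).symm
    exact smul_right_injective _ ht0.ne' h6
  have hli : LinearIndependent ℝ ![n, b - p] := by
    rw [LinearIndependent.pair_iff' hn0]
    intro a ha
    have h5 : inner ℝ n (b - p) = 0 := by rw [← T.inner_map_map, e1]; exact h1
    rw [← ha, inner_smul_right, real_inner_self_eq_norm_sq, hn1] at h5
    have h6 : a = 0 := by simpa using h5
    rw [h6, zero_smul] at ha
    exact hpb (sub_eq_zero.1 ha.symm).symm
  have hTT := linearIsometryEquiv_ext_of_linearIndependent hli hnn.symm (e1.trans e2.symm)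
  refine ⟨hTT, ?_⟩
  rw [hfb, hfp, ← hTT, map_sub] at e1
  have : c' - c = 0 := by
    have := sub_eq_zero.2 e1.symm
    rw [← this]
    abel
  exact (sub_eq_zero.1 this).symm

/-- The boundary map is a single plane isometry near the extreme points. -/
theorem exists_global_isometry (S : BoundaryIso U V f ε) :
    ∃ (T : EuclideanSpace ℝ (Fin 2) ≃ₗᵢ[ℝ] EuclideanSpace ℝ (Fin 2))
      (c : EuclideanSpace ℝ (Fin 2)), ∀ n, ∃ p ∈ extremeSet U,
        n ∈ normalCone U p ∧ T n ∈ normalCone V (f p) ∧ f p = c + T p := by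
  obtain ⟨ι, hι, K, T, c, hK, hKE, hKd, hinj, hloc⟩ := S.exists_pieces
  have hE : ∀ i, ∀ p ∈ K i, p ∈ extremeSet U := fun i p hp => hKE ▸ mem_iUnion.2 ⟨i, hp⟩
  have hstar : ∀ n, ∃ i, ∃ p ∈ K i, n ∈ normalCone U p ∧ T i n ∈ normalCone V (f p) := by
    have hD : ∀ᵐ m : EuclideanSpace ℝ (Fin 2), ∀ i j,
        m ∈ {n | ∃ p ∈ K i, n ∈ normalCone U p} → m ∈ {n | ∃ p ∈ K j, n ∈ normalCone U p} →
          i = j := by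
      filter_upwards [ae_eq_of_mem_normalCone S.nonempty_left S.bounded_left] with m hm
      rintro i j ⟨p, hp, hmp⟩ ⟨q, hq, hmq⟩
      obtain rfl := hm p (frontier_subset_closure (hE i p hp).1) q
        (frontier_subset_closure (hE j q hq).1) hmp hmq
      exact hKd i j p hp hq
    have := iUnion_preimage_eq_univ (C := fun i => {n | ∃ p ∈ K i, n ∈ normalCone V (f p)})
      (D := fun i => {n | ∃ p ∈ K i, n ∈ normalCone U p}) T
      (fun i => isClosed_setOf_exists_mem_normalCone V (hK i)
        (S.continuousOn.mono fun p hp => (hE i p hp).1))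
      (fun i n ⟨p, hp, h⟩ => ⟨p, hp, S.mem_normalCone_symm (hE i p hp) (hloc i p hp) h⟩)
      (by
        refine eq_univ_of_forall fun n => ?_
        obtain ⟨p, hp, h⟩ := S.exists_extreme_image n
        rw [← hKE, mem_iUnion] at hp
        obtain ⟨i, hp⟩ := hp
        exact mem_iUnion.2 ⟨i, p, hp, h⟩) hD
    intro n
    obtain ⟨i, p, hp, h⟩ := mem_iUnion.1 (this ▸ mem_univ n)
    exact ⟨i, p, hp, S.mem_normalCone_symm (hE i p hp) (hloc i p hp) h, h⟩
  have huniq : ∀ n, ‖n‖ = 1 → ∀ i j, (∃ p ∈ K i, n ∈ normalCone U p) →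
      (∃ p ∈ K j, n ∈ normalCone U p) → i = j := by
    intro n hn
    obtain ⟨k, p, hp, hnp, hTn⟩ := hstar n
    suffices h : ∀ i, (∃ p ∈ K i, n ∈ normalCone U p) → k = i from
      fun i j hi hj => (h i hi).symm.trans (h j hj)
    rintro i ⟨b, hb, hnb⟩
    rcases eq_or_ne p b with rfl | hpb
    · exact hKd k i p hp hb
    · obtain ⟨h1, h2⟩ := S.eq_of_face (hE k p hp) (hE i b hb) hpb hn hnp hnb (hloc k p hp)
        (hloc i b hb) hTn
      exact hinj k i h1 h2
  have hG : ∀ i, IsClosed {n | ∃ p ∈ K i, n ∈ normalCone U p} := fun i =>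
    isClosed_setOf_exists_mem_normalCone U (hK i) continuousOn_id
  have hconn : IsConnected (sphere (0 : EuclideanSpace ℝ (Fin 2)) 1) := by
    refine isConnected_sphere ?_ _ zero_le_one
    rw [← Module.finrank_eq_rank, finrank_euclideanSpace, Fintype.card_fin]
    norm_num
  obtain ⟨n₀, hn₀⟩ := hconn.nonempty
  obtain ⟨i, q₀, hq₀, hnq₀, -⟩ := hstar n₀
  have hall : ∀ j, ∀ p ∈ K j, j = i := by
    intro j p hp
    obtain ⟨hν1, hν⟩ := S.outerNormal_spec (hE j p hp).1
    have hcl : IsClosed (⋃ j : {j // j ≠ i}, {n | ∃ p ∈ K j, n ∈ normalCone U p}) :=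
      isClosed_iUnion_of_finite fun j => hG j
    rcases isPreconnected_iff_subset_of_disjoint_closed.1 hconn.isPreconnected _ _ (hG i) hcl
      (fun n _ => by
        obtain ⟨k, q, hq, hnq, -⟩ := hstar n
        by_cases hk : k = i
        · exact Or.inl ⟨q, hk ▸ hq, hnq⟩
        · exact Or.inr (mem_iUnion.2 ⟨⟨k, hk⟩, q, hq, hnq⟩))
      (eq_empty_of_forall_notMem fun n ⟨hn, h1, h2⟩ => by
        obtain ⟨k, h2⟩ := mem_iUnion.1 h2
        exact k.2 (huniq n (by simpa using hn) _ _ h2 h1)) with h | h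
    · exact huniq _ hν1 _ _ ⟨p, hp, hν⟩ (h (by simpa using hν1))
    · obtain ⟨k, h2⟩ := mem_iUnion.1 (h hn₀)
      exact absurd (huniq n₀ (by simpa using hn₀) _ _ h2 ⟨q₀, hq₀, hnq₀⟩) k.2
  refine ⟨T i, c i, fun n => ?_⟩
  obtain ⟨j, p, hp, h1, h2⟩ := hstar n
  obtain rfl := hall j p hp
  obtain ⟨r, hr, h3⟩ := hloc j p hp
  exact ⟨p, hE j p hp, h1, h2, h3 p (hE j p hp).1 (by rwa [dist_self])⟩

theorem exists_isometryEquiv (S : BoundaryIso U V f ε) :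
    ∃ J : EuclideanSpace ℝ (Fin 2) ≃ᵢ EuclideanSpace ℝ (Fin 2), J '' U = V := by
  obtain ⟨T, c, hstar⟩ := S.exists_global_isometry
  set J : EuclideanSpace ℝ (Fin 2) ≃ᵢ EuclideanSpace ℝ (Fin 2) :=
    T.toIsometryEquiv.trans (IsometryEquiv.addLeft c) with hJ
  have hJz : ∀ z, J z = c + T z := fun z => rfl
  have hsub : V ⊆ J '' closure U := by
    intro v hv
    refine ⟨J.symm v, ?_, J.apply_symm_apply v⟩
    set z := J.symm v with hz
    have hvz : v = c + T z := by rw [← hJz, hz, J.apply_symm_apply]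
    by_contra hzU
    obtain ⟨φ, s, h1, h2⟩ := geometric_hahn_banach_closed_point S.convex.closure isClosed_closure hzU
    set m := (InnerProductSpace.toDual ℝ (EuclideanSpace ℝ (Fin 2))).symm φ with hm
    have hmφ : ∀ z, inner ℝ m z = φ z := fun z => InnerProductSpace.toDual_symm_apply
    obtain ⟨p, hp, -, h4, h5⟩ := hstar m
    have h6 := h4 v (subset_closure hv)
    rw [h5, hvz, add_sub_add_left_eq_sub, ← map_sub, T.inner_map_map, inner_sub_right, hmφ,
      hmφ] at h6
    linarith [h1 p (frontier_subset_closure hp.1)]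
  have hsubcl : closure V ⊆ J '' closure U :=
    closure_minimal hsub (J.toHomeomorph.isClosedMap _ isClosed_closure)
  have hWo : IsOpen (J ⁻¹' V) := S.isOpen_right.preimage J.continuous
  have hWU : J ⁻¹' V ⊆ U := by
    have h1 : J ⁻¹' V ⊆ closure U := fun z hz => by
      obtain ⟨w, hw, hwz⟩ := hsub hz
      rwa [← J.injective hwz]
    have h2 := interior_maximal h1 hWo
    rwa [S.convex.interior_closure_eq_interior_of_nonempty_interior
      (by rw [S.isOpen_left.interior_eq]; exact S.nonempty_left), S.isOpen_left.interior_eq] at h2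
  have hfr : ∀ z, J z ∈ frontier V → z ∉ U := by
    intro z hz hzU
    obtain ⟨x, hx, hxz⟩ := S.bijOn.surjOn hz
    obtain ⟨-, hν⟩ := S.outerNormal_spec hx
    have hν0 := S.outerNormal_ne_zero hx
    obtain ⟨p, hp, h3, h4, h5⟩ := hstar (outerNormal U x)
    have h6 := (S.mem_normalCone_image hp.1 hx hν0 h3 hν h4).1
    rw [hxz, hJz, h5, add_sub_add_left_eq_sub, ← map_sub, T.inner_map_map] at h6
    exact (inner_neg_of_mem_normalCone S.isOpen_left h3 hν0 hzU).ne h6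
  have hUW : U ⊆ J ⁻¹' V := by
    refine S.convex.isPreconnected.subset_of_closure_inter_subset hWo ?_ ?_
    · obtain ⟨v, hv⟩ := S.nonempty_right
      have h1 : J.symm v ∈ J ⁻¹' V := by rwa [mem_preimage, J.apply_symm_apply]
      exact ⟨_, hWU h1, h1⟩
    · rintro z ⟨hz, hzU⟩
      by_contra hzV
      refine hfr z ?_ hzU
      rw [S.isOpen_right.frontier_eq]
      exact ⟨closure_mono (image_preimage_subset _ _)
        (image_closure_subset_closure_image J.continuous (mem_image_of_mem J hz)), hzV⟩
  refine ⟨J, ?_⟩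
  rw [subset_antisymm hUW hWU, J.surjective.image_preimage]

end BoundaryIso

/-- a bounded convex plane domain with smooth boundary is uniquely
determined, in the class of all bounded plane domains with smooth boundaries, by
the condition of local isometry of boundaries in the relative metrics. -/
theorem bounded_convex_uniquely_determined
    (U : Set (EuclideanSpace ℝ (Fin 2)))
    (hU : IsDomainSet U) (hUbd : Bornology.IsBounded U)
    (hUconv : Convex ℝ U) (hUb : HasC1Boundary U) :
    ∀ V : Set (EuclideanSpace ℝ (Fin 2)), IsDomainSet V →
      Bornology.IsBounded V → HasC1Boundary V →
      (∃ f : EuclideanSpace ℝ (Fin 2) → EuclideanSpace ℝ (Fin 2),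
        IsBoundaryLocalIsometry U V f) →
      ∃ J : EuclideanSpace ℝ (Fin 2) ≃ᵢ EuclideanSpace ℝ (Fin 2), J '' U = V := by
  rintro V hV hVbd hVb ⟨f, hf⟩
  obtain ⟨ε, S⟩ := exists_boundaryIso hU.1 hU.2.nonempty hUbd hUconv hUb hV.1 hV.2.nonempty hVbd
    hVb hf
  exact S.exists_isometryEquiv

end
end

section
/- Let U be a strictly convex domain in ℝⁿ (n ≥ 2) and let f̄: ∂U → ℝⁿ be a mapping that is locally a Euclidean isometry, in the sense that for every point x ∈ ∂U there exist a radius r_x > 0 and a Euclidean isometry F_x: ℝⁿ → ℝⁿ such that F_x coincides with f̄ on ∂U ∩ B(x, r_x). Then there exists a single Euclidean isometry F: ℝⁿ → ℝⁿ such that F coincides with f̄ on all of ∂U; in particular |f̄(a) − f̄(b)| = |a − b| for all a, b ∈ ∂U. -/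
open Set Filter Metric Topology ENNReal

noncomputable section

/-- A strictly convex domain: convex, and the open segment joining any two
distinct points of its closure is contained in the domain. -/
def IsStrictlyConvexDomain {n : ℕ} (U : Set (EuclideanSpace ℝ (Fin n))) : Prop :=
  Convex ℝ U ∧ ∀ a ∈ closure U, ∀ b ∈ closure U, a ≠ b → openSegment ℝ a b ⊆ U

section StrictlyConvex

variable {E : Type*} [NormedAddCommGroup E] [InnerProductSpace ℝ E]

/-- In dimension at least two every linear functional has a nonzero kernel vector. -/
lemma exists_ne_zero_apply_eq_zero [FiniteDimensional ℝ E] (hE : 1 < Module.finrank ℝ E)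
    (f : StrongDual ℝ E) : ∃ w : E, w ≠ 0 ∧ f w = 0 := by
  have h : LinearMap.ker (f : E →ₗ[ℝ] ℝ) ≠ ⊥ :=
    LinearMap.ker_ne_bot_of_finrank_lt (by simpa using hE)
  obtain ⟨w, hw, hw0⟩ := Submodule.exists_mem_ne_zero_of_ne_bot h
  exact ⟨w, hw0, hw⟩

lemma exists_apply_pos {f : StrongDual ℝ E} (hf : f ≠ 0) : ∃ v : E, 0 < f v := by
  obtain ⟨v, hv⟩ : ∃ v, f v ≠ 0 := by
    by_contra! h
    exact hf (ContinuousLinearMap.ext h)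
  rcases lt_or_gt_of_ne hv with h | h
  · exact ⟨-v, by simpa using h⟩
  · exact ⟨v, h⟩

/-- An open set is entered by every line through one of its points. -/
lemma eventually_add_smul_mem {U : Set E} (hU : IsOpen U) {p : E} (hp : p ∈ U) (v : E) :
    ∀ᶠ t : ℝ in 𝓝[>] 0, p + t • v ∈ U := by
  have hc : Continuous fun t : ℝ => p + t • v := by fun_prop
  exact nhdsWithin_le_nhds (hc.continuousAt.preimage_mem_nhds (hU.mem_nhds (by simpa using hp)))

lemma exists_pos_add_smul_mem_ball (x : E) {r : ℝ} (hr : 0 < r) (v : E) :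
    ∃ t : ℝ, 0 < t ∧ x + t • v ∈ ball x r ∧ x + t • (-v) ∈ ball x r := by
  have h : ∀ v : E, ∀ᶠ t : ℝ in 𝓝[>] 0, x + t • v ∈ ball x r :=
    eventually_add_smul_mem isOpen_ball (mem_ball_self hr)
  exact ((eventually_mem_nhdsWithin (a := (0 : ℝ)) (s := Ioi 0)).and ((h v).and (h (-v)))).exists

lemma halfSpaces_inter_nonempty {f g : StrongDual ℝ E} (hf : f ≠ 0) {w : E}
    (hfw : f w = 0) (hgw : g w ≠ 0) (α β : ℝ) :
    ({z | α ≤ f z} ∩ {z | β ≤ g z}).Nonempty := by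
  obtain ⟨v, hv⟩ := exists_apply_pos hf
  refine ⟨(α / f v) • v + ((β - g ((α / f v) • v)) / g w) • w, ?_, ?_⟩
  · simp [hfw, hv.ne']
  · simp only [mem_ofPred_eq, map_add, map_smul, smul_eq_mul]
    rw [div_mul_cancel₀ _ hgw]
    linarith

lemma isPreconnected_halfSpace (f : StrongDual ℝ E) (α : ℝ) :
    IsPreconnected {z | α ≤ f z} :=
  (convex_halfSpace_ge f.toLinearMap.isLinear α).isPreconnected

/-- Two boundary points cannot be symmetric about a third one. -/
lemma add_notMem_or_sub_notMem_closure {U : Set E} (hU : IsOpen U)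
    (hs : ∀ a ∈ closure U, ∀ b ∈ closure U, a ≠ b → openSegment ℝ a b ⊆ U)
    {a : E} (ha : a ∈ frontier U) {w : E} (hw : w ≠ 0) :
    a + w ∉ closure U ∨ a - w ∉ closure U := by
  by_contra! h
  refine (hU.frontier_eq ▸ ha).2 (hs _ h.1 _ h.2 ?_ ?_)
  · intro e
    apply hw
    have : (2 : ℝ) • w = 0 := by
      rw [two_smul]
      calc w + w = (a + w) - (a - w) := by abel
        _ = 0 := sub_eq_zero.2 e
    simpa using this
  · refine ⟨1 / 2, 1 / 2, by norm_num, by norm_num, by norm_num, ?_⟩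
    module

/-- The boundary of a strictly convex set is not contained in a hyperplane near any of its
points. -/
lemma exists_frontier_apply_ne [FiniteDimensional ℝ E] (hE : 1 < Module.finrank ℝ E)
    {U : Set E} (hU : IsOpen U) (hconv : Convex ℝ U)
    (hs : ∀ a ∈ closure U, ∀ b ∈ closure U, a ≠ b → openSegment ℝ a b ⊆ U)
    {L : StrongDual ℝ E} (hL : L ≠ 0) {x : E} (hx : x ∈ frontier U) {r : ℝ} (hr : 0 < r) :
    ∃ z ∈ frontier U ∩ ball x r, L z ≠ L x := by
  have hxU : x ∉ U := (hU.frontier_eq ▸ hx).2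
  by_contra! hflat
  have half : ∀ M : StrongDual ℝ E, (∀ z ∈ frontier U ∩ ball x r, M z = M x) →
      (ball x r ∩ {z | M x < M z} ∩ U).Nonempty → ball x r ∩ {z | M x < M z} ⊆ U := by
    intro M hM hne
    by_contra hsub
    obtain ⟨p, hp, hpU⟩ := not_subset.1 hsub
    have hpre : IsPreconnected (ball x r ∩ {z | M x < M z}) :=
      ((convex_ball x r).inter
        (convex_halfSpace_gt M.toLinearMap.isLinear _)).isPreconnected
    have hcl : ∀ z ∈ ball x r ∩ {z | M x < M z}, z ∉ U → z ∉ closure U := fun z hz hzU hzc =>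
      hz.2.ne' (hM z ⟨hU.frontier_eq ▸ ⟨hzc, hzU⟩, hz.1⟩)
    obtain ⟨z, -, hzU, hzc⟩ := hpre U (closure U)ᶜ hU isClosed_closure.isOpen_compl
      (fun z hz => or_iff_not_imp_left.2 (hcl z hz)) hne ⟨p, hp, hcl p hp hpU⟩
    exact hzc (subset_closure hzU)
  have key : ∀ M : StrongDual ℝ E, M ≠ 0 → (∀ z ∈ frontier U ∩ ball x r, M z = M x) →
      (ball x r ∩ {z | M x < M z} ∩ U).Nonempty := by
    intro M hM0 hM
    by_contra hemp
    obtain ⟨v, hv⟩ := exists_apply_pos hM0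
    have hle : ∀ p ∈ U ∩ ball x r, M p < M x := by
      intro p hp
      by_contra! hcon
      obtain ⟨t, ht, htU⟩ := ((eventually_mem_nhdsWithin (a := (0 : ℝ)) (s := Ioi 0)).and
        (eventually_add_smul_mem (hU.inter isOpen_ball) hp v)).exists
      refine hemp ⟨p + t • v, ⟨htU.2, ?_⟩, htU.1⟩
      have : 0 < t * M v := mul_pos ht hv
      simp only [mem_ofPred_eq, map_add, map_smul, smul_eq_mul]
      linarith
    obtain ⟨q, hqB, hqU⟩ := mem_closure_iff.1 hx.1 _ isOpen_ball (mem_ball_self hr)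
    have hneg := half (-M) (fun z hz => by simp [hM z hz])
      ⟨q, ⟨hqB, by simpa using hle q ⟨hqU, hqB⟩⟩, hqU⟩
    have hcl : ∀ y ∈ ball x r, M y = M x → y ∈ closure U := by
      intro y hy hMy
      have htend : Tendsto (fun t : ℝ => y + t • (-v)) (𝓝[>] 0) (𝓝 y) := by
        have hc : Continuous fun t : ℝ => y + t • (-v) := by fun_prop
        simpa using (hc.tendsto 0).mono_left nhdsWithin_le_nhds
      refine mem_closure_of_tendsto htend ?_
      filter_upwards [eventually_mem_nhdsWithin, eventually_add_smul_mem isOpen_ball hy (-v)]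
        with t ht htB
      refine hneg ⟨htB, ?_⟩
      have : 0 < t * M v := mul_pos ht hv
      simp only [mem_ofPred_eq, map_add, map_smul, smul_eq_mul, neg_apply,
        map_neg, hMy]
      linarith
    obtain ⟨w, hw, hMw⟩ := exists_ne_zero_apply_eq_zero hE M
    obtain ⟨t, ht, htB, htB'⟩ := exists_pos_add_smul_mem_ball x hr w
    have htw : t • w ≠ 0 := smul_ne_zero (ne_of_gt ht) hw
    rcases add_notMem_or_sub_notMem_closure hU hs hx htw with h | h
    · exact h (hcl _ htB (by simp [hMw]))
    · exact h (hcl _ (by simpa [sub_eq_add_neg] using htB') (by simp [hMw]))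
  have hflat' : ∀ z ∈ frontier U ∩ ball x r, (-L) z = (-L) x := fun z hz => by
    simp [hflat z hz]
  have h₁ := half L hflat (key L hL hflat)
  have h₂ := half (-L) hflat' (key (-L) (neg_ne_zero.2 hL) hflat')
  obtain ⟨v, hv⟩ := exists_apply_pos hL
  obtain ⟨t, ht, htB, htB'⟩ := exists_pos_add_smul_mem_ball x hr v
  have htv : 0 < t * L v := mul_pos ht hv
  have hm := hconv (h₁ ⟨htB, by simpa using htv⟩) (h₂ ⟨htB', by simpa using htv⟩)
    (a := 1 / 2) (b := 1 / 2) (by norm_num) (by norm_num) (by norm_num)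
  refine hxU ?_
  convert hm using 1
  module

/-- Isometries that agree on a neighbourhood of a boundary point of a strictly convex set within
its boundary are equal. -/
lemma isometryEquiv_eq_of_eqOn_frontier [FiniteDimensional ℝ E] (hE : 1 < Module.finrank ℝ E)
    {U : Set E} (hU : IsOpen U) (hconv : Convex ℝ U)
    (hs : ∀ a ∈ closure U, ∀ b ∈ closure U, a ≠ b → openSegment ℝ a b ⊆ U)
    {F G : E ≃ᵢ E} {x : E} (hx : x ∈ frontier U) {r : ℝ} (hr : 0 < r)
    (h : EqOn F G (frontier U ∩ ball x r)) : F = G := by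
  by_contra hne
  obtain ⟨y, hy⟩ : ∃ y, F y ≠ G y := by
    by_contra! hcon
    exact hne (IsometryEquiv.ext hcon)
  let D : E →ᵃ[ℝ] E := F.toRealAffineIsometryEquiv.toAffineEquiv.toAffineMap -
    G.toRealAffineIsometryEquiv.toAffineEquiv.toAffineMap
  have hD : ∀ z, D z = F z - G z := fun z => rfl
  have hDx : D x = 0 := by rw [hD, h ⟨hx, mem_ball_self hr⟩, sub_self]
  have hlin : ∀ z, D.linear (z - x) = D z := fun z => by
    have := D.linearMap_vsub z x
    simpa [hDx] using this
  let L : StrongDual ℝ E := (innerSL ℝ (D y)).comp (LinearMap.toContinuousLinearMap D.linear)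
  have hLsub : ∀ z, L z - L x = inner ℝ (D y) (D z) := fun z => by
    rw [← map_sub, ← hlin z]
    rfl
  have hDy : D y ≠ 0 := by rw [hD]; exact sub_ne_zero.2 hy
  have hL : L ≠ 0 := by
    intro h0
    have := hLsub y
    rw [h0] at this
    simp only [zero_apply, sub_self, real_inner_self_eq_norm_sq] at this
    exact hDy (norm_eq_zero.1 (pow_eq_zero_iff two_ne_zero |>.1 this.symm))
  obtain ⟨z, hz, hLz⟩ := exists_frontier_apply_ne hE hU hconv hs hL hx hr
  apply hLz
  rw [← sub_eq_zero, hLsub, hD z, h hz]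
  simp

/-- The complement of a strictly convex set contains, for any two boundary points, a connected set
joining them. -/
lemma exists_isPreconnected_disjoint [FiniteDimensional ℝ E] (hE : 1 < Module.finrank ℝ E)
    {U : Set E} (hU : IsOpen U) (hconv : Convex ℝ U)
    (hs : ∀ a ∈ closure U, ∀ b ∈ closure U, a ≠ b → openSegment ℝ a b ⊆ U)
    {a b : E} (ha : a ∈ frontier U) (hb : b ∈ frontier U) :
    ∃ C : Set E, a ∈ C ∧ b ∈ C ∧ IsPreconnected C ∧ C ⊆ Uᶜ := by
  have haU : a ∉ U := (hU.frontier_eq ▸ ha).2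
  have hbU : b ∉ U := (hU.frontier_eq ▸ hb).2
  rcases eq_or_ne a b with rfl | hab
  · exact ⟨{a}, rfl, rfl, isPreconnected_singleton, by simpa using haU⟩
  obtain ⟨u, hu⟩ : U.Nonempty := closure_nonempty_iff.1 ⟨a, ha.1⟩
  have hne : ∀ {f : StrongDual ℝ E} {c : E}, (∀ u ∈ U, f u < f c) → f ≠ 0 := by
    rintro f c h rfl
    simpa using h u hu
  have hdisj : ∀ {f : StrongDual ℝ E} {c : E}, (∀ u ∈ U, f u < f c) →
      {z | f c ≤ f z} ⊆ Uᶜ := fun h z hz hzU => (h z hzU).not_ge hz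
  obtain ⟨f, hf⟩ := geometric_hahn_banach_open_point hconv hU haU
  obtain ⟨g, hg⟩ := geometric_hahn_banach_open_point hconv hU hbU
  by_cases hfg : ({z | f a ≤ f z} ∩ {z | g b ≤ g z}).Nonempty
  · exact ⟨{z | f a ≤ f z} ∪ {z | g b ≤ g z}, Or.inl (le_refl (f a)),
      Or.inr (le_refl (g b)),
      (isPreconnected_halfSpace f _).union' hfg (isPreconnected_halfSpace g _),
      union_subset (hdisj hf) (hdisj hg)⟩
  obtain ⟨w₀, hw₀, hfw₀⟩ := exists_ne_zero_apply_eq_zero hE f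
  obtain ⟨w, hfw, hw⟩ : ∃ w, f w = 0 ∧ a + w ∉ closure U := by
    rcases add_notMem_or_sub_notMem_closure hU hs ha hw₀ with h | h
    · exact ⟨w₀, hfw₀, h⟩
    · exact ⟨-w₀, by simp [hfw₀], by simpa [sub_eq_add_neg] using h⟩
  have hgw : g w = 0 := by
    by_contra hgw
    exact hfg (halfSpaces_inter_nonempty (hne hf) hfw hgw _ _)
  obtain ⟨t, ⟨ht0, ht1⟩, htU⟩ := ((eventually_mem_set.2 (Ioo_mem_nhdsGT (zero_lt_one (α := ℝ)))).and
    (eventually_add_smul_mem isClosed_closure.isOpen_compl hw (b - a))).exists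
  obtain ⟨h, hh⟩ := geometric_hahn_banach_open_point hconv hU
    (fun hc => htU (subset_closure hc))
  have hp : a + t • (b - a) ∈ U := by
    refine hs a ha.1 b hb.1 hab ⟨1 - t, t, by linarith, ht0, by ring, ?_⟩
    module
  have hhw : h w ≠ 0 := by
    have := hh _ hp
    simp only [map_add] at this
    linarith
  refine ⟨{z | f a ≤ f z} ∪ {z | h (a + w + t • (b - a)) ≤ h z} ∪ {z | g b ≤ g z},
    Or.inl (Or.inl (le_refl (f a))), Or.inr (le_refl (g b)), ?_,
    union_subset (union_subset (hdisj hf) (hdisj hh)) (hdisj hg)⟩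
  refine IsPreconnected.union' ?_ ((isPreconnected_halfSpace f _).union'
    (halfSpaces_inter_nonempty (hne hf) hfw hhw _ _) (isPreconnected_halfSpace h _))
    (isPreconnected_halfSpace g _)
  obtain ⟨z, hzg, hzh⟩ := halfSpaces_inter_nonempty (hne hg) hgw hhw (g b)
    (h (a + w + t • (b - a)))
  exact ⟨z, .inr hzh, hzg⟩

/-- A closed convex set admits a continuous retraction characterized by the obtuse angle
condition. -/
lemma exists_continuous_nearest_point [CompleteSpace E] {K : Set E} (hne : K.Nonempty)
    (hK : IsClosed K) (hconv : Convex ℝ K) :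
    ∃ π : E → E, Continuous π ∧ (∀ x, π x ∈ K) ∧
      ∀ x, ∀ w ∈ K, inner ℝ (x - π x) (w - π x) ≤ 0 := by
  choose π hπK hπ using exists_norm_eq_iInf_of_complete_convex hne hK.isComplete hconv
  have hin : ∀ x, ∀ w ∈ K, inner ℝ (x - π x) (w - π x) ≤ 0 := fun x =>
    (norm_eq_iInf_iff_real_inner_le_zero hconv (hπK x)).1 (hπ x)
  refine ⟨π, ?_, hπK, hin⟩
  refine (LipschitzWith.of_dist_le_mul (K := 1) fun x y => ?_).continuous
  rw [NNReal.coe_one, one_mul, dist_eq_norm, dist_eq_norm]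
  have hx := hin x (π y) (hπK y)
  have hy := hin y (π x) (hπK x)
  have hsq : ‖π x - π y‖ * ‖π x - π y‖ ≤ inner ℝ (x - y) (π x - π y) := by
    rw [← real_inner_self_eq_norm_mul_norm]
    simp only [inner_sub_left, inner_sub_right] at hx hy ⊢
    linarith
  have hcs := real_inner_le_norm (x - y) (π x - π y)
  rcases (norm_nonneg (π x - π y)).eq_or_lt with h0 | h0
  · rw [← h0]
    exact norm_nonneg _
  · exact le_of_mul_le_mul_right (hsq.trans hcs) h0

/-- The boundary of a strictly convex open set in dimension at least two is connected. -/
lemma isPreconnected_frontier_of_strictlyConvex [FiniteDimensional ℝ E]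
    (hE : 1 < Module.finrank ℝ E) {U : Set E} (hU : IsOpen U) (hconv : Convex ℝ U)
    (hs : ∀ a ∈ closure U, ∀ b ∈ closure U, a ≠ b → openSegment ℝ a b ⊆ U) :
    IsPreconnected (frontier U) := by
  refine isPreconnected_of_forall_pair fun a ha b hb => ?_
  have : CompleteSpace E := FiniteDimensional.complete ℝ E
  obtain ⟨π, hπc, hπK, hπ⟩ :=
    exists_continuous_nearest_point ⟨a, ha.1⟩ isClosed_closure hconv.closure
  have hfix : ∀ x ∈ closure U, π x = x := fun x hx => by
    have := hπ x x hx
    rw [real_inner_self_nonpos, sub_eq_zero] at this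
    exact this.symm
  have hout : ∀ x ∉ U, π x ∉ U := by
    intro x hx hπU
    obtain ⟨t, ht, htU⟩ := ((eventually_mem_nhdsWithin (a := (0 : ℝ)) (s := Ioi 0)).and
      (eventually_add_smul_mem hU hπU (x - π x))).exists
    have hle := hπ x _ (subset_closure htU)
    rw [add_sub_cancel_left, inner_smul_right] at hle
    have h0 : inner ℝ (x - π x) (x - π x) ≤ 0 := nonpos_of_mul_nonpos_right hle ht
    rw [real_inner_self_nonpos, sub_eq_zero] at h0
    exact hx (h0 ▸ hπU)
  obtain ⟨C, haC, hbC, hC, hCU⟩ := exists_isPreconnected_disjoint hE hU hconv hs ha hb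
  refine ⟨π '' C, ?_, ⟨a, haC, hfix a ha.1⟩, ⟨b, hbC, hfix b hb.1⟩,
    hC.image π hπc.continuousOn⟩
  rintro _ ⟨x, hx, rfl⟩
  rw [hU.frontier_eq]
  exact ⟨hπK x, hout x (hCU hx)⟩

end StrictlyConvex

/-- a map of the boundary of a strictly convex domain in `ℝⁿ`
(`n ≥ 2`) which locally coincides with Euclidean isometries of `ℝⁿ` coincides
on the whole boundary with a single Euclidean isometry; in particular it
preserves Euclidean distances between boundary points. -/
theorem local_euclidean_isometry_of_strictly_convex_boundary_extends
    (n : ℕ) (hn : 2 ≤ n)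
    (U : Set (EuclideanSpace ℝ (Fin n)))
    (hU : IsDomainSet U) (hUconv : IsStrictlyConvexDomain U)
    (fbar : EuclideanSpace ℝ (Fin n) → EuclideanSpace ℝ (Fin n))
    (hloc : ∀ x ∈ frontier U, ∃ r : ℝ, 0 < r ∧
      ∃ Fx : EuclideanSpace ℝ (Fin n) ≃ᵢ EuclideanSpace ℝ (Fin n),
        ∀ z ∈ frontier U ∩ Metric.ball x r, Fx z = fbar z) :
    (∃ F : EuclideanSpace ℝ (Fin n) ≃ᵢ EuclideanSpace ℝ (Fin n),
      ∀ z ∈ frontier U, F z = fbar z) ∧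
    ∀ a ∈ frontier U, ∀ b ∈ frontier U, dist (fbar a) (fbar b) = dist a b := by
  obtain ⟨hconv, hs⟩ := hUconv
  have hE : 1 < Module.finrank ℝ (EuclideanSpace ℝ (Fin n)) := by
    rw [finrank_euclideanSpace_fin]
    omega
  suffices hF : ∃ F : EuclideanSpace ℝ (Fin n) ≃ᵢ EuclideanSpace ℝ (Fin n),
      ∀ z ∈ frontier U, F z = fbar z by
    obtain ⟨F, hF⟩ := hF
    refine ⟨⟨F, hF⟩, fun a ha b hb => ?_⟩
    rw [← hF a ha, ← hF b hb, F.dist_eq]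
  rcases (frontier U).eq_empty_or_nonempty with hemp | ⟨x₀, hx₀⟩
  · exact ⟨IsometryEquiv.refl _, by simp [hemp]⟩
  choose! r hr F hF using hloc
  have hconst : ∀ y ∈ frontier U, F x₀ = F y := fun y hy => by
    refine (isPreconnected_frontier_of_strictlyConvex hE hU.1 hconv hs).induction₂
      (fun x y => F x = F y) (fun x hx => ?_) (fun _ _ _ _ _ _ => Eq.trans)
      (fun _ _ _ _ => Eq.symm) hx₀ hy
    filter_upwards [self_mem_nhdsWithin,
      mem_nhdsWithin_of_mem_nhds (ball_mem_nhds x (hr x hx))] with y hy hyx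
    obtain ⟨ε, hε, hsub⟩ := Metric.isOpen_iff.1
      ((isOpen_ball (x := x) (ε := r x)).inter (isOpen_ball (x := y) (ε := r y))) y
      ⟨hyx, mem_ball_self (hr y hy)⟩
    refine isometryEquiv_eq_of_eqOn_frontier hE hU.1 hconv hs hy hε fun z hz => ?_
    rw [hF x hx z ⟨hz.1, (hsub hz.2).1⟩, hF y hy z ⟨hz.1, (hsub hz.2).2⟩]
  refine ⟨F x₀, fun z hz => ?_⟩
  rw [hconst z hz]
  exact hF z hz z ⟨hz, mem_ball_self (hr z hz)⟩

end
end
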